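/- There is no nonzero integer k with #{(x, y) ∈ ℤ² : y² = x³ + k} = 2|k| (excluding the point at infinity), and the only nonzero integer k with #{(x, y) ∈ ℤ² : y² = x³ + k} + 1 = 2|k| (including the point at infinity) is k = -1. -/

import Mathlib

section

def pe : ℕ → ℚ
  | 0 => 1
  | s+1 => pe s / (((s:ℚ)+1)*((s:ℚ)+4/3))
def pg : ℕ → ℚ
  | 0 => 1
  | s+1 => pg s / (((s:ℚ)+1)*((s:ℚ)+2/3))
def pK : ℕ → ℚ
  | 0 => 1
  | s+1 => pK s * (((s:ℚ)+4/3)*((s:ℚ)+2/3))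

lemma pe_pos (s : ℕ) : 0 < pe s := by
  induction s with
  | zero => simp [pe]
  | succ s ih => simp only [pe]; positivity
lemma pg_pos (s : ℕ) : 0 < pg s := by
  induction s with
  | zero => simp [pg]
  | succ s ih => simp only [pg]; positivity
lemma pK_pos (s : ℕ) : 0 < pK s := by
  induction s with
  | zero => simp [pK]
  | succ s ih => simp only [pK]; positivity
lemma pe_succ (s : ℕ) : pe s = pe (s+1) * (((s:ℚ)+1)*((s:ℚ)+4/3)) := by
  simp only [pe]; field_simp
lemma pg_succ (s : ℕ) : pg s = pg (s+1) * (((s:ℚ)+1)*((s:ℚ)+2/3)) := by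
  simp only [pg]; field_simp

open Finset in
/-- weighted sums -/
noncomputable def wS (n : ℕ) (φ : ℚ → ℚ → ℚ) (α β : ℂ) : ℂ :=
  ∑ p ∈ antidiagonal n, ((φ p.1 p.2 * pe p.1 * pg p.2 : ℚ) : ℂ) * α ^ p.1 * β ^ p.2

open Finset in
lemma wS_alpha (n : ℕ) (φ : ℚ → ℚ → ℚ) (α β : ℂ) :
    α * wS n φ α β = wS (n+1) (fun s m => φ (s-1) m * (s*(s+1/3))) α β := by
  unfold wS
  rw [Finset.Nat.sum_antidiagonal_succ, Finset.mul_sum]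
  simp only [Nat.cast_zero, zero_mul, mul_zero, Rat.cast_zero, zero_add]
  apply Finset.sum_congr rfl
  intro p _
  rw [pe_succ p.1]
  push_cast
  ring_nf

open Finset in
lemma wS_beta (n : ℕ) (φ : ℚ → ℚ → ℚ) (α β : ℂ) :
    β * wS n φ α β = wS (n+1) (fun s m => φ s (m-1) * (m*(m-1/3))) α β := by
  unfold wS
  rw [Finset.Nat.sum_antidiagonal_succ', Finset.mul_sum]
  simp only [Nat.cast_zero, zero_mul, mul_zero, Rat.cast_zero, zero_add]
  apply Finset.sum_congr rfl
  intro p _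
  rw [pg_succ p.2]
  push_cast
  ring_nf

noncomputable def PP (n : ℕ) (α β : ℂ) : ℂ := (pK n : ℂ) * wS n (fun _ _ => 1) α β

open Finset in
lemma wS_lin (n : ℕ) (α β : ℂ) (a b c : ℂ) (φ ψ χ : ℚ → ℚ → ℚ) (a' b' c' : ℚ) (ha : a = a') (hb : b = b')
   (hc : c = c')
   (h : ∀ s m : ℚ, s + m = n → a' * φ s m + b' * ψ s m + c' * χ s m = 0) :
   a * wS n φ α β + b * wS n ψ α β + c * wS n χ α β = 0 := by
  unfold wS
  rw [Finset.mul_sum, Finset.mul_sum, Finset.mul_sum, ← Finset.sum_add_distrib, ← Finset.sum_add_distrib]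
  apply Finset.sum_eq_zero
  intro p hp
  have hp' := mem_antidiagonal.mp hp
  have := h p.1 p.2 (by rw [← hp']; push_cast; ring)
  have h2 : (a':ℂ) * (φ p.1 p.2 : ℚ) + b' * (ψ p.1 p.2 : ℚ) + c' * (χ p.1 p.2 : ℚ) = 0 := by
    exact_mod_cast congrArg (fun q : ℚ => (q:ℂ)) this
  rw [ha, hb, hc]
  push_cast
  linear_combination ((pe p.1 : ℂ) * pg p.2 * α ^ p.1 * β ^ p.2) * h2

lemma PP_rec (n : ℕ) (α β : ℂ) :
    ((n:ℂ)+2) * PP (n+2) α β = (2*n+3) * (α+β) * PP (n+1) α β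
      - ((n+1) - 1/(9*((n:ℂ)+1))) * (α-β)^2 * PP n α β := by
  have h1 : (α+β) * wS (n+1) (fun _ _ => 1) α β =
      wS (n+2) (fun s m => s*(s+1/3) + m*(m-1/3)) α β := by
    rw [add_mul, wS_alpha, wS_beta]
    unfold wS
    rw [← Finset.sum_add_distrib]
    apply Finset.sum_congr rfl
    intro p _
    push_cast; ring
  have h2 : (α-β)^2 * wS n (fun _ _ => 1) α β =
      wS (n+2) (fun s m => (s-1)*(s-1+1/3)*(s*(s+1/3)) - 2*(s*(s+1/3))*(m*(m-1/3))
        + (m-1)*(m-1-1/3)*(m*(m-1/3))) α β := by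
    have : (α-β)^2 * wS n (fun _ _ => 1) α β = α * (α * wS n (fun _ _ => 1) α β)
      - 2 * (α * (β * wS n (fun _ _ => 1) α β)) + β * (β * wS n (fun _ _ => 1) α β) := by ring
    rw [this, wS_alpha, wS_alpha, wS_beta, wS_alpha, wS_beta]
    unfold wS
    rw [Finset.mul_sum, ← Finset.sum_sub_distrib, ← Finset.sum_add_distrib]
    apply Finset.sum_congr rfl
    intro p _
    push_cast; ring
  have h3 := wS_lin (n+2) α β (((n:ℂ)+2)*(((n:ℂ)+1+4/3)*((n:ℂ)+1+2/3))) (-(2*n+3)) (1/((n:ℂ)+1)) (fun _ _ => 1)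
    (fun s m => s*(s+1/3) + m*(m-1/3)) (fun s m => (s-1)*(s-1+1/3)*(s*(s+1/3)) - 2*(s*(s+1/3))*(m*(m-1/3))
        + (m-1)*(m-1-1/3)*(m*(m-1/3))) (((n:ℚ)+2)*(((n:ℚ)+1+4/3)*((n:ℚ)+1+2/3))) (-(2*n+3)) (1/((n:ℚ)+1))
        (by push_cast; ring) (by push_cast; ring) (by push_cast; ring) (by
          intro s m hsm
          have : s = n + 2 - m := by push_cast at hsm; linarith
          subst this
          have : (n:ℚ)+1 ≠ 0 := by positivity
          field_simp
          ring)
  have hn : (n:ℂ)+1 ≠ 0 := by exact_mod_cast Nat.succ_ne_zero n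
  rw [← h1, ← h2] at h3
  have k1 : (pK (n+2) : ℂ) = pK (n+1) * (((n:ℂ)+1+4/3)*((n:ℂ)+1+2/3)) := by
    simp only [pK]; push_cast; ring
  have k2 : (pK (n+1) : ℂ) = pK n * (((n:ℂ)+4/3)*((n:ℂ)+2/3)) := by
    simp only [pK]; push_cast; ring
  unfold PP
  rw [k1]
  have h4 : ((n:ℂ)+1) - 1/(9*((n:ℂ)+1)) = (((n:ℂ)+4/3)*((n:ℂ)+2/3)) * (1/((n:ℂ)+1)) := by
    field_simp; ring
  rw [h4]
  have h5 : (((n:ℂ)+4/3)*((n:ℂ)+2/3)) * (1/((n:ℂ)+1)) * (α-β)^2 * ((pK n:ℂ) * wS n (fun _ _ => 1) α β)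
    = (pK (n+1):ℂ) * ((1/((n:ℂ)+1)) * ((α-β)^2 * wS n (fun _ _ => 1) α β)) := by rw [k2]; ring
  rw [h5]
  linear_combination (pK (n+1):ℂ) * h3

lemma PP_zero (α β : ℂ) : PP 0 α β = 1 := by
  simp [PP, wS, pK, pe, pg]
lemma PP_one (α β : ℂ) : PP 1 α β = (2/3) * α + (4/3) * β := by
  simp [PP, wS, pK, pe, pg, Finset.Nat.antidiagonal_succ]; ring

end
section
open Polynomial

/-- coefficient sequence -/
def ca (n s : ℕ) : ℚ := if s ≤ n then pe s * pg (n - s) else 0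

lemma ca_succ (n s : ℕ) : ((s:ℚ)+1)*((s:ℚ)+4/3) * ca n (s+1) = ((n:ℚ)-s)*((n:ℚ)-1/3-s) * ca n s := by
  unfold ca
  rcases lt_trichotomy s n with h | h | h
  · rw [if_pos (by omega), if_pos (by omega)]
    obtain ⟨m, rfl⟩ : ∃ m, n = s + 1 + m := ⟨n - s - 1, by omega⟩
    rw [show s + 1 + m - (s+1) = m by omega, show s + 1 + m - s = m + 1 by omega, pe_succ s, pg_succ m]
    push_cast; ring
  · subst h; simp
  · rw [if_neg (by omega), if_neg (by omega)]; simp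

/-- reversed -/
def cb (n s : ℕ) : ℚ := if s ≤ n then pe (n - s) * pg s else 0

lemma cb_succ (n s : ℕ) : ((s:ℚ)+1)*((s:ℚ)+2/3) * cb n (s+1) = ((n:ℚ)-s)*((n:ℚ)+1/3-s) * cb n s := by
  unfold cb
  rcases lt_trichotomy s n with h | h | h
  · rw [if_pos (by omega), if_pos (by omega)]
    obtain ⟨m, rfl⟩ : ∃ m, n = s + 1 + m := ⟨n - s - 1, by omega⟩
    rw [show s + 1 + m - (s+1) = m by omega, show s + 1 + m - s = m + 1 by omega, pg_succ s, pe_succ m]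
    push_cast; ring
  · subst h; simp
  · rw [if_neg (by omega), if_neg (by omega)]; simp

noncomputable def pA (n : ℕ) : ℚ[X] := ∑ s ∈ Finset.range (n+1), C (ca n s) * X ^ s
noncomputable def pB (n : ℕ) : ℚ[X] := ∑ s ∈ Finset.range (n+1), C (cb n s) * X ^ s

lemma pA_coeff (n s : ℕ) : (pA n).coeff s = ca n s := by
  simp only [pA, finsetSum_coeff, coeff_C_mul_X_pow]
  simp [ca]
  omega
lemma pB_coeff (n s : ℕ) : (pB n).coeff s = cb n s := by
  simp only [pB, finsetSum_coeff, coeff_C_mul_X_pow]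
  simp [cb]
  omega

noncomputable def th (p : ℚ[X]) : ℚ[X] := X * derivative p
lemma th_coeff (p : ℚ[X]) (s : ℕ) : (th p).coeff s = s * p.coeff s := by
  unfold th
  cases s with
  | zero => simp
  | succ s => rw [coeff_X_mul, coeff_derivative]; push_cast; ring

lemma ode_gen (p : ℚ[X]) (n : ℕ) (u : ℚ) (h : ∀ s : ℕ, ((s:ℚ)+1)*((s:ℚ)+1+u) * p.coeff (s+1) = ((n:ℚ)-s)*((n:ℚ)-u-s) * p.coeff s) :
   (1 - X) * th (th p) = - C u * th p + X * (C (u - 2 * (n:ℚ)) * th p + C ((n:ℚ)*(n-u)) * p) := by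
  ext s
  rw [sub_mul, one_mul]
  simp only [coeff_add, coeff_sub, neg_mul, coeff_neg, coeff_C_mul, th_coeff]
  cases s with
  | zero => simp
  | succ s =>
    simp only [coeff_X_mul, coeff_add, coeff_C_mul, th_coeff]
    have := h s
    push_cast
    linear_combination this

lemma ode_A (n : ℕ) : (1 - X) * th (th (pA n)) = - C (1/3) * th (pA n) + X * (C (1/3 - 2 * (n:ℚ)) * th (pA n) + C ((n:ℚ)*(n-1/3)) * pA n) := by
  apply ode_gen
  intro s; rw [pA_coeff, pA_coeff]; linear_combination ca_succ n s
lemma ode_B (n : ℕ) : (1 - X) * th (th (pB n)) = - C (-1/3) * th (pB n) + X * (C (-1/3 - 2 * (n:ℚ)) * th (pB n) + C ((n:ℚ)*(n-(-1/3))) * pB n) := by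
  apply ode_gen
  intro s; rw [pB_coeff, pB_coeff]; linear_combination cb_succ n s

noncomputable def pW (n : ℕ) : ℚ[X] := pA n * pB n + 3 * (th (pA n) * pB n - pA n * th (pB n))

lemma pW_ode (n : ℕ) : (1 - X) * derivative (pW n) = - (2 * C (n:ℚ)) * pW n := by
  have hx : X * ((1 - X) * derivative (pW n)) = X * (- (2 * C (n:ℚ)) * pW n) := by
    have e1 : X * derivative (pW n) = th (pA n) * pB n + pA n * th (pB n) +
       3 * (th (th (pA n)) * pB n - pA n * th (th (pB n))) := by
      unfold pW
      simp only [derivative_add, derivative_mul, derivative_sub]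
      have : derivative (3:ℚ[X]) = 0 := by simp
      rw [this]
      simp only [th]
      ring
    have a := ode_A n
    have b := ode_B n
    have c1 : (C (1/3 - 2 * (n:ℚ)) : ℚ[X]) = C (1/3) - 2 * C (n:ℚ) := by
      rw [C_sub, C_mul]; rfl
    have c2 : (C (-1/3 - 2 * (n:ℚ)) : ℚ[X]) = - C (1/3) - 2 * C (n:ℚ) := by
      rw [C_sub, C_mul, neg_div, C_neg]; rfl
    have c3 : (C ((n:ℚ)*(n-1/3)) : ℚ[X]) = C (n:ℚ) * (C (n:ℚ) - C (1/3)) := by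
      rw [C_mul, C_sub]
    have c4 : (C ((n:ℚ)*(n-(-1/3))) : ℚ[X]) = C (n:ℚ) * (C (n:ℚ) + C (1/3)) := by
      rw [neg_div, sub_neg_eq_add, C_mul, C_add]
    have c5 : (C (-1/3) : ℚ[X]) = - C (1/3) := by rw [neg_div, C_neg]
    have c6 : 3 * (C (1/3) : ℚ[X]) = 1 := by
      rw [show (3:ℚ[X]) = C 3 by rfl, ← C_mul]; norm_num
    rw [c1, c3] at a
    rw [c2, c4, c5] at b
    rw [mul_left_comm, e1]
    unfold pW
    generalize th (th (pA n)) = A2 at *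
    generalize th (th (pB n)) = B2 at *
    generalize th (pA n) = A1 at *
    generalize th (pB n) = B1 at *
    generalize (C (n:ℚ)) = N at *
    generalize (C (1/3:ℚ)) = t at *
    linear_combination 3 * pB n * a - 3 * pA n * b + (-(1 - X) * (A1 * pB n + pA n * B1) - 2 * X * N * pA n * pB n) * c6
  exact mul_left_cancel₀ X_ne_zero hx

lemma ca_pos {n s : ℕ} (h : s ≤ n) : 0 < ca n s := by
  rw [ca, if_pos h]; exact mul_pos (pe_pos _) (pg_pos _)
lemma cb_eq {n s : ℕ} (h : s ≤ n) : cb n s = ca n (n - s) := by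
  rw [cb, ca, if_pos h, if_pos (by omega), show n - (n - s) = s by omega]

lemma pA_one_pos (n : ℕ) : 0 < (pA n).eval 1 := by
  simp only [pA, eval_finsetSum]
  simp
  apply Finset.sum_pos
  · intro s hs; exact ca_pos (by simpa [Nat.lt_succ_iff] using hs)
  · simp
lemma pB_one (n : ℕ) : (pB n).eval 1 = (pA n).eval 1 := by
  simp only [pA, pB, eval_finsetSum]
  simp
  rw [← Finset.sum_range_reflect]
  apply Finset.sum_congr rfl
  intro s hs
  have hs' : s ≤ n := by simpa [Nat.lt_succ_iff] using hs
  rw [cb_eq (by omega)]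
  congr 1; omega

lemma pW_dvd (n : ℕ) : (X - C 1) ^ (2 * n) ∣ pW n := by
  have h0 : pW n ≠ 0 := by
    intro h
    have : (pW n).eval 0 = 0 := by rw [h]; simp
    simp only [pW, th, eval_add, eval_mul, eval_sub, eval_X, zero_mul, mul_zero, sub_zero, add_zero] at this
    rw [← coeff_zero_eq_eval_zero, ← coeff_zero_eq_eval_zero, pA_coeff, pB_coeff, cb_eq (by omega)] at this
    have h1 := ca_pos (Nat.zero_le n)
    have h2 := ca_pos (show n - 0 ≤ n by omega)
    have := mul_pos h1 h2
    linarith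
  obtain ⟨V, hV, hV1⟩ := exists_eq_pow_rootMultiplicity_mul_and_not_dvd (pW n) h0 1
  generalize rootMultiplicity 1 (pW n) = m at *
  have ode := pW_ode n
  rw [hV] at ode ⊢
  have hd : derivative ((X - C (1:ℚ)) ^ m * V) * (X - C 1) = (X - C 1) ^ m * (C (m:ℚ) * V + (X - C 1) * derivative V) := by
    rw [derivative_mul, derivative_X_sub_C_pow]
    rcases m with _ | m
    · simp; ring
    · simp; ring
  have h2 : (X - C (1:ℚ)) ^ m * (C (m:ℚ) * V + (X - C 1) * derivative V) = (X - C 1) ^ m * (2 * C (n:ℚ) * V) := by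
    rw [← hd]
    rw [show (1:ℚ[X]) - X = -(X - C 1) by simp] at ode
    linear_combination - ode
  have hne : (X - C (1:ℚ)) ^ m ≠ 0 := pow_ne_zero _ (X_sub_C_ne_zero 1)
  have h3 := congrArg (eval 1) (mul_left_cancel₀ hne h2)
  simp at h3
  rcases h3 with h3 | h3
  · have : m = 2 * n := by exact_mod_cast h3
    rw [this]; exact dvd_mul_right _ _
  · exact absurd (dvd_iff_isRoot.mpr h3) hV1

lemma pade_dvd (n : ℕ) : (X - C 1) ^ (2 * n + 1) ∣ X * pA n ^ 3 - pB n ^ 3 := by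
  set δ := X * pA n ^ 3 - pB n ^ 3 with hδ
  have hW : derivative δ * pB n ^ 3 - δ * derivative (pB n ^ 3) = pA n ^ 2 * pB n ^ 2 * pW n := by
    rw [hδ, pW]
    simp only [th, derivative_sub, derivative_mul, derivative_X, derivative_pow]
    have c3 : (C 3 : ℚ[X]) = 3 := rfl
    simp [c3]
    ring
  have hB1 : (pB n).eval 1 ≠ 0 := by rw [pB_one]; exact (pA_one_pos n).ne'
  have h0 : δ ≠ 0 := by
    intro h
    have : δ.eval 0 = 0 := by rw [h]; simp
    simp [hδ, ← coeff_zero_eq_eval_zero, pB_coeff, cb_eq] at this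
    exact absurd this (ca_pos le_rfl).ne'
  obtain ⟨V, hV, hV1⟩ := exists_eq_pow_rootMultiplicity_mul_and_not_dvd δ h0 1
  have hroot : δ.IsRoot 1 := by
    simp [hδ, IsRoot, pB_one]
  have hm : 0 < rootMultiplicity 1 δ := (rootMultiplicity_pos h0).mpr hroot
  generalize rootMultiplicity 1 δ = m at *
  obtain ⟨m, rfl⟩ : ∃ k, m = k + 1 := ⟨m - 1, by omega⟩
  by_cases hmn : 2 * n ≤ m
  · rw [hV]
    exact Dvd.dvd.mul_right (pow_dvd_pow _ (by omega)) _
  exfalso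
  obtain ⟨Z, hZ⟩ := pW_dvd n
  obtain ⟨j, hj⟩ : ∃ j, 2 * n = m + 1 + j := ⟨2 * n - m - 1, by omega⟩
  rw [hZ, hV, hj, derivative_mul, derivative_X_sub_C_pow] at hW
  have h2 : (X - C (1:ℚ)) ^ m * (C ((m:ℚ)+1) * V * pB n ^ 3 + (X - C 1) * (derivative V * pB n ^ 3 - V * derivative (pB n ^ 3)))
    = (X - C 1) ^ m * ((X - C 1) * (pA n ^ 2 * pB n ^ 2 * (X - C 1) ^ j * Z)) := by
    have : (C ((m+1:ℕ):ℚ) : ℚ[X]) = C ((m:ℚ)+1) := by push_cast; rfl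
    rw [← this]
    simp only [Nat.add_sub_cancel] at hW
    linear_combination hW
  have hne : (X - C (1:ℚ)) ^ m ≠ 0 := pow_ne_zero _ (X_sub_C_ne_zero 1)
  have h3 := congrArg (eval 1) (mul_left_cancel₀ hne h2)
  simp at h3
  rcases h3 with (h3 | h3) | h3
  · have : (0:ℚ) < m + 1 := by positivity
    linarith
  · exact hV1 (dvd_iff_isRoot.mpr h3)
  · exact hB1 h3

end
section
open Polynomial

lemma pA_degree (n : ℕ) : (pA n).natDegree ≤ n := by
  rw [natDegree_le_iff_coeff_eq_zero]
  intro N hN; rw [pA_coeff, ca, if_neg (by omega)]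
lemma pB_degree (n : ℕ) : (pB n).natDegree ≤ n := by
  rw [natDegree_le_iff_coeff_eq_zero]
  intro N hN; rw [pB_coeff, cb, if_neg (by omega)]

lemma exists_S (n : ℕ) : ∃ S : ℚ[X], S.natDegree ≤ n ∧ X * pA n ^ 3 - pB n ^ 3 = (X - C 1) ^ (2 * n + 1) * S := by
  obtain ⟨S, hS⟩ := pade_dvd n
  refine ⟨S, ?_, hS⟩
  by_cases h0 : S = 0
  · simp [h0]
  have h1 : (X * pA n ^ 3 - pB n ^ 3).natDegree ≤ 3 * n + 1 := by
    apply (natDegree_sub_le _ _).trans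
    apply max_le
    · apply natDegree_mul_le.trans
      have := natDegree_pow_le (p := pA n) (n := 3)
      have := pA_degree n
      have := natDegree_X_le (R := ℚ)
      omega
    · have := natDegree_pow_le (p := pB n) (n := 3)
      have := pB_degree n
      omega
  rw [hS, natDegree_mul (pow_ne_zero _ (X_sub_C_ne_zero 1)) h0, natDegree_pow, natDegree_X_sub_C] at h1
  omega

lemma PP_pA (n : ℕ) (α β : ℂ) (hβ : β ≠ 0) : PP n α β = pK n * β ^ n * aeval (α / β) (pA n) := by
  unfold PP wS pA
  rw [Finset.Nat.sum_antidiagonal_eq_sum_range_succ_mk, map_sum, mul_assoc]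
  congr 1
  rw [Finset.mul_sum]
  apply Finset.sum_congr rfl
  intro s hs
  have hs' : s ≤ n := by simpa [Nat.lt_succ_iff] using hs
  obtain ⟨m, rfl⟩ : ∃ m, n = s + m := ⟨n - s, by omega⟩
  simp [ca, div_pow, pow_add]
  field_simp
lemma PP_pB (n : ℕ) (α β : ℂ) (hβ : β ≠ 0) : PP n β α = pK n * β ^ n * aeval (α / β) (pB n) := by
  unfold PP wS pB
  rw [← Finset.Nat.sum_antidiagonal_swap, Finset.Nat.sum_antidiagonal_eq_sum_range_succ_mk, map_sum, mul_assoc]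
  congr 1
  rw [Finset.mul_sum]
  apply Finset.sum_congr rfl
  intro s hs
  have hs' : s ≤ n := by simpa [Nat.lt_succ_iff] using hs
  obtain ⟨m, rfl⟩ : ∃ m, n = s + m := ⟨n - s, by omega⟩
  simp [cb, div_pow, pow_add]
  field_simp

lemma exists_ST (n : ℕ) : ∃ c : ℕ → ℂ, ∀ α β : ℂ, β ≠ 0 →
    α * PP n α β ^ 3 - β * PP n β α ^ 3 = (α - β) ^ (2 * n + 1) * ∑ j ∈ Finset.range (n+1), c j * α ^ j * β ^ (n - j) := by
  obtain ⟨S, hd, hS⟩ := exists_S n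
  refine ⟨fun j => (pK n : ℂ) ^ 3 * (S.coeff j : ℚ), fun α β hβ => ?_⟩
  rw [PP_pA n α β hβ, PP_pB n α β hβ]
  have h := congrArg (aeval (α / β)) hS
  simp only [map_sub, map_mul, map_pow, aeval_X] at h
  have hs : β ^ n * aeval (α / β) S = ∑ j ∈ Finset.range (n+1), ((S.coeff j : ℚ) : ℂ) * α ^ j * β ^ (n - j) := by
    rw [aeval_eq_sum_range' (Nat.lt_succ_of_le hd), Finset.mul_sum]
    apply Finset.sum_congr rfl
    intro s hs
    have hs' : s ≤ n := by simpa [Nat.lt_succ_iff] using hs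
    obtain ⟨m, rfl⟩ : ∃ m, n = s + m := ⟨n - s, by omega⟩
    simp [div_pow, pow_add, Rat.smul_def]
    field_simp
  have e1 : α = β * (α / β) := by field_simp
  have e2 : α - β = β * (α / β - 1) := by field_simp
  have : ∑ j ∈ Finset.range (n+1), (pK n : ℂ) ^ 3 * ((S.coeff j : ℚ) : ℂ) * α ^ j * β ^ (n - j) = (pK n : ℂ)^3 * (β ^ n * aeval (α / β) S) := by
    rw [hs, Finset.mul_sum]
    apply Finset.sum_congr rfl; intros; ring
  rw [this, e2]
  simp only [map_one] at h
  generalize α / β = z at *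
  rw [e1, mul_pow β (z-1)]
  linear_combination (β^(3*n+1) * (pK n : ℂ)^3) * h

lemma PP_bound8 (t : ℂ) (ht : ‖t‖ ^ 2 = 8) (n : ℕ) : ‖PP n (1+t) (1-t)‖ ≤ 8 ^ n ∧ ‖PP (n+1) (1+t) (1-t)‖ ≤ 8 ^ (n+1) := by
  induction n with
  | zero =>
    refine ⟨by simp [PP_zero], ?_⟩
    rw [zero_add, PP_one, show (2/3:ℂ)*(1+t)+4/3*(1-t) = 2 - (2/3) * t by ring]
    have : ‖t‖ ≤ 3 := by nlinarith [norm_nonneg t]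
    calc _ ≤ ‖(2:ℂ)‖ + ‖(2/3) * t‖ := norm_sub_le _ _
      _ ≤ 2 + (2/3) * 3 := by
        rw [norm_mul]; norm_num; linarith
      _ ≤ _ := by norm_num
  | succ n ih =>
    refine ⟨ih.2, ?_⟩
    have h := PP_rec n (1+t) (1-t)
    have h1 : ‖((n:ℂ)+2) * PP (n+2) (1+t) (1-t)‖ = ((n:ℝ)+2) * ‖PP (n+2) (1+t) (1-t)‖ := by
      rw [norm_mul]; congr 1
      rw [show ((n:ℂ)+2) = ((n+2:ℕ):ℂ) by push_cast; ring, Complex.norm_natCast]; push_cast; ring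
    have h2 : ‖(2*(n:ℂ)+3)*(1+t+(1-t))* PP (n+1) (1+t) (1-t)‖ ≤ (2*(n:ℝ)+3)*2*8^(n+1) := by
      rw [norm_mul, norm_mul, show (1+t+(1-t)) = 2 by ring, show (2*(n:ℂ)+3) = ((2*n+3:ℕ):ℂ) by push_cast; ring, Complex.norm_natCast]
      push_cast
      gcongr
      · simp
      · exact ih.2
    have h3 : ‖((n+1) - 1/(9*((n:ℂ)+1))) * (1+t-(1-t))^2 * PP n (1+t) (1-t)‖ ≤ ((n:ℝ)+1)*32*8^n := by
      rw [norm_mul, norm_mul, show (1+t-(1-t))^2 = 4*t^2 by ring, norm_mul, norm_pow, ht]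
      have : ‖((n+1) - 1/(9*((n:ℂ)+1)))‖ ≤ (n:ℝ)+1 := by
        rw [show ((n:ℂ)+1) - 1/(9*((n:ℂ)+1)) = (((n:ℝ)+1 - 1/(9*((n:ℝ)+1)) : ℝ) : ℂ) by push_cast; ring, Complex.norm_real, Real.norm_eq_abs, abs_le]
        have a1 : 1/(9*((n:ℝ)+1)) ≤ 1 := by rw [div_le_one (by positivity)]; linarith [(Nat.cast_nonneg n : (0:ℝ) ≤ n)]
        have a2 : 0 ≤ 1/(9*((n:ℝ)+1)) := by positivity
        constructor <;> linarith [(Nat.cast_nonneg n : (0:ℝ) ≤ n)]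
      have e : ‖(4:ℂ)‖ * 8 = 32 := by norm_num
      rw [e]
      gcongr
      exact ih.1
    have h4 : ((n:ℝ)+2) * ‖PP (n+2) (1+t) (1-t)‖ ≤ (2*(n:ℝ)+3)*2*8^(n+1) + ((n:ℝ)+1)*32*8^n := by
      rw [← h1, h]
      exact (norm_sub_le _ _).trans (add_le_add h2 h3)
    have h5 : (2*(n:ℝ)+3)*2*8^(n+1) + ((n:ℝ)+1)*32*8^n ≤ ((n:ℝ)+2) * 8^(n+2) := by
      rw [pow_succ _ (n+1), pow_succ]
      have : (0:ℝ) < 8^n := by positivity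
      linarith
    exact le_of_mul_le_mul_left (h4.trans h5) (by positivity)

lemma PP_bound8' (t : ℂ) (ht : ‖t‖ ^ 2 = 8) (n : ℕ) : ‖PP n (1-t) (1+t)‖ ≤ 8 ^ n := by
  have := (PP_bound8 (-t) (by simpa using ht) n).1
  simpa [sub_eq_add_neg] using this

lemma norm_pm (t : ℂ) : ‖1+t‖ + ‖1-t‖ ≤ 2 * Real.sqrt (1 + ‖t‖^2) := by
  have h : ‖1+t‖^2 + ‖1-t‖^2 = 2 * (1 + ‖t‖^2) := by
    have := parallelogram_law_with_norm ℝ (1:ℂ) t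
    simp only [norm_one] at this; linarith
  have h2 : (‖1+t‖ + ‖1-t‖)^2 ≤ (2 * Real.sqrt (1 + ‖t‖^2))^2 := by
    rw [mul_pow, Real.sq_sqrt (by positivity)]
    linarith [sq_nonneg (‖1+t‖ - ‖1-t‖)]
  exact le_trans (le_abs_self _) (abs_le_of_sq_le_sq h2 (by positivity))

lemma PP_hom (n : ℕ) (y α β : ℂ) : PP n (y*α) (y*β) = y^n * PP n α β := by
  unfold PP wS
  rw [mul_left_comm]
  congr 1
  rw [Finset.mul_sum]
  apply Finset.sum_congr rfl
  intro p hp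
  rw [← Finset.HasAntidiagonal.mem_antidiagonal.mp hp, mul_pow, mul_pow, pow_add]; ring

theorem E_bound (n : ℕ) (κ : ℂ) (y : ℝ) (hy : 0 < y) (hk : ‖κ‖ < y) :
    ‖(y+κ) * PP n (y+κ) (y-κ) ^ 3 - (y-κ) * PP n (y-κ) (y+κ) ^ 3‖
      ≤ 2 * ‖κ‖ * ((107/100) * (64 * ‖κ‖^2 * y)^n) := by
  obtain ⟨c, hc⟩ := exists_ST n
  set f : ℂ → ℂ := fun t => ∑ j ∈ Finset.range (n+1), c j * (1+t) ^ j * (1-t) ^ (n - j) with hf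
  have hfd : Differentiable ℂ f := by fun_prop
  have hs8 : Real.sqrt 8 ^ 2 = 8 := Real.sq_sqrt (by norm_num)
  have hs8p : 2.8284 < Real.sqrt 8 := Real.lt_sqrt_of_sq_lt (by norm_num)
  have hbd : ∀ t : ℂ, ‖t‖ = Real.sqrt 8 → ‖f t‖ ≤ (107/100) * 16 ^ n := by
    intro t ht
    have ht8 : ‖t‖^2 = 8 := by rw [ht, hs8]
    have hne : (1 - t) ≠ 0 := by
      intro h
      have : t = 1 := by linear_combination -h
      rw [this] at ht8; norm_num at ht8
    have h := hc (1+t) (1-t) hne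
    rw [show 1+t-(1-t) = 2*t by ring] at h
    have h1 : ‖(2*t)^(2*n+1) * f t‖ ≤ 6 * 512^n := by
      rw [← h]
      refine (norm_sub_le _ _).trans ?_
      rw [norm_mul, norm_mul, norm_pow, norm_pow]
      have a1 := (PP_bound8 t ht8 n).1
      have a2 := PP_bound8' t ht8 n
      have b1 : ‖PP n (1+t) (1-t)‖^3 ≤ 512^n := by
        calc _ ≤ ((8:ℝ)^n)^3 := by gcongr
          _ = _ := by rw [← pow_mul, mul_comm, pow_mul]; norm_num
      have b2 : ‖PP n (1-t) (1+t)‖^3 ≤ 512^n := by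
        calc _ ≤ ((8:ℝ)^n)^3 := by gcongr
          _ = _ := by rw [← pow_mul, mul_comm, pow_mul]; norm_num
      have b3 := norm_pm t
      rw [ht8, show (1:ℝ)+8 = 3^2 by norm_num, Real.sqrt_sq (by norm_num)] at b3
      calc _ ≤ ‖1+t‖ * 512^n + ‖1-t‖*512^n := by gcongr
        _ = (‖1+t‖ + ‖1-t‖) * 512^n := by ring
        _ ≤ _ := by gcongr; linarith
    rw [norm_mul, norm_pow, norm_mul, ht, pow_succ, pow_mul, mul_pow, hs8] at h1
    norm_num at h1
    have e : (512:ℝ)^n = 32^n * 16^n := by rw [← mul_pow]; norm_num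
    rw [e] at h1
    have p1 : (0:ℝ) < 32^n := by positivity
    have h2 : (2 * Real.sqrt 8) * ‖f t‖ ≤ 6 * 16^n := by
      have : (32:ℝ)^n * ((2 * Real.sqrt 8) * ‖f t‖) ≤ 32^n * (6*16^n) := by
        calc _ = 32 ^ n * (2 * √8) * ‖f t‖ := by ring
          _ ≤ _ := h1
          _ = _ := by ring
      exact le_of_mul_le_mul_left this p1
    have p2 : (0:ℝ) < 16^n := by positivity
    nlinarith [norm_nonneg (f t)]
  have hball : ∀ t : ℂ, ‖t‖ ≤ Real.sqrt 8 → ‖f t‖ ≤ (107/100) * 16 ^ n := by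
    intro t ht
    apply Complex.norm_le_of_forall_mem_frontier_norm_le (U := Metric.ball (0:ℂ) (Real.sqrt 8)) Metric.isBounded_ball hfd.diffContOnCl
    · intro z hz
      rw [frontier_ball _ (by positivity)] at hz
      exact hbd z (by simpa using hz)
    · rw [closure_ball _ (by positivity)]; simpa using ht
  have hyc : (y:ℂ) ≠ 0 := by exact_mod_cast hy.ne'
  have hne : (y:ℂ) - κ ≠ 0 := by
    intro h
    have : κ = y := by linear_combination -h
    rw [this] at hk; simp [abs_of_pos hy] at hk
  have h := hc (y+κ) (y-κ) hne
  have e1 : (y:ℂ) + κ = y * (1 + κ/y) := by field_simp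
  have e2 : (y:ℂ) - κ = y * (1 - κ/y) := by field_simp
  have hsum : ∑ j ∈ Finset.range (n+1), c j * ((y:ℂ)+κ) ^ j * ((y:ℂ)-κ) ^ (n - j) = y^n * f (κ/y) := by
    rw [hf, Finset.mul_sum]
    apply Finset.sum_congr rfl
    intro s hs
    have hs' : s ≤ n := by simpa [Nat.lt_succ_iff] using hs
    obtain ⟨m, rfl⟩ : ∃ m, n = s + m := ⟨n - s, by omega⟩
    rw [e1, e2, mul_pow, mul_pow, pow_add]; simp; ring
  rw [h, hsum, show (y:ℂ)+κ-(y-κ) = 2*κ by ring, norm_mul, norm_mul, norm_pow, norm_pow, norm_mul, Complex.norm_real, Real.norm_eq_abs, abs_of_pos hy]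
  have hf' := hball (κ/y) (by
    rw [norm_div, Complex.norm_real, Real.norm_eq_abs, abs_of_pos hy]
    have : ‖κ‖/y ≤ 1 := by rw [div_le_one hy]; exact hk.le
    linarith)
  norm_num
  calc (2 * ‖κ‖) ^ (2 * n + 1) * (y ^ n * ‖f (κ / ↑y)‖) ≤ (2 * ‖κ‖) ^ (2 * n + 1) * (y ^ n * ((107/100) * 16 ^ n)) := by gcongr
    _ = _ := by rw [pow_succ, pow_mul, show (64 * ‖κ‖^2 * y) = (2*‖κ‖)^2 * y * 16 by ring, mul_pow _ (16:ℝ), mul_pow _ y]; generalize ((2*‖κ‖)^2)^n = z; ring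

end
section

lemma v3_fact (m : ℕ) : padicValNat 3 (m.factorial) ≤ m / 2 := by
  have : Fact (Nat.Prime 3) := ⟨by norm_num⟩
  have := sub_one_mul_padicValNat_factorial (p := 3) m
  omega

lemma fact_dvd_prod (a : ℤ) (m : ℕ) : ((m.factorial : ℕ) : ℤ) ∣ 3 ^ (m/2) * ∏ i ∈ Finset.range m, (a - 3 * i) := by
  have : Fact (Nat.Prime 3) := ⟨by norm_num⟩
  obtain ⟨v, M, hM, he⟩ := Nat.exists_eq_pow_mul_and_not_dvd (Nat.factorial_ne_zero m) 3 (by norm_num)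
  have hv : v ≤ m / 2 := by
    have h1 := v3_fact m
    have : 3 ^ v ∣ m.factorial := ⟨M, he⟩
    exact ((padicValNat_dvd_iff_le (Nat.factorial_ne_zero m)).mp this).trans h1
  have hc : IsCoprime (3:ℤ) (M:ℤ) := by
    rw [show (3:ℤ) = ((3:ℕ):ℤ) by rfl, Nat.isCoprime_iff_coprime]
    exact (Nat.Prime.coprime_iff_not_dvd (by norm_num)).mpr hM
  have hMd : (M:ℤ) ∣ ∏ i ∈ Finset.range m, (a - 3 * i) := by
    obtain ⟨t, u, htu⟩ := hc
    have hct : IsCoprime (M:ℤ) t := ⟨u, 3, by linarith⟩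
    have h1 : (M:ℤ) ∣ ∏ i ∈ Finset.range m, (t * a - i) := by
      have h2 : (m.factorial : ℤ) ∣ ∏ i ∈ Finset.range m, (t * a - m + 1 + i) := by
        have := Nat.factorial_coe_dvd_prod m (t * a - m + 1)
        simpa using this
      rw [← Finset.prod_range_reflect] at h2
      have h3 : ∏ j ∈ Finset.range m, (t * a - m + 1 + ((m - 1 - j : ℕ):ℤ)) = ∏ i ∈ Finset.range m, (t * a - i) := by
        apply Finset.prod_congr rfl
        intro j hj
        have : j < m := by simpa using hj
        have : ((m - 1 - j : ℕ):ℤ) = m - 1 - j := by omega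
        rw [this]; ring
      rw [h3] at h2
      exact Dvd.dvd.trans ⟨3^v, by rw [he]; push_cast; ring⟩ h2
    have h4 : (M:ℤ) ∣ t ^ m * ∏ i ∈ Finset.range m, (a - 3 * i) := by
      have e : t ^ m * ∏ i ∈ Finset.range m, (a - 3 * (i:ℤ)) = ∏ i ∈ Finset.range m, (t * (a - 3 * i)) := by
        rw [Finset.prod_mul_distrib]; simp
      rw [e]
      have hmod : (∏ i ∈ Finset.range m, (t * (a - 3 * (i:ℤ)))) ≡ ∏ i ∈ Finset.range m, (t * a - i) [ZMOD M] := by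
        apply Int.ModEq.prod
        intro i _
        apply Int.ModEq.symm
        rw [Int.modEq_iff_dvd]
        exact ⟨u * i, by linear_combination (-(i:ℤ)) * htu⟩
      exact (Int.ModEq.dvd_iff hmod).mpr h1
    exact (hct.pow_right).dvd_of_dvd_mul_left h4
  rw [he]
  push_cast
  exact mul_dvd_mul (pow_dvd_pow _ hv) hMd

lemma prod_shift (c : ℚ) (s m : ℕ) : (∏ i ∈ Finset.range m, (3*((s:ℚ)+m) - 3 + 3 * c - 3*i)) * (∏ i ∈ Finset.range s, ((i:ℚ)+c)) = 3^m * ∏ i ∈ Finset.range (s+m), ((i:ℚ)+c) := by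
  rw [Finset.prod_range_add, ← Finset.prod_range_reflect (fun j => ((s + j : ℕ):ℚ) + c)]
  have : (3:ℚ)^m = ∏ i ∈ Finset.range m, 3 := by simp
  rw [this, mul_left_comm, ← Finset.prod_mul_distrib, mul_comm]
  congr 1
  apply Finset.prod_congr rfl
  intro j hj
  have : j < m := by simpa using hj
  obtain ⟨l, rfl⟩ : ∃ l, m = l + 1 + j := ⟨m - 1 - j, by omega⟩
  rw [show l + 1 + j - 1 - j = l by omega]
  push_cast; ring

lemma pe_mul (s : ℕ) : pe s * (s.factorial * ∏ i ∈ Finset.range s, ((i:ℚ)+4/3)) = 1 := by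
  induction s with
  | zero => simp [pe]
  | succ s ih =>
    rw [pe_succ] at ih
    rw [Finset.prod_range_succ, Nat.factorial_succ]
    push_cast
    linear_combination ih
lemma pg_mul (s : ℕ) : pg s * (s.factorial * ∏ i ∈ Finset.range s, ((i:ℚ)+2/3)) = 1 := by
  induction s with
  | zero => simp [pg]
  | succ s ih =>
    rw [pg_succ] at ih
    rw [Finset.prod_range_succ, Nat.factorial_succ]
    push_cast
    linear_combination ih
lemma pK_eq (n : ℕ) : pK n = (∏ i ∈ Finset.range n, ((i:ℚ)+4/3)) * ∏ i ∈ Finset.range n, ((i:ℚ)+2/3) := by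
  induction n with
  | zero => simp [pK]
  | succ s ih =>
    rw [Finset.prod_range_succ, Finset.prod_range_succ, pK, ih]; ring

def e3 (n : ℕ) : ℕ := n + n / 2

lemma coef_int (s m : ℕ) : ∃ z : ℤ, (3:ℚ)^(e3 (s+m)) * (pK (s+m) * (pe s * pg m)) = z := by
  obtain ⟨z1, h1⟩ := fact_dvd_prod (3*((s:ℤ)+m)+1) m
  obtain ⟨z2, h2⟩ := fact_dvd_prod (3*((s:ℤ)+m)-1) s
  have a1 := prod_shift (4/3) s m
  have a2 := prod_shift (2/3) m s
  have q1 : (3:ℚ)^(m/2) * ∏ i ∈ Finset.range m, (3*((s:ℚ)+m)+1 - 3*i) = m.factorial * z1 := by exact_mod_cast h1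
  have q2 : (3:ℚ)^(s/2) * ∏ i ∈ Finset.range s, (3*((s:ℚ)+m)-1 - 3*i) = s.factorial * z2 := by exact_mod_cast h2
  have b1 := pe_mul s
  have b2 := pg_mul m
  rw [show m + s = s + m by omega] at a2
  have c1 : ∏ i ∈ Finset.range m, (3*((s:ℚ)+m) - 3 + 3 * (4/3) - 3*i) = ∏ i ∈ Finset.range m, (3*((s:ℚ)+m)+1 - 3*i) := by
    apply Finset.prod_congr rfl; intros; ring
  have c2 : ∏ i ∈ Finset.range s, (3*((m:ℚ)+s) - 3 + 3 * (2/3) - 3*i) = ∏ i ∈ Finset.range s, (3*((s:ℚ)+m)-1 - 3*i) := by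
    apply Finset.prod_congr rfl; intros; ring
  rw [c1] at a1
  rw [c2] at a2
  rw [pK_eq]
  have hle : m/2 + s/2 ≤ (s+m)/2 := by omega
  obtain ⟨j, hj⟩ := Nat.exists_eq_add_of_le hle
  refine ⟨3^j * z1 * z2, ?_⟩
  rw [e3, hj, pow_add, pow_add, pow_add, pow_add]
  push_cast
  generalize ∏ i ∈ Finset.range m, (3*((s:ℚ)+m)+1 - 3*i) = A at *
  generalize ∏ i ∈ Finset.range s, (3*((s:ℚ)+m)-1 - 3*i) = B at *
  generalize ∏ i ∈ Finset.range (s+m), ((i:ℚ)+4/3) = A1 at *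
  generalize ∏ i ∈ Finset.range (s+m), ((i:ℚ)+2/3) = B1 at *
  generalize ∏ i ∈ Finset.range s, ((i:ℚ)+4/3) = A2 at *
  generalize ∏ i ∈ Finset.range m, ((i:ℚ)+2/3) = B2 at *
  calc (3:ℚ)^s * 3^m * (3^(m/2) * 3^(s/2) * 3^j) * (A1*B1*(pe s * pg m))
      = 3^(m/2) * 3^(s/2) * 3^j * ((3^m*A1) * (3^s*B1)) * (pe s * pg m) := by ring
    _ = 3^j * (3^(m/2) * A) * (3^(s/2) * B) * (A2 * B2 * pe s * pg m) := by rw [← a1, ← a2]; ring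
    _ = 3^j * z1 * z2 * ((pe s * (s.factorial * A2)) * (pg m * (m.factorial * B2))) := by rw [q1, q2]; ring
    _ = _ := by rw [b1, b2]; ring

/-- real and imaginary components by recurrence -/
noncomputable def rr (y k : ℝ) : ℕ → ℝ
  | 0 => 1
  | 1 => 2 * y
  | n+2 => ((2*n+3) * (2*y) * rr y k (n+1) - ((n+1) - 1/(9*((n:ℝ)+1))) * (4*k) * rr y k n) / (n+2)
noncomputable def ss (y k : ℝ) : ℕ → ℝ
  | 0 => 0
  | 1 => -2/3
  | n+2 => ((2*n+3) * (2*y) * ss y k (n+1) - ((n+1) - 1/(9*((n:ℝ)+1))) * (4*k) * ss y k n) / (n+2)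

lemma rr_rec (y k : ℝ) (n : ℕ) : ((n:ℝ)+2) * rr y k (n+2) = (2*n+3) * (2*y) * rr y k (n+1) - ((n+1) - 1/(9*((n:ℝ)+1))) * (4*k) * rr y k n := by
  rw [rr]; field_simp
lemma ss_rec (y k : ℝ) (n : ℕ) : ((n:ℝ)+2) * ss y k (n+2) = (2*n+3) * (2*y) * ss y k (n+1) - ((n+1) - 1/(9*((n:ℝ)+1))) * (4*k) * ss y k n := by
  rw [ss]; field_simp

lemma PP_rs (y k : ℝ) (κ : ℂ) (hκ : κ^2 = k) (n : ℕ) :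
    PP n (y+κ) (y-κ) = rr y k n + ss y k n * κ ∧ PP (n+1) (y+κ) (y-κ) = rr y k (n+1) + ss y k (n+1) * κ := by
  induction n with
  | zero => simp [PP_zero, PP_one, rr, ss]; ring
  | succ n ih =>
    refine ⟨ih.2, ?_⟩
    have h := PP_rec n (y+κ) (y-κ)
    rw [ih.1, ih.2, show (y:ℂ)+κ+(y-κ) = 2*y by ring, show ((y:ℂ)+κ-(y-κ))^2 = 4 * κ^2 by ring, hκ] at h
    have h1 := congrArg (fun x : ℝ => (x:ℂ)) (rr_rec y k n)
    have h2 := congrArg (fun x : ℝ => (x:ℂ)) (ss_rec y k n)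
    push_cast at h1 h2
    have hn : (n:ℂ)+2 ≠ 0 := by exact_mod_cast Nat.succ_ne_zero (n+1)
    apply mul_left_cancel₀ hn
    linear_combination h - h1 - κ * h2

lemma pow_int_comb (y k : ℤ) (s m : ℕ) : ∃ A B : ℤ, ∀ κ : ℂ, κ^2 = k → ((y:ℂ)+κ)^s * (y-κ)^m = A + B * κ := by
  induction s with
  | zero =>
    induction m with
    | zero => exact ⟨1, 0, by simp⟩
    | succ m ih =>
      obtain ⟨A, B, h⟩ := ih
      refine ⟨A*y - B*k, B*y - A, fun κ hκ => ?_⟩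
      have := h κ hκ
      rw [pow_succ, ← mul_assoc, this]; push_cast; linear_combination (-(B:ℂ)) * hκ
  | succ s ih =>
    obtain ⟨A, B, h⟩ := ih
    refine ⟨A*y + B*k, B*y + A, fun κ hκ => ?_⟩
    have := h κ hκ
    rw [pow_succ, mul_right_comm, this]; push_cast; linear_combination ((B:ℂ)) * hκ

lemma PP_int (y k : ℤ) (n : ℕ) : ∃ A B : ℤ, ∀ κ : ℂ, κ^2 = k → 3^(e3 n) * PP n (y+κ) (y-κ) = A + B * κ := by
  have : ∀ p ∈ Finset.HasAntidiagonal.antidiagonal n, ∃ A B : ℤ, ∀ κ : ℂ, κ^2 = k →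
      (3:ℂ)^(e3 n) * pK n * (((1 * pe p.1 * pg p.2 : ℚ) : ℂ) * (y+κ) ^ p.1 * (y-κ) ^ p.2) = A + B * κ := by
    intro p hp
    have hp' : p.1 + p.2 = n := by simpa using hp
    obtain ⟨A, B, h⟩ := pow_int_comb y k p.1 p.2
    obtain ⟨z, hz⟩ := coef_int p.1 p.2
    rw [hp'] at hz
    refine ⟨z*A, z*B, fun κ hκ => ?_⟩
    have hz' := congrArg (fun x : ℚ => (x:ℂ)) hz
    push_cast at hz'
    have := h κ hκ
    push_cast
    linear_combination (((y:ℂ)+κ)^p.1 * (y-κ)^p.2) * hz' + (z:ℂ) * this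
  choose! A B h using this
  refine ⟨∑ p ∈ Finset.HasAntidiagonal.antidiagonal n, A p, ∑ p ∈ Finset.HasAntidiagonal.antidiagonal n, B p, fun κ hκ => ?_⟩
  unfold PP wS
  rw [← mul_assoc, Finset.mul_sum]
  push_cast
  rw [Finset.sum_mul, ← Finset.sum_add_distrib]
  apply Finset.sum_congr rfl
  intro p hp
  rw [← h p hp κ hκ]; push_cast; ring

theorem rs_int (y k : ℤ) (hk : k ≠ 0) (n : ℕ) : ∃ A B : ℤ, 3^(e3 n) * rr y k n = A ∧ 3^(e3 n) * ss y k n = B := by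
  obtain ⟨A, B, h⟩ := PP_int y k n
  refine ⟨A, B, ?_⟩
  obtain ⟨κ, hκ⟩ : ∃ κ : ℂ, κ^2 = k := IsAlgClosed.exists_pow_nat_eq (k:ℂ) (by norm_num)
  have hκ0 : κ ≠ 0 := by
    rintro rfl
    apply hk
    have : (k:ℂ) = 0 := by rw [← hκ]; simp
    exact_mod_cast this
  have h1 := h κ hκ
  have h2 := h (-κ) (by simpa using hκ)
  have g1 := (PP_rs y k κ (by simpa using hκ) n).1
  have g2 := (PP_rs y k (-κ) (by simpa using hκ) n).1
  simp only [Complex.ofReal_intCast] at g1 g2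
  rw [g1] at h1
  rw [g2] at h2
  constructor
  · have : (3:ℂ)^(e3 n) * rr y k n = A := by linear_combination (h1+h2)/2
    exact_mod_cast this
  · have : (3:ℂ)^(e3 n) * ss y k n = B := by
      apply mul_right_cancel₀ hκ0
      linear_combination (h1-h2)/2
    exact_mod_cast this

end
section

lemma seq_ratio (y k : ℝ) (hy : 0 < y) (hk : |k| ≤ y^2/100000) (z : ℕ → ℝ)
    (hz : ∀ n : ℕ, ((n:ℝ)+2) * z (n+2) = (2*n+3) * (2*y) * z (n+1) - ((n+1) - 1/(9*((n:ℝ)+1))) * (4*k) * z n)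
    (h0 : 0 ≤ z 0) (h1 : 0 < z 1) (h01 : (6/10) * y * z 0 ≤ z 1) (n : ℕ) :
    0 ≤ z n ∧ 0 < z (n+1) ∧ (6/10) * y * z n ≤ z (n+1) ∧
     |((n:ℝ)+2) * z (n+2) - (2*n+3) * (2*y) * z (n+1)| ≤ ((n:ℝ)+2) * (1/10000) * y * z (n+1) := by
  have key : ∀ n, 0 ≤ z n → 0 < z (n+1) → (6/10) * y * z n ≤ z (n+1) → 
     |((n:ℝ)+2) * z (n+2) - (2*n+3) * (2*y) * z (n+1)| ≤ ((n:ℝ)+2) * (1/10000) * y * z (n+1) := by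
    intro n a b c
    rw [hz n]
    have a1 : 1/(9*((n:ℝ)+1)) ≤ 1 := by rw [div_le_one (by positivity)]; linarith [(Nat.cast_nonneg n : (0:ℝ) ≤ n)]
    have a2 : 0 ≤ 1/(9*((n:ℝ)+1)) := by positivity
    have hn : (0:ℝ) ≤ n := Nat.cast_nonneg n
    rw [show (2*(n:ℝ)+3) * (2*y) * z (n+1) - ((n+1) - 1/(9*((n:ℝ)+1))) * (4*k) * z n - (2*n+3) * (2*y) * z (n+1) = -(((n+1) - 1/(9*((n:ℝ)+1))) * (4*k) * z n) by ring, abs_neg, abs_mul, abs_mul, abs_mul, abs_of_nonneg a, abs_of_nonneg (by linarith : 0 ≤ (n:ℝ)+1 - 1/(9*((n:ℝ)+1))), abs_of_pos (by norm_num : (0:ℝ) < 4)]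
    have q : |k| * z n ≤ y/60000 * z (n+1) := by
      calc |k| * z n ≤ y^2/100000 * z n := by gcongr
        _ = y/60000 * ((6/10) * y * z n) := by ring
        _ ≤ _ := by gcongr
    have q2 : ((n:ℝ)+1 - 1/(9*((n:ℝ)+1))) ≤ n + 2 := by linarith
    calc ((n:ℝ)+1 - 1/(9*((n:ℝ)+1))) * (4*|k|) * z n = ((n:ℝ)+1 - 1/(9*((n:ℝ)+1))) * (4*(|k| * z n)) := by ring
      _ ≤ ((n:ℝ)+2) * (4 * (y/60000 * z (n+1))) := by
        have : 0 ≤ |k| * z n := by positivity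
        gcongr
      _ ≤ _ := by
        have : 0 ≤ ((n:ℝ)+2) * y * z (n+1) := by positivity
        linarith
  have main : 0 ≤ z n ∧ 0 < z (n+1) ∧ (6/10) * y * z n ≤ z (n+1) := by
    induction n with
    | zero => exact ⟨h0, h1, h01⟩
    | succ n ih =>
      obtain ⟨a, b, c⟩ := ih
      have := key n a b c
      rw [abs_le] at this
      have hn : (0:ℝ) ≤ n := Nat.cast_nonneg n
      have h3 : ((n:ℝ)+2) * ((6/10) * y * z (n+1)) ≤ ((n:ℝ)+2) * z (n+2) := by
        have : 0 ≤ y * z (n+1) := by positivity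
        have : 0 ≤ (n:ℝ) * (y * z (n+1)) := by positivity
        linarith
      have h4 : (6/10) * y * z (n+1) ≤ z (n+2) := le_of_mul_le_mul_left h3 (by positivity)
      exact ⟨b.le, lt_of_lt_of_le (by positivity) h4, h4⟩
  exact ⟨main.1, main.2.1, main.2.2, key n main.1 main.2.1 main.2.2⟩

lemma rr_bounds (y k : ℝ) (hy : 0 < y) (hk : |k| ≤ y^2/100000) (n : ℕ) :
    0 < rr y k n ∧ |((n:ℝ)+2) * rr y k (n+2) - (2*n+3) * (2*y) * rr y k (n+1)| ≤ ((n:ℝ)+2) * (1/10000) * y * rr y k (n+1) := by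
  have h := seq_ratio y k hy hk (rr y k) (rr_rec y k) (by simp [rr]) (by simp [rr]; linarith) (by simp [rr]; linarith)
  refine ⟨?_, (h n).2.2.2⟩
  rcases n with _ | n
  · simp [rr]
  · exact (h n).2.1

lemma ss_bounds (y k : ℝ) (hy : 0 < y) (hk : |k| ≤ y^2/100000) (n : ℕ) :
    ss y k n ≤ 0 ∧ -ss y k n * (2*y) ≤ rr y k n := by
  constructor
  · have h := seq_ratio y k hy hk (fun n => - ss y k n) (fun n => by linear_combination -(ss_rec y k n)) (by simp [ss]) (by simp [ss]; norm_num) (by simp [ss]; norm_num)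
    have := (h n).1
    simpa using this
  · have h := seq_ratio y k hy hk (fun n => rr y k n + 2 * y * ss y k n) (fun n => by linear_combination (rr_rec y k n) + 2 * y * (ss_rec y k n)) (by simp [rr, ss]) (by simp [rr, ss]; linarith) (by simp [rr, ss]; linarith)
    have := (h n).1
    linarith

/-- ratio bounds -/
lemma rr_ratio (y k : ℝ) (hy : 0 < y) (hk : |k| ≤ y^2/100000) (n : ℕ) :
    ((2*(2*n+3)/((n:ℝ)+2)) - 1/10000) * y * rr y k (n+1) ≤ rr y k (n+2) ∧
    rr y k (n+2) ≤ ((2*(2*n+3)/((n:ℝ)+2)) + 1/10000) * y * rr y k (n+1) := by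
  have h := (rr_bounds y k hy hk n).2
  have hn : (0:ℝ) < n + 2 := by positivity
  rw [abs_le] at h
  constructor
  · apply le_of_mul_le_mul_left _ hn
    have : ((n:ℝ)+2) * (((2*(2*n+3)/((n:ℝ)+2)) - 1/10000) * y * rr y k (n+1)) = (2*n+3) * (2*y) * rr y k (n+1) - ((n:ℝ)+2) * (1/10000) * y * rr y k (n+1) := by
      field_simp
    linarith
  · apply le_of_mul_le_mul_left _ hn
    have : ((n:ℝ)+2) * (((2*(2*n+3)/((n:ℝ)+2)) + 1/10000) * y * rr y k (n+1)) = (2*n+3) * (2*y) * rr y k (n+1) + ((n:ℝ)+2) * (1/10000) * y * rr y k (n+1) := by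
      field_simp
    linarith

lemma casorati (y k : ℝ) (hk : k ≠ 0) (n : ℕ) : rr y k n * ss y k (n+1) - ss y k n * rr y k (n+1) ≠ 0 := by
  induction n with
  | zero => simp [rr, ss]
  | succ n ih =>
    intro h
    apply ih
    have h1 := rr_rec y k n
    have h2 := ss_rec y k n
    have h3 : ((n:ℝ)+1 - 1/(9*((n:ℝ)+1))) * (4*k) * (rr y k n * ss y k (n+1) - ss y k n * rr y k (n+1)) = 0 := by
      linear_combination ((n:ℝ)+2) * h - rr y k (n+1) * h2 + ss y k (n+1) * h1
    have h4 : ((n:ℝ)+1 - 1/(9*((n:ℝ)+1))) ≠ 0 := by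
      have a1 : 1/(9*((n:ℝ)+1)) ≤ 1/9 := by
        apply one_div_le_one_div_of_le (by norm_num); linarith [(Nat.cast_nonneg n : (0:ℝ) ≤ n)]
      have := (Nat.cast_nonneg n : (0:ℝ) ≤ n)
      linarith
    rcases mul_eq_zero.mp h3 with h5 | h5
    · rcases mul_eq_zero.mp h5 with h6 | h6
      · exact absurd h6 h4
      · exact absurd h6 (by simpa using hk)
    · exact h5

/-- E and R -/
noncomputable def EE (y k : ℝ) (r s : ℝ) : ℝ := r^3 + 3*k*r*s^2 + y*(3*r^2*s + k*s^3)
noncomputable def RR (y k : ℝ) (r s : ℝ) : ℝ := y*(r^3 + 3*k*r*s^2) + k*(3*r^2*s + k*s^3)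

lemma EE_bound (y k : ℝ) (hy : 0 < y) (hk0 : k ≠ 0) (hk : |k| < y^2) (n : ℕ) :
    |EE y k (rr y k n) (ss y k n)| ≤ (107/100) * (64 * |k| * y)^n := by
  obtain ⟨κ, hκ⟩ : ∃ κ : ℂ, κ^2 = k := IsAlgClosed.exists_pow_nat_eq (k:ℂ) (by norm_num)
  have hn2 : ‖κ‖^2 = |k| := by rw [← norm_pow, hκ, Complex.norm_real, Real.norm_eq_abs]
  have hκ0 : 0 < ‖κ‖ := by
    rw [norm_pos_iff]; rintro rfl
    apply hk0
    have : (k:ℂ) = 0 := by rw [← hκ]; simp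
    exact_mod_cast this
  have h := E_bound n κ y hy (by nlinarith [norm_nonneg κ])
  have g1 := (PP_rs y k κ hκ n).1
  have g2 := (PP_rs y k (-κ) (by simpa using hκ) n).1
  rw [← sub_eq_add_neg, sub_neg_eq_add] at g2
  have e : (y+κ) * PP n (y+κ) (y-κ) ^ 3 - (y-κ) * PP n (y-κ) (y+κ) ^ 3 = 2 * κ * (EE y k (rr y k n) (ss y k n) : ℝ) := by
    rw [g1, g2, EE]
    push_cast
    generalize ((rr y k n : ℝ):ℂ) = r
    generalize ((ss y k n : ℝ):ℂ) = s
    linear_combination (6*r*s^2*κ + 2*s^3*κ*y) * hκ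
  rw [e, norm_mul, norm_mul, Complex.norm_real, Real.norm_eq_abs, hn2] at h
  norm_num at h
  have : (2 * ‖κ‖) * |EE y k (rr y k n) (ss y k n)| ≤ (2 * ‖κ‖) * (107/100 * (64 * |k| * y)^n) := h
  exact le_of_mul_le_mul_left this (by positivity)

end
section

/-- two points on the same line -/
structure MRel (k x y x' y' u v : ℤ) : Prop where
  n1 : u^2 - k*v^2 = x*x'
  c1 : u^3 + 3*k*u*v^2 = y*y' - k
  c2 : 3*u^2*v + k*v^3 = y' - y

/-- hypotheses for large anchors -/
structure Anch (k x y x' y' u v : ℤ) : Prop where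
  rel : MRel k x y x' y' u v
  hk : k ≠ 0
  hy : 0 < y
  h1 : y^2 = x^3 + k
  h2 : y'^2 = x'^3 + k
  small : 100 * |k| * v^2 ≤ u^2
  gap : 8 * x^2 ≤ x'
  b1 : 100000 * |k|^2 ≤ x
  b2 : 6000000000 * |k|^8 ≤ x^3

lemma key_ident (k y y' u v r s : ℝ) (c1 : u^3 + 3*k*u*v^2 = y*y' - k) (c2 : 3*u^2*v + k*v^3 = y' - y) :
    3*(u*r+k*v*s)^2*(u*s+v*r) + k*(u*s+v*r)^3 = EE y k r s * y' - RR y k r s := by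
  unfold EE RR
  linear_combination (3*r^2*s + k*s^3) * c1 + (r^3+3*k*r*s^2) * c2

set_option maxHeartbeats 1000000 in
lemma key_ineq (k x y x' y' u v r s δ E : ℝ) (n1 : u^2 - k*v^2 = x*x') (c1 : u^3 + 3*k*u*v^2 = y*y' - k) (c2 : 3*u^2*v + k*v^3 = y' - y)
    (hy : 0 < y) (hk : |k| ≤ y^2/100000) (hr : 0 < r) (hs : s ≤ 0) (hrs : -s*(2*y) ≤ r) (small : 100 * |k| * v^2 ≤ u^2)
    (hx : 0 < x) (hx' : 0 < x') (hδ : 0 < δ) (hw : δ ≤ |u*s+v*r|) (hE : |EE y k r s| ≤ E) (hy' : y'^2 ≤ (1001/1000)*x'^3) :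
    x*x'*δ ≤ (7/10)*y*r ∨ (21/10)*δ^2*x^2*r^4 ≤ x' * E^2 := by
  have id := key_ident k y y' u v r s c1 c2
  set w := u*s+v*r with hw'
  set U := u*r+k*v*s with hU
  have hN : U^2 - k*w^2 = x*x'*(r^2-k*s^2) := by rw [← n1, hU, hw']; ring
  have hkabs := abs_le.mp (le_refl |k|)
  have hs2 : |k| *s^2 ≤ r^2/400000 := by
    have : (s*(2*y))^2 ≤ r^2 := by
      have e : (s*(2*y))^2 = (-s*(2*y))^2 := by ring
      rw [e]; exact pow_le_pow_left₀ (mul_nonneg (neg_nonneg.mpr hs) (by positivity)) hrs 2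
    have : s^2 * |k| ≤ s^2*(y^2/100000) := by gcongr
    linarith
  have hu2 : u^2 ≤ (10102/10000) * (x*x') := by
    have : k*v^2 ≤ |k| *v^2 := by gcongr; exact le_abs_self k
    linarith [mul_pos hx hx']
  have hkw : |k| *w^2 ≤ (202/10000)*(u^2*r^2) := by
    have a1 : w^2 ≤ 2*(u^2*s^2+v^2*r^2) := by rw [hw']; linarith [sq_nonneg (u*s-v*r)]
    have a2 : |k| *w^2 ≤ |k| *(2*(u^2*s^2+v^2*r^2)) := by gcongr
    have a3 : u^2*(|k| *s^2) ≤ u^2*(r^2/400000) := by gcongr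
    have a4 : r^2*(100 * |k| * v^2) ≤ r^2*u^2 := by gcongr
    have a5 : 0 ≤ u^2*r^2 := by positivity
    linarith
  have hxx : 0 < x*x' := by positivity
  have h3 : (29/10)*(x*x'*r^2) ≤ 3*U^2+k*w^2 := by
    have a1 : 3*U^2+k*w^2 = 3*(x*x'*(r^2-k*s^2)) + 4*(k*w^2) := by rw [← hN]; ring
    have a2 : -(|k| *w^2) ≤ k*w^2 := by
      have := neg_abs_le k
      linarith [mul_nonneg (by linarith : 0 ≤ k + |k|) (sq_nonneg w)]
    have a3 : k*s^2 ≤ r^2/400000 := le_trans (by gcongr; exact le_abs_self k) hs2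
    have a4 : x*x'*(k*s^2) ≤ x*x'*(r^2/400000) := by gcongr
    have a5 : r^2*u^2 ≤ r^2*((10102/10000) * (x*x')) := by gcongr
    have a6 : 0 < x*x'*r^2 := by positivity
    linarith
  have hR : |RR y k r s| ≤ (101/100)*y*r^3 := by
    unfold RR
    have b1 : |k * s^2| ≤ r^2/400000 := by rw [abs_mul, abs_of_nonneg (sq_nonneg s)]; exact hs2
    have b2 : |s| * (2*y) ≤ r := by rw [abs_of_nonpos hs]; exact hrs
    have b3 : |k*s| ≤ y*r/200000 := by
      rw [abs_mul]
      calc |k|  * |s| ≤ y^2/100000 * |s| := by gcongr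
        _ = y/200000 * (|s| *(2*y)) := by ring
        _ ≤ y/200000 * r := by gcongr
        _ = _ := by ring
    have e : y*(r^3 + 3*k*r*s^2) + k*(3*r^2*s + k*s^3) = y*r^3 + 3*y*r*(k*s^2) + (3*r^2)*(k*s) + (k*s^2)*(k*s) := by ring
    rw [e]
    have t1 : |3*y*r*(k*s^2)| ≤ 3*y*r*(r^2/400000) := by
      rw [abs_mul, abs_of_pos (by positivity : 0 < 3*y*r)]; gcongr
    have t2 : |(3*r^2)*(k*s)| ≤ 3*r^2*(y*r/200000) := by
      rw [abs_mul, abs_of_pos (by positivity : 0 < 3*r^2)]; gcongr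
    have t3 : |(k*s^2)*(k*s)| ≤ r^2/400000*(y*r/200000) := by
      rw [abs_mul]; gcongr
    have t0 : |y*r^3| = y*r^3 := abs_of_pos (by positivity)
    have p : 0 < y*r^3 := by positivity
    calc _ ≤ |y*r^3| + |3*y*r*(k*s^2)| + |(3*r^2)*(k*s)| + |(k*s^2)*(k*s)| := by
          refine (abs_add_le _ _).trans ?_
          gcongr
          refine (abs_add_le _ _).trans ?_
          gcongr
          exact abs_add_le _ _
      _ ≤ y*r^3 + 3*y*r*(r^2/400000) + 3*r^2*(y*r/200000) + r^2/400000*(y*r/200000) := by rw [t0]; gcongr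
      _ ≤ _ := by linarith
  have hmain : δ*((29/10)*(x*x'*r^2)) ≤ E * |y'| + (101/100)*y*r^3 := by
    calc δ*((29/10)*(x*x'*r^2)) ≤ |w| * (3*U^2+k*w^2) := by gcongr
      _ ≤ |w * (3*U^2+k*w^2)| := by rw [abs_mul]; gcongr; exact le_abs_self _
      _ = |EE y k r s * y' - RR y k r s| := by rw [← id]; congr 1; ring
      _ ≤ |EE y k r s * y'| + |RR y k r s| := abs_sub _ _
      _ ≤ _ := by rw [abs_mul]; gcongr
  by_cases hc : x*x'*δ ≤ (7/10)*y*r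
  · exact Or.inl hc
  right
  push Not at hc
  have h5 : (101/100)*y*r^3 ≤ (145/100)*δ*(x*x'*r^2) := by
    have : r^2*((7/10)*y*r) ≤ r^2*(x*x'*δ) := by gcongr
    have : 0 ≤ y*r^3 := by positivity
    linarith
  have h6 : (145/100)*δ*(x*x'*r^2) ≤ E * |y'| := by linarith
  have h7 : ((145/100)*δ*(x*x'*r^2))^2 ≤ (E * |y'|)^2 := by gcongr
  rw [mul_pow E, sq_abs] at h7
  have h8 : E^2*y'^2 ≤ E^2*((1001/1000)*x'^3) := by gcongr
  have h9 : x'^2*((1.001)*((21/10)*δ^2*x^2*r^4)) ≤ x'^2*((1.001)*(x'*E^2)) := by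
    have : 0 ≤ δ^2*x^2*r^4*x'^2 := by positivity
    linarith
  have := le_of_mul_le_mul_left h9 (by positivity)
  linarith


end
section

lemma e3_two (n : ℕ) : e3 (n+2) = e3 n + 3 := by unfold e3; omega
lemma e3_one (n : ℕ) : e3 (n+1) ≤ e3 n + 2 := by unfold e3; omega
lemma e3_mono (n : ℕ) : e3 n ≤ e3 (n+1) := by unfold e3; omega
lemma e3_ge (n : ℕ) : n ≤ e3 n := by unfold e3; omega

lemma rr_ratio3 (y k : ℝ) (hy : 0 < y) (hk : |k| ≤ y^2/100000) (n : ℕ) :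
    (349/100) * y * rr y k (n+3) ≤ rr y k (n+4) ∧ rr y k (n+4) ≤ (40001/10000) * y * rr y k (n+3) := by
  have h := rr_ratio y k hy hk (n+2)
  have hp := (rr_bounds y k hy hk (n+3)).1
  have hf1 : (35/10:ℝ) ≤ 2*(2*((n+2:ℕ):ℝ)+3)/(((n+2:ℕ):ℝ)+2) := by
    rw [le_div_iff₀ (by positivity)]; push_cast; linarith [(Nat.cast_nonneg n : (0:ℝ) ≤ n)]
  have hf2 : 2*(2*((n+2:ℕ):ℝ)+3)/(((n+2:ℕ):ℝ)+2) ≤ 4 := by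
    rw [div_le_iff₀ (by positivity)]; push_cast; linarith [(Nat.cast_nonneg n : (0:ℝ) ≤ n)]
  have hyr : 0 < y * rr y k (n+3) := by positivity
  generalize 2*(2*((n+2:ℕ):ℝ)+3)/(((n+2:ℕ):ℝ)+2) = q at *
  change (q - 1/10000) * y * rr y k (n+3) ≤ rr y k (n+4) ∧ rr y k (n+4) ≤ (q + 1/10000) * y * rr y k (n+3) at h
  constructor
  · nlinarith
  · nlinarith

lemma rr_34 (y k : ℝ) (hy : 0 < y) (hk : |k| ≤ y^2/100000) :
    (1999/100) * y^3 ≤ rr y k 3 ∧ rr y k 4 ≤ (701/10) * y^4 := by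
  have h0 := rr_ratio y k hy hk 0
  have h1 := rr_ratio y k hy hk 1
  have h2 := rr_ratio y k hy hk 2
  have e1 : rr y k 1 = 2*y := rfl
  norm_num at h0 h1 h2
  rw [e1] at h0
  have a : y*(y*(2*y)) = 2*y^3 := by ring
  constructor
  · have : (33332/10000)*y*((29999/10000) * y * (2*y)) ≤ (33332/10000)*y*rr y k 2 := by gcongr; linarith
    have : 0 < y * rr y k 2 := by have := (rr_bounds y k hy hk 2).1; positivity
    linarith
  · have t1 : rr y k 3 ≤ (33335/10000)*y*((30001/10000) * y * (2*y)) := by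
      have : (33335/10000)*y*rr y k 2 ≤ (33335/10000)*y*((30001/10000) * y * (2*y)) := by gcongr; linarith
      have : 0 < y * rr y k 2 := by have := (rr_bounds y k hy hk 2).1; positivity
      linarith
    have : (35001/10000)*y*rr y k 3 ≤ (35001/10000)*y*((33335/10000)*y*((30001/10000) * y * (2*y))) := by gcongr
    have : 0 < y^4 := by positivity
    linarith

lemma Gbase (y K : ℝ) (r : ℝ) (hK : 1 ≤ K) (hy : 0 < y) (hy6 : 8*10^14 * K^6 ≤ y^2) (hr : (1999/100) * y^3 ≤ r) :
    174 * 27^(e3 3) * y * (64*K*y)^(2*3) ≤ r^3 := by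
  have h1 : ((1999/100) * y^3)^3 ≤ r^3 := by gcongr
  have e : e3 3 = 4 := rfl
  rw [e]
  have : y^7 * (8*10^14 * K^6) ≤ y^7 * y^2 := by gcongr
  have : 0 < y^9 := by positivity
  have : 0 ≤ y^7*K^6 := by positivity
  have e1 : ((1999/100) * y^3)^3 = (1999/100)^3 * y^9 := by ring
  have e2 : 174 * 27^4 * y * (64*K*y)^(2*3) = (174 * 27^4*64^6) * (y^7*K^6) := by ring
  rw [e2]; rw [e1] at h1
  linarith

lemma Gn (y k : ℝ) (hk1 : 1 ≤ |k|) (hy : 0 < y) (hk : |k| ≤ y^2/100000) (hy6 : 8*10^14 * |k|^6 ≤ y^2) (hy2 : 71000*|k|^2 ≤ y) (n : ℕ) :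
    174 * 27^(e3 (n+3)) * y * (64 * |k| * y)^(2*(n+3)) ≤ rr y k (n+3) ^ 3 := by
  induction n with
  | zero => exact Gbase y |k| _ hk1 hy hy6 (rr_34 y k hy hk).1
  | succ n ih =>
    have h := (rr_ratio3 y k hy hk n).1
    have hp := (rr_bounds y k hy hk (n+3)).1
    have h1 : ((349/100) * y * rr y k (n+3))^3 ≤ rr y k (n+4)^3 := by gcongr
    have h2 : (27:ℝ)^(e3 (n+4)) ≤ 27^(e3 (n+3)) * 729 := by
      calc (27:ℝ)^(e3 (n+4)) ≤ 27^(e3 (n+3) + 2) := pow_le_pow_right₀ (by norm_num) (e3_one _)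
        _ = _ := by rw [pow_add]; norm_num
    change 174 * 27^(e3 (n+4)) * y * (64 * |k| * y)^(2*(n+4)) ≤ rr y k (n+4) ^ 3
    refine le_trans ?_ h1
    have e : (64 * |k| * y)^(2*(n+4)) = (64 * |k| * y)^(2*(n+3)) * (4096 * |k|^2 * y^2) := by
      rw [show 2*(n+4) = 2*(n+3)+2 by ring, pow_add]; ring
    rw [e]
    have c : 729 * (4096 * |k|^2 * y^2) ≤ (349/100)^3*y^3 := by
      have : y^2 * (71000 * |k|^2) ≤ y^2*y := by gcongr
      have : 0 < y^3 := by positivity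
      linarith
    calc 174 * 27^(e3 (n+4)) * y * ((64 * |k| * y)^(2*(n+3)) * (4096 * |k|^2 * y^2))
       ≤ 174 * (27^(e3 (n+3)) * 729) * y * ((64 * |k| * y)^(2*(n+3)) * (4096 * |k|^2 * y^2)) := by gcongr
      _ = (174 * 27^(e3 (n+3)) * y * (64 * |k| * y)^(2*(n+3))) * (729 * (4096 * |k|^2 * y^2)) := by ring
      _ ≤ rr y k (n+3)^3 * ((349/100)^3*y^3) := by gcongr
      _ = _ := by ring

lemma chain (y k x x' : ℝ) (w : ℕ → Prop) (hk1 : 1 ≤ |k|) (hy : 0 < y) (hk : |k| ≤ y^2/100000) (hy6 : 8*10^14 * |k|^6 ≤ y^2) (hy2 : 71000*|k|^2 ≤ y)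
   (hx : 0 < x) (hx' : 0 < x') (hxy : (999/1000)*y^2 ≤ x^3) (hw : ∀ n, w n ∨ w (n+1))
   (hwin : ∀ n, w n → x*x' ≤ (7/10) * (3^(e3 n) * y * rr y k n) ∨ (18/10)*x^2*(rr y k n)^4 ≤ x' * (9^(e3 n) * (64 * |k| * y)^(2*n)))
   (hbase : 36000 * y^5 < x*x') : False := by
  have hpos : ∀ n, 0 < rr y k n := fun n => (rr_bounds y k hy hk n).1
  have hy1 : 1 ≤ y := by nlinarith [sq_nonneg |k|]
  have claim : ∀ n, (7/10) * (3^(e3 (n+4)) * y * rr y k (n+4)) < x*x' := by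
    intro n
    induction n with
    | zero =>
      have h := (rr_34 y k hy hk).2
      have e : e3 4 = 6 := rfl
      rw [zero_add, e]
      have : y * rr y k 4 ≤ y * ((701/10)*y^4) := by gcongr
      have : 0 < y^5 := by positivity
      linarith
    | succ n ih =>
      have h34 := rr_ratio3 y k hy hk n
      have h45 := rr_ratio3 y k hy hk (n+1)
      have p3 := hpos (n+3)
      have p4 := hpos (n+4)
      change (349/100) * y * rr y k (n+4) ≤ rr y k (n+5) ∧ rr y k (n+5) ≤ (40001/10000) * y * rr y k (n+4) at h45
      have hU : (18/10)*x^2*(rr y k (n+3))^4 ≤ x' * (9^(e3 (n+3)) * (64 * |k| * y)^(2*(n+3))) := by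
        rcases hw (n+3) with h | h
        · rcases hwin _ h with h' | h'
          · exfalso
            have : (3:ℝ)^(e3 (n+3)) * y * rr y k (n+3) ≤ 3^(e3 (n+4)) * y * rr y k (n+4) := by
              have a1 : (3:ℝ)^(e3 (n+3)) ≤ 3^(e3 (n+4)) := pow_le_pow_right₀ (by norm_num) (e3_mono _)
              have a2 : rr y k (n+3) ≤ rr y k (n+4) := by nlinarith
              gcongr
            linarith
          · exact h'
        · rcases hwin _ h with h' | h'
          · exact absurd h' (not_le.mpr ih)
          · change (18/10)*x^2*(rr y k (n+4))^4 ≤ x' * (9^(e3 (n+4)) * (64 * |k| * y)^(2*(n+4))) at h'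
            have h2 : (9:ℝ)^(e3 (n+4)) ≤ 9^(e3 (n+3)) * 81 := by
              calc (9:ℝ)^(e3 (n+4)) ≤ 9^(e3 (n+3) + 2) := pow_le_pow_right₀ (by norm_num) (e3_one _)
                _ = _ := by rw [pow_add]; norm_num
            have e : (64 * |k| * y)^(2*(n+4)) = (64 * |k| * y)^(2*(n+3)) * (4096 * |k|^2 * y^2) := by
              rw [show 2*(n+4) = 2*(n+3)+2 by ring, pow_add]; ring
            rw [e] at h'
            have c : 81 * (4096 * |k|^2 * y^2) ≤ (349/100)^4*y^4 := by
              have : y^2 * (8*10^14 * |k|^6) ≤ y^2*y^2 := by gcongr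
              have q : |k|^2 ≤ |k|^6 := pow_le_pow_right₀ hk1 (by norm_num)
              have : y^2 * |k|^2 ≤ y^2*|k|^6 := by gcongr
              have : 0 < y^4 := by positivity
              linarith
            have h1 : ((349/100) * y * rr y k (n+3))^4 ≤ rr y k (n+4)^4 := by gcongr; exact h34.1
            have c0 : (0:ℝ) < (349/100)^4*y^4 := by positivity
            apply le_of_mul_le_mul_left _ c0
            calc (349/100)^4*y^4 * ((18/10)*x^2*(rr y k (n+3))^4) = (18/10)*x^2*((349/100) * y * rr y k (n+3))^4 := by ring
              _ ≤ (18/10)*x^2*(rr y k (n+4))^4 := by gcongr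
              _ ≤ x' * (9^(e3 (n+4)) * ((64 * |k| * y)^(2*(n+3)) * (4096 * |k|^2 * y^2))) := h'
              _ ≤ x' * ((9^(e3 (n+3)) * 81) * ((64 * |k| * y)^(2*(n+3)) * (4096 * |k|^2 * y^2))) := by gcongr
              _ = (81 * (4096 * |k|^2 * y^2)) * (x' * (9^(e3 (n+3)) * (64 * |k| * y)^(2*(n+3)))) := by ring
              _ ≤ _ := by gcongr
      have G := Gn y k hk1 hy hk hy6 hy2 n
      have r5 : rr y k (n+5) ≤ (16001/1000)*y^2*rr y k (n+3) := by
        have : (40001/10000) * y * rr y k (n+4) ≤ (40001/10000) * y * ((40001/10000) * y * rr y k (n+3)) := by gcongr; exact h34.2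
        have : 0 < y^2 * rr y k (n+3) := by positivity
        linarith
      change (7/10) * (3^(e3 (n+3+2)) * y * rr y k (n+5)) < x*x'
      rw [e3_two, pow_add]
      have D0 : (0:ℝ) < 9^(e3 (n+3)) * (64 * |k| * y)^(2*(n+3)) := by positivity
      apply lt_of_mul_lt_mul_right _ D0.le
      set r := rr y k (n+3)
      have s1 : (18/10)*x^3*r^4 ≤ x*x' * (9^(e3 (n+3)) * (64 * |k| * y)^(2*(n+3))) := by
        have : x*((18/10)*x^2*r^4) ≤ x*(x' * (9^(e3 (n+3)) * (64 * |k| * y)^(2*(n+3)))) := by gcongr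
        linarith
      have s2 : (18/10)*((999/1000)*y^2)*r^4 ≤ (18/10)*x^3*r^4 := by gcongr
      have e27 : (27:ℝ)^(e3 (n+3)) = 3^(e3 (n+3)) * 9^(e3 (n+3)) := by rw [← mul_pow]; norm_num
      rw [e27] at G
      have s3 : (y^2*r) * (174 * (3^(e3 (n+3)) * 9^(e3 (n+3))) * y * (64 * |k| * y)^(2*(n+3))) ≤ (y^2*r) * r^3 := by gcongr
      calc (7/10) * (3^(e3 (n+3)) * 3^3 * y * rr y k (n+5)) * (9^(e3 (n+3)) * (64 * |k| * y)^(2*(n+3)))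
          ≤ (7/10) * (3^(e3 (n+3)) * 3^3 * y * ((16001/1000)*y^2*r)) * (9^(e3 (n+3)) * (64 * |k| * y)^(2*(n+3))) := by gcongr
        _ = (30241890/17400000) * ((y^2*r) * (174 * (3^(e3 (n+3)) * 9^(e3 (n+3))) * y * (64 * |k| * y)^(2*(n+3)))) := by ring
        _ ≤ (30241890/17400000) * ((y^2*r) * r^3) := by gcongr
        _ < (18/10)*((999/1000)*y^2)*r^4 := by
          have : 0 < y^2*r^4 := by positivity
          linarith
        _ ≤ _ := s2
        _ ≤ _ := s1
  obtain ⟨n, hn⟩ := exists_nat_gt ((10/7)*(x*x'))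
  have c := claim n
  have hr : ∀ m, 1 ≤ rr y k (m+3) := by
    intro m
    induction m with
    | zero =>
      have := (rr_34 y k hy hk).1
      have : (1:ℝ) ≤ y^3 := one_le_pow₀ hy1
      simp only [zero_add]; linarith
    | succ m ih =>
      have := (rr_ratio3 y k hy hk m).1
      change 1 ≤ rr y k (m+4)
      nlinarith
  have h1 : (n:ℝ) ≤ 3^(e3 (n+4)) := by
    have a : n ≤ 3^(e3 (n+4)) := by
      calc n ≤ 3^n := (Nat.lt_pow_self (by norm_num)).le
        _ ≤ _ := Nat.pow_le_pow_right (by norm_num) (by have := e3_ge (n+4); omega)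
    exact_mod_cast a
  have h2 : (n:ℝ) * 1 * 1 ≤ 3^(e3 (n+4)) * y * rr y k (n+4) := by
    gcongr
    exact hr (n+1)
  linarith

end
section

structure AnchR (k x y x' y' u v : ℝ) : Prop where
  n1 : u^2 - k*v^2 = x*x'
  c1 : u^3 + 3*k*u*v^2 = y*y' - k
  c2 : 3*u^2*v + k*v^3 = y' - y
  hy : 0 < y
  hx : 0 < x
  hx' : 0 < x'
  hK : 1 ≤ |k|
  hk : |k| ≤ y^2/100000
  small : 100 * |k| * v^2 ≤ u^2
  gap : 8 * x^2 ≤ x'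
  hy' : y'^2 ≤ (1001/1000)*x'^3
  lo : (999/1000)*y^2 ≤ x^3
  hi : x^3 ≤ (1001/1000)*y^2
  hy6 : 8*10^14 * |k|^6 ≤ y^2
  hy4 : 77000 * |k|^4 ≤ y

lemma Anch.toR {k x y x' y' u v : ℤ} (h : Anch k x y x' y' u v) : AnchR k x y x' y' u v := by
  have hK : (1:ℝ) ≤ |(k:ℝ)| := by
    have := Int.one_le_abs h.hk
    exact_mod_cast this
  have b1 : (100000:ℝ) * |(k:ℝ)|^2 ≤ x := by exact_mod_cast h.b1
  have b2 : (6000000000:ℝ) * |(k:ℝ)|^8 ≤ (x:ℝ)^3 := by exact_mod_cast h.b2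
  have h1 : (y:ℝ)^2 = (x:ℝ)^3 + k := by exact_mod_cast h.h1
  have h2 : (y':ℝ)^2 = (x':ℝ)^3 + k := by exact_mod_cast h.h2
  have hy : (0:ℝ) < y := by exact_mod_cast h.hy
  have gap : (8:ℝ)*(x:ℝ)^2 ≤ x' := by exact_mod_cast h.gap
  have ka := abs_le.mp (le_refl |(k:ℝ)|)
  obtain ⟨K, hKd⟩ : ∃ K, |(k:ℝ)| = K := ⟨_, rfl⟩
  have sm : (100:ℝ) * |(k:ℝ)| * (v:ℝ)^2 ≤ (u:ℝ)^2 := by exact_mod_cast h.small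
  rw [hKd] at hK b1 b2 ka sm
  have K2 : 1 ≤ K^2 := one_le_pow₀ hK
  have KK2 : K ≤ K^2 := le_self_pow₀ hK (by norm_num)
  have K6 : K ≤ K^6 := le_self_pow₀ hK (by norm_num)
  have K8 : K ≤ K^8 := le_self_pow₀ hK (by norm_num)
  have hx : (100000:ℝ) ≤ x := by linarith
  have x3 : (10^15:ℝ)*K^6 ≤ (x:ℝ)^3 := by
    calc (10^15:ℝ)*K^6 = ((100000:ℝ) * K^2)^3 := by ring
      _ ≤ _ := by gcongr
  have hxx' : (x:ℝ) ≤ x' := by nlinarith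
  have x'3 : (x:ℝ)^3 ≤ (x':ℝ)^3 := by gcongr
  have hsq : ∀ t:ℝ, 0 ≤ t → t^2 ≤ (y:ℝ)^2 → t ≤ y := fun t ht h => le_of_sq_le_sq h hy.le
  refine ⟨by exact_mod_cast h.rel.n1, by exact_mod_cast h.rel.c1, by exact_mod_cast h.rel.c2, hy, by linarith, by linarith, by rw [hKd]; exact hK, ?_, by rw [hKd]; exact sm, gap, ?_, ?_, ?_, ?_, ?_⟩
  · rw [hKd]; linarith
  · linarith
  · linarith
  · linarith
  · rw [hKd]; linarith
  · rw [hKd]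
    apply hsq _ (by positivity)
    have : (77000*K^4)^2 = 77000^2*K^8 := by ring
    linarith

lemma AnchR.step1 {k x y x' y' u v : ℝ} (h : AnchR k x y x' y' u v) (hw : 1 ≤ |u*(-1)+v*(3*y)|) :
    (265/100)*x^2*y^2 ≤ x' * |k|^2 := by
  obtain ⟨n1,c1,c2,hy,hx,hx',hK,hk,small,gap,hy',lo,hi,hy6,hy4⟩ := h
  have e : EE y k (3*y) (-1) = 8*k*y := by unfold EE; ring
  have := key_ineq k x y x' y' u v (3*y) (-1) 1 (8 * |k| * y) n1 c1 c2 hy hk (by positivity) (by norm_num) (by linarith) small hx hx' one_pos hw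
    (by rw [e, abs_mul, abs_mul, abs_of_pos hy]; norm_num) hy'
  rcases this with h | h
  · exfalso
    have : x*(8*x^2) ≤ x*x' := by gcongr
    linarith [sq_pos_of_pos hy]
  · have : y^2*((265/100)*x^2*y^2) ≤ y^2*(x' * |k|^2) := by
      have : 0 ≤ x^2*y^4 := by positivity
      linarith
    exact le_of_mul_le_mul_left this (by positivity)

lemma AnchR.step2 {k x y x' y' u v : ℝ} (h : AnchR k x y x' y' u v) (s1 : (265/100)*x^2*y^2 ≤ x' * |k|^2) (hw : 1 ≤ |u*(-9*y)+v*(27*y^2-8*k)|) :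
    36000 * y^5 < x*x' := by
  obtain ⟨n1,c1,c2,hy,hx,hx',hK,hk,small,gap,hy',lo,hi,hy6,hy4⟩ := h
  have ka := abs_le.mp (le_refl |k|)
  have e : EE y k (27*y^2-8*k) (-9*y) = 8*k^2*(189*y^2-64*k) := by unfold EE; ring
  have hr : (2699/100)*y^2 ≤ 27*y^2-8*k := by linarith
  have hr' : 27*y^2-8*k ≤ (2701/100)*y^2 := by linarith
  have y2 : 0 < y^2 := by positivity
  have hE : |EE y k (27*y^2-8*k) (-9*y)| ≤ 1513 * |k|^2 * y^2 := by
    rw [e, abs_mul, abs_of_nonneg (by positivity), sq_abs, abs_of_pos (by linarith)]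
    have : k^2*(8*(189*y^2-64*k)) ≤ k^2*(1513*y^2) := mul_le_mul_of_nonneg_left (by linarith) (by positivity)
    linarith
  have K4 : |k|^2 ≤ |k|^4 := pow_le_pow_right₀ hK (by norm_num)
  have y77 : 77000 ≤ y := by
    have : 1 ≤ |k|^4 := one_le_pow₀ hK
    linarith
  rcases key_ineq k x y x' y' u v (27*y^2-8*k) (-9*y) 1 (1513 * |k|^2*y^2) n1 c1 c2 hy hk (by linarith) (by linarith) (by linarith) small hx hx' one_pos hw hE hy' with h | h
  · exfalso
    have a1 : y*(27*y^2-8*k) ≤ y*((2701/100)*y^2) := by gcongr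
    have a2 : x*((265/100)*x^2*y^2) ≤ x*(x' * |k|^2) := by gcongr
    have a3 : y^2*((999/1000)*y^2) ≤ y^2*x^3 := by gcongr
    have a4 : 26 * y^4 ≤ 10*(x*x' * |k|^2) := by linarith [pow_pos hy 4]
    have a5 : x*x' * |k|^2 ≤ (7/10*(2701/100)*y^3) * |k|^2 := mul_le_mul_of_nonneg_right (by linarith) (by positivity)
    have a6 : y^3*(77000 * |k|^2) ≤ y^3*y := by gcongr; linarith
    have : 0 < y^4 := by positivity
    linarith
  · have a1 : ((2699/100)*y^2)^4 ≤ (27*y^2-8*k)^4 := by gcongr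
    have a2 : (21/10)*x^2*((2699/100)*y^2)^4 ≤ x'*(1513 * |k|^2*y^2)^2 := by
      refine le_trans ?_ (le_trans h ?_)
      · have : (21/10)*x^2*((2699/100)*y^2)^4 ≤ (21/10)*x^2*(27*y^2-8*k)^4 := by gcongr
        linarith
      · linarith
    have a3 : y^4*((486/1000)*x^2*y^4) ≤ y^4*(x' * |k|^4) := by
      have : 0 ≤ x^2*y^8 := by positivity
      have e1 : (21/10)*x^2*((2699/100)*y^2)^4 = (21/10)*(2699/100)^4*(x^2*y^8) := by ring
      have e2 : x'*(1513 * |k|^2*y^2)^2 = 1513^2*(y^4*(x' * |k|^4)) := by ring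
      rw [e1, e2] at a2
      linarith
    have a4 := le_of_mul_le_mul_left a3 (by positivity)
    have a5 : x*((486/1000)*x^2*y^4) ≤ x*(x' * |k|^4) := by gcongr
    have a6 : y^4*((999/1000)*y^2) ≤ y^4*x^3 := by gcongr
    have a7 : x*x'*(77000 * |k|^4) ≤ x*x'*y := by gcongr
    have : 0 < y^6 := by positivity
    have a8 : y*(36000*y^5) < y*(x*x') := by linarith
    exact lt_of_mul_lt_mul_left a8 hy.le

lemma AnchR.final {k x y x' y' u v : ℤ} (hk0 : k ≠ 0) (h : AnchR k x y x' y' u v) (hb : (36000:ℝ) * y^5 < x*x') : False := by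
  obtain ⟨n1,c1,c2,hy,hx,hx',hK,hk,small,gap,hy',lo,hi,hy6,hy4⟩ := h
  have k0 : (k:ℝ) ≠ 0 := by exact_mod_cast hk0
  have K4 : |(k:ℝ)|^2 ≤ |(k:ℝ)|^4 := pow_le_pow_right₀ hK (by norm_num)
  have hk2 : |(k:ℝ)| < (y:ℝ)^2 := by
    have : 0 < (y:ℝ)^2 := by positivity
    linarith
  refine chain y k x x' (fun n => (u:ℝ)*ss y k n + v*rr y k n ≠ 0) hK hy hk hy6 (by linarith) hx hx' lo ?_ ?_ hb
  · intro n
    by_contra hc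
    push Not at hc
    obtain ⟨h1, h2⟩ := hc
    have c := casorati y k k0 n
    have hu : (u:ℝ) * (rr y k n * ss y k (n+1) - ss y k n * rr y k (n+1)) = 0 := by linear_combination rr y k n * h2 - rr y k (n+1) * h1
    have hv : (v:ℝ) * (rr y k n * ss y k (n+1) - ss y k n * rr y k (n+1)) = 0 := by linear_combination ss y k (n+1) * h1 - ss y k n * h2
    have hu := (mul_eq_zero.mp hu).resolve_right c
    have hv := (mul_eq_zero.mp hv).resolve_right c
    rw [hu, hv] at n1
    have : (0:ℝ) < x*x' := by positivity
    linarith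
  · intro n hn
    obtain ⟨A, B, hA, hB⟩ := rs_int y k hk0 n
    have p3 : (0:ℝ) < 3^(e3 n) := by positivity
    have hw : (1/3^(e3 n):ℝ) ≤ |(u:ℝ)*ss y k n + v*rr y k n| := by
      rw [div_le_iff₀ p3]
      have e : |(u:ℝ)*ss y k n + v*rr y k n| * 3^(e3 n) = |((u*B+v*A : ℤ):ℝ)| := by
        conv_lhs => rw [← abs_of_pos p3, ← abs_mul]
        congr 1; push_cast; rw [← hA, ← hB]; ring
      rw [e]
      have : u*B+v*A ≠ 0 := by
        intro h0
        rw [h0] at e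
        simp at e
        exact hn e
      exact_mod_cast Int.one_le_abs this
    have r := rr_bounds y k hy hk n
    have s := ss_bounds y k hy hk n
    rcases key_ineq k x y x' y' u v (rr y k n) (ss y k n) (1/3^(e3 n)) _ n1 c1 c2 hy hk r.1 s.1 s.2 small hx hx' (by positivity) hw (EE_bound y k hy k0 hk2 n) hy' with h | h
    · left
      have := mul_le_mul_of_nonneg_left h p3.le
      have e : (3:ℝ)^(e3 n) * (x*x'*(1/3^(e3 n))) = x*x' := by field_simp
      rw [e] at this
      linarith
    · right
      have := mul_le_mul_of_nonneg_left h (show (0:ℝ) ≤ 9^(e3 n) by positivity)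
      have e9 : (9:ℝ)^(e3 n) = (3^(e3 n))^2 := by rw [← pow_mul, mul_comm, pow_mul]; norm_num
      have e : (9:ℝ)^(e3 n) * (21/10*(1/3^(e3 n))^2*x^2*(rr y k n)^4) = 21/10*x^2*(rr y k n)^4 := by rw [e9]; field_simp
      rw [e] at this
      have e2 : ((64 * |(k:ℝ)| * y)^n)^2 = (64 * |(k:ℝ)| * y)^(2*n) := by rw [← pow_mul, mul_comm n]
      rw [mul_pow, e2] at this
      have : 0 ≤ x' * (9^(e3 n) * (64 * |(k:ℝ)| * y)^(2*n)) := by positivity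
      linarith

lemma anch_w1 {k x y x' y' u v : ℤ} (h : Anch k x y x' y' u v) : u*(-1)+v*(3*y) ≠ 0 := by
  intro hw
  have hr := h.toR
  have hw' : (u:ℝ)*(-1)+v*(3*y) = 0 := by exact_mod_cast hw
  have id := key_ident k y y' u v (3*y) (-1) hr.c1 hr.c2
  rw [hw'] at id
  have id2 : 8*k*y*y' = 27*y^4-18*k*y^2-k^2 := by
    have : (8:ℝ)*k*y*y' = 27*y^4-18*k*y^2-k^2 := by unfold EE RR at id; linear_combination -id
    exact_mod_cast this
  have hd : y ∣ k^2 := ⟨27*y^3-18*k*y-8*k*y', by linear_combination id2⟩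
  have hle := Int.le_of_dvd (by have := h.hk; positivity) hd
  have hle' : (y:ℝ) ≤ |(k:ℝ)|^2 := by rw [sq_abs]; exact_mod_cast hle
  have K4 : |(k:ℝ)|^2 ≤ |(k:ℝ)|^4 := pow_le_pow_right₀ hr.hK (by norm_num)
  have := hr.hy4
  have := hr.hy
  linarith

lemma anch_w2 {k x y x' y' u v : ℤ} (h : Anch k x y x' y' u v) : u*(-9*y)+v*(27*y^2-8*k) ≠ 0 := by
  intro hw
  have hr := h.toR
  have hw' : (u:ℝ)*(-9*y)+v*(27*y^2-8*k) = 0 := by exact_mod_cast hw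
  have id := key_ident k y y' u v (27*y^2-8*k) (-9*y) hr.c1 hr.c2
  rw [hw'] at id
  have id2 : 8*k^2*(189*y^2-64*k)*y' = y*(19683*y^6-30618*k*y^4+14175*k^2*y^2-2240*k^3) := by
    have : (8:ℝ)*k^2*(189*y^2-64*k)*y' = y*(19683*y^6-30618*k*y^4+14175*k^2*y^2-2240*k^3) := by unfold EE RR at id; linear_combination -id
    exact_mod_cast this
  have hd : (189*y^2-64*k) ∣ 80621568000*k^4 :=
    ⟨189*y*(y*(703096443*y^4-855620010*k*y^2+216611415*k^2) - 189^3*8*k^2*y') - 1259712000*k^3, by linear_combination (189^4*y) * id2⟩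
  have k0 := h.hk
  have hle := Int.le_of_dvd (by positivity) hd
  have hle' : (189:ℝ)*y^2-64*k ≤ 80621568000 * |(k:ℝ)|^4 := by
    rw [show |(k:ℝ)|^4 = (k:ℝ)^4 by rw [← abs_pow]; exact abs_of_nonneg (by positivity)]; exact_mod_cast hle
  have K4 : |(k:ℝ)|^4 ≤ |(k:ℝ)|^6 := pow_le_pow_right₀ hr.hK (by norm_num)
  have h1 := hr.hy6
  have h2 := hr.hk
  have h3 := hr.hy
  have h4 := le_abs_self (k:ℝ)
  have : 0 < |(k:ℝ)|^4 := by have := hr.hK; positivity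
  linarith

theorem thmA {k x y x' y' u v : ℤ} (h : Anch k x y x' y' u v) : False := by
  have hr := h.toR
  refine hr.final h.hk (hr.step2 (hr.step1 ?_) ?_)
  · exact_mod_cast Int.one_le_abs (anch_w1 h)
  · exact_mod_cast Int.one_le_abs (anch_w2 h)

end
section

/-- binary cubic form with binomial coefficients -/
def cub (a b c d X Y : ℤ) : ℤ := a*X^3+3*b*X^2*Y+3*c*X*Y^2+d*Y^3

structure RepM (a b c d x y p q r s : ℤ) : Prop where
  det : p*s-q*r = 1
  eq : ∀ X Y, cub a b c d (p*X+r*Y) (q*X+s*Y) = cub 1 0 (-x) (2*y) X Y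

lemma RepM.comp {a b c d x y p q r s x' y' p' q' r' s' : ℤ} (h : RepM a b c d x y p q r s) (h' : RepM a b c d x' y' p' q' r' s') :
    RepM 1 0 (-x) (2*y) x' y' (s*p'-r*q') (p*q'-q*p') (s*r'-r*s') (p*s'-q*r') := by
  refine ⟨by linear_combination (p'*s'-q'*r') * h.det + h'.det, fun X Y => ?_⟩
  rw [← h.eq, ← h'.eq]
  congr 1
  · linear_combination (p'*X+r'*Y)*h.det
  · linear_combination (q'*X+s'*Y)*h.det

lemma RepM.coeffs {a b c d x y p q r s : ℤ} (h : RepM a b c d x y p q r s) :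
    cub a b c d p q = 1 ∧ a*p^2*r+b*(p^2*s+2*p*q*r)+c*(2*p*q*s+q^2*r)+d*q^2*s = 0 ∧
    a*p*r^2+b*(2*p*r*s+q*r^2)+c*(p*s^2+2*q*r*s)+d*q*s^2 = -x ∧ cub a b c d r s = 2*y := by
  have h1 := h.eq 1 0
  have h2 := h.eq 0 1
  have h3 := h.eq 1 1
  have h4 := h.eq 1 (-1)
  simp only [cub] at *
  refine ⟨by linarith, by linarith, by linarith, by linarith⟩

lemma RepM.mrel {k x y x' y' p q r s : ℤ} (hP : y^2 = x^3 + k) (h : RepM 1 0 (-x) (2*y) x' y' p q r s) :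
    MRel k x y x' y' (x*p-y*q) (-q) := by
  obtain ⟨c1, c2, c3, c4⟩ := h.coeffs
  have hd := h.det
  simp only [cub] at c1 c4
  have hk : k = y^2 - x^3 := by linarith
  have hx' : x' = x*p^2-2*y*p*q+x^2*q^2 := by
    have e : (1*p^2*r+0*(p^2*s+2*p*q*r)+(-x)*(2*p*q*s+q^2*r)+(2*y)*q^2*s)^2 - (1*p^3+3*0*p^2*q+3*(-x)*p*q^2+2*y*q^3)*(1*p*r^2+0*(2*p*r*s+q*r^2)+(-x)*(p*s^2+2*q*r*s)+(2*y)*q*s^2) = (p*s-q*r)^2*(x*p^2-2*y*p*q+x^2*q^2) := by ring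
    rw [c1, c2, c3, hd] at e
    linarith
  have hy' : 2*y' = 2*y*p^3-6*x^2*p^2*q+6*x*y*p*q^2-(4*y^2-2*x^3)*q^3 := by
    have e : (1*p^3+3*0*p^2*q+3*(-x)*p*q^2+2*y*q^3)^2*(1*r^3+3*0*r^2*s+3*(-x)*r*s^2+2*y*s^3)
       - 3*(1*p^3+3*0*p^2*q+3*(-x)*p*q^2+2*y*q^3)*(1*p^2*r+0*(p^2*s+2*p*q*r)+(-x)*(2*p*q*s+q^2*r)+(2*y)*q^2*s)*(1*p*r^2+0*(2*p*r*s+q*r^2)+(-x)*(p*s^2+2*q*r*s)+(2*y)*q*s^2)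
       + 2*(1*p^2*r+0*(p^2*s+2*p*q*r)+(-x)*(2*p*q*s+q^2*r)+(2*y)*q^2*s)^3 = (p*s-q*r)^3*(2*y*p^3-6*x^2*p^2*q+6*x*y*p*q^2-(4*y^2-2*x^3)*q^3) := by ring
    rw [c1, c2, c3, c4, hd] at e
    linarith
  have f : p^3-3*x*p*q^2+2*y*q^3 = 1 := by linarith
  have c2 : 3*(x*p-y*q)^2*(-q) + k*(-q)^3 = y' - y := by
    rw [hk]
    have : 2*(3*(x*p-y*q)^2*(-q) + (y^2-x^3)*(-q)^3) = 2*(y'-y) := by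
      linear_combination (-1)*hy' - 2*y*f
    linarith
  refine ⟨by rw [hk, hx']; ring, ?_, c2⟩
  have : y' = y + (3*(x*p-y*q)^2*(-q) + k*(-q)^3) := by linarith
  rw [this, hk]
  linear_combination x^3*f

lemma MRel.v_ne {k x y x' y' u v : ℤ} (h : MRel k x y x' y' u v) (h1 : y^2 = x^3+k) (h2 : y'^2 = x'^3+k) (hne : x ≠ x') : v ≠ 0 := by
  rintro rfl
  have hy : y' = y := by have := h.c2; linarith
  apply hne
  subst hy
  have : x^3 = x'^3 := by linarith
  exact (Odd.strictMono_pow (by decide : Odd 3)).injective this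

lemma MRel.neg {k x y x' y' u v : ℤ} (h : MRel k x y x' y' u v) : MRel k x (-y) x' (-y') u (-v) := by
  obtain ⟨a, b, c⟩ := h
  exact ⟨by linarith, by linarith, by linarith⟩

end
section

lemma gapR (k x y x' y' u v : ℝ) (n1 : u^2 - k*v^2 = x*x') (c2 : 3*u^2*v + k*v^3 = y' - y)
   (h1 : y^2 = x^3+k) (h2 : y'^2 = x'^3+k) (hv : 1 ≤ v^2) (small : 100 * |k| * v^2 ≤ u^2) (hxx : x ≤ x') (hx : 30 ≤ x) (hk : 1616 * |k| ≤ x^3) :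
   8*x^2 ≤ x' := by
  have ka := abs_le.mp (le_refl |k|)
  have v2 : 0 ≤ v^2 := sq_nonneg v
  have kv1 : k*v^2 ≤ |k| * v^2 := by gcongr; exact ka.2
  have kv2 : -(|k| * v^2) ≤ k*v^2 := by
    have := mul_le_mul_of_nonneg_right ka.1 v2
    linarith
  have hx'0 : 0 < x' := by linarith
  have hN : 0 < x*x' := by positivity
  have a1 : (295/100)*(x*x') ≤ 3*u^2+k*v^2 := by linarith
  have a2 : ((295/100)*(x*x'))^2 ≤ (3*u^2+k*v^2)^2 := by gcongr
  have a3 : (3*u^2+k*v^2)^2 ≤ (y'-y)^2 := by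
    have : (y'-y)^2 = v^2*(3*u^2+k*v^2)^2 := by rw [← c2]; ring
    rw [this]
    exact le_mul_of_one_le_left (sq_nonneg _) hv
  have x3 : x^3 ≤ x'^3 := by gcongr
  have p3 : 0 < x^3 := by positivity
  have x'2 : 0 < x'^2 := by positivity
  have a4 : 2*x^2 ≤ x' := by
    have : (y'-y)^2 ≤ 2*(y'^2+y^2) := by linarith [sq_nonneg (y'+y)]
    have : x'^2*(2*x^2) ≤ x'^2*x' := by linarith
    exact le_of_mul_le_mul_left this x'2
  have a5 : 200000*x^3 ≤ x'^3 := by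
    calc 200000*x^3 ≤ 8*x^3*x^3 := by
          have : (30:ℝ)^3 ≤ x^3 := by gcongr
          have := mul_le_mul_of_nonneg_left this p3.le
          linarith
      _ = (2*x^2)^3 := by ring
      _ ≤ _ := by gcongr
  have a6 : (y'-y)^2 ≤ (101/100)*y'^2+101*y^2 := by linarith [sq_nonneg (y'/10+10*y)]
  have : x'^2*(8*x^2) ≤ x'^2*x' := by linarith [sq_nonneg (x*x')]
  exact le_of_mul_le_mul_left this x'2

lemma smallPos (k x y x' y' u v : ℝ) (k0 : 0 < k) (n1 : u^2 - k*v^2 = x*x') (c2 : 3*u^2*v + k*v^3 = y' - y)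
   (h1 : y^2 = x^3+k) (h2 : y'^2 = x'^3+k) (hxx : x ≤ x') (hx : 30 ≤ x) (hk : 1616 * k ≤ x^3) : 100*k*v^2 ≤ u^2 := by
  have hN : 0 < x*x' := by nlinarith
  have v2 : 0 ≤ v^2 := sq_nonneg v
  have a1 : x*x' ≤ u^2 := by nlinarith
  have x3 : x^3 ≤ x'^3 := by gcongr
  have p3 : 0 < x^3 := by positivity
  have a2 : 9*(x*x')^2*v^2 ≤ 5*x'^3 := by
    have e : (y'-y)^2 = v^2*(3*u^2+k*v^2)^2 := by rw [← c2]; ring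
    have : (y'-y)^2 ≤ 2*(y'^2+y^2) := by linarith [sq_nonneg (y'+y)]
    have : (3*(x*x'))^2 ≤ (3*u^2+k*v^2)^2 := by
      have : 0 ≤ k*v^2 := by positivity
      gcongr; linarith
    have : v^2*(3*(x*x'))^2 ≤ v^2*(3*u^2+k*v^2)^2 := by gcongr
    linarith
  have x'2 : 0 < x'^2 := by nlinarith
  have a3 : 9*x^2*v^2 ≤ 5*x' := by
    have : x'^2*(9*x^2*v^2) ≤ x'^2*(5*x') := by linarith
    exact le_of_mul_le_mul_left this x'2
  have a4 : k*(9*x^2*v^2) ≤ k*(5*x') := by gcongr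
  have a5 : x^2*(100*k*v^2) ≤ x^2*(x*x') := by
    have : x'*(1616*k) ≤ x'*x^3 := by
      apply mul_le_mul_of_nonneg_left hk; linarith
    have : 0 ≤ x'*k := by apply mul_nonneg _ k0.le; linarith
    linarith
  have := le_of_mul_le_mul_left a5 (by positivity)
  linarith

lemma three_lines (U V n ε : ℝ) (hn : 0 < n) (h : U^2+V^2 = n^2) (hb : |V*(3*U^2-V^2)| ≤ ε*n^3) :
    ∃ t ∈ ({0, √3, -√3} : Finset ℝ), |V - t*U| ≤ ε*n := by
  have s3 : √3^2 = (3:ℝ) := Real.sq_sqrt (by norm_num)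
  have n2 : 0 < n^2 := by positivity
  have key : ∀ L M : ℝ, |L*M| ≤ ε*n^3 → n^2 ≤ |M| → |L| ≤ ε*n := by
    intro L M h1 h2
    rw [abs_mul] at h1
    have : n^2 * |L| ≤ n^2*(ε*n) := by
      have := mul_le_mul_of_nonneg_left h2 (abs_nonneg L)
      linarith
    exact le_of_mul_le_mul_left this n2
  by_cases hV : 4*V^2 ≤ n^2
  · refine ⟨0, by simp, ?_⟩
    have := key V (3*U^2-V^2) hb (by rw [abs_of_nonneg] <;> linarith)
    simpa using this
  push Not at hV
  have hUV : |U| ≤ √3 * |V| := by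
    apply le_of_sq_le_sq _ (by positivity)
    rw [sq_abs, mul_pow, sq_abs, s3]; linarith
  have hUV2 : U^2 ≤ √3 * |U*V| := by
    have := mul_le_mul_of_nonneg_left hUV (abs_nonneg U)
    rw [abs_mul, ← sq_abs U]; linarith
  rcases le_total 0 (U*V) with hs | hs
  · refine ⟨√3, by simp, ?_⟩
    rw [abs_of_nonneg hs] at hUV2
    refine key _ (V*(V+√3*U)) ?_ ?_
    · rw [← abs_neg]; convert hb using 2; linear_combination (-V*U^2)*s3 + 2*V*U^2*s3
    · rw [abs_of_nonneg] <;> linarith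
  · refine ⟨-√3, by simp, ?_⟩
    rw [abs_of_nonpos hs] at hUV2
    refine key _ (V*(V-√3*U)) ?_ ?_
    · rw [← abs_neg]; convert hb using 2; linear_combination (V*U^2)*s3
    · rw [abs_of_nonneg] <;> linarith

end
section

noncomputable def epsK (k T : ℝ) : ℝ := 2*√(-k)/√(T^3)

lemma typeR (k x y x' y' u v T : ℝ) (hk : k < 0) (hT : 0 < T) (n1 : u^2 - k*v^2 = x*x') (c2 : 3*u^2*v + k*v^3 = y' - y)
   (h1 : y^2 = x^3+k) (h2 : y'^2 = x'^3+k) (hx : T ≤ x) (hx' : T ≤ x') :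
   ∃ t ∈ ({0, √3, -√3} : Finset ℝ), |√(-k)*v - t*u| ≤ epsK k T * √(x*x') := by
  have hx0 : 0 < x := by linarith
  have hx0' : 0 < x' := by linarith
  have sK : √(-k)^2 = -k := Real.sq_sqrt (by linarith)
  have sn : √(x*x')^2 = x*x' := Real.sq_sqrt (by positivity)
  have sT : √(T^3)^2 = T^3 := Real.sq_sqrt (by positivity)
  have pT : 0 < √(T^3) := Real.sqrt_pos.mpr (by positivity)
  have pn : 0 < √(x*x') := Real.sqrt_pos.mpr (by positivity)
  apply three_lines u (√(-k)*v) (√(x*x')) (epsK k T) pn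
  · rw [mul_pow, sK, sn]; linarith
  · have e : √(-k)*v*(3*u^2-(√(-k)*v)^2) = √(-k)*(y'-y) := by
      rw [mul_pow, sK, ← c2]; ring
    rw [e, abs_mul, abs_of_nonneg (Real.sqrt_nonneg _)]
    have n6 : (√(x*x')^3)^2 = x^3*x'^3 := by
      calc (√(x*x')^3)^2 = (√(x*x')^2)^3 := by ring
        _ = _ := by rw [sn]; ring
    have T3 : T^3 ≤ x^3 := by gcongr
    have T3' : T^3 ≤ x'^3 := by gcongr
    have b1 : |y'| * √(T^3) ≤ √(x*x')^3 := by
      apply le_of_sq_le_sq _ (by positivity)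
      rw [mul_pow, sq_abs, sT, n6, h2]
      have : (x'^3+k)*T^3 ≤ x'^3*x^3 := by
        apply mul_le_mul _ T3 (by positivity) (by positivity); linarith
      linarith
    have b2 : |y| * √(T^3) ≤ √(x*x')^3 := by
      apply le_of_sq_le_sq _ (by positivity)
      rw [mul_pow, sq_abs, sT, n6, h1]
      apply mul_le_mul _ T3' (by positivity) (by positivity); linarith
    have b3 : |y'-y| * √(T^3) ≤ 2*√(x*x')^3 := by
      have := mul_le_mul_of_nonneg_right (abs_sub y' y) pT.le
      linarith
    unfold epsK
    rw [div_mul_eq_mul_div, le_div_iff₀ pT]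
    have := mul_le_mul_of_nonneg_left b3 (Real.sqrt_nonneg (-k))
    linarith

lemma combR (k x0 x x' u1 v1 u2 v2 u v T t : ℝ) (hk : k < 0) (hT : 0 < T) (hx0 : 0 < x0) (hx : 0 < x) (hx' : 0 < x')
   (n1 : u1^2 - k*v1^2 = x0*x) (n2 : u2^2-k*v2^2 = x0*x') (n3 : u^2-k*v^2 = x*x') (hv : x0*v = u1*v2-v1*u2)
   (t1 : |√(-k)*v1 - t*u1| ≤ epsK k T * √(x0*x)) (t2 : |√(-k)*v2 - t*u2| ≤ epsK k T * √(x0*x')) (hb : 1616*(-k) ≤ T^3) :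
   100*(-k)*v^2 ≤ u^2 := by
  have sK : √(-k)^2 = -k := Real.sq_sqrt (by linarith)
  have u1b : |u1| ≤ √(x0*x) := by
    apply Real.le_sqrt_of_sq_le; rw [sq_abs]; nlinarith [sq_nonneg v1]
  have u2b : |u2| ≤ √(x0*x') := by
    apply Real.le_sqrt_of_sq_le; rw [sq_abs]; nlinarith [sq_nonneg v2]
  have e : x0*(√(-k)*v) = u1*(√(-k)*v2 - t*u2) - (√(-k)*v1 - t*u1)*u2 := by linear_combination √(-k)*hv
  have ee : 0 ≤ epsK k T := by unfold epsK; positivity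
  have b1 : |x0*(√(-k)*v)| ≤ 2*epsK k T*(√(x0*x)*√(x0*x')) := by
    rw [e]
    refine (abs_sub _ _).trans ?_
    rw [abs_mul, abs_mul]
    have : |u1| * |√(-k)*v2 - t*u2| ≤ √(x0*x)*(epsK k T * √(x0*x')) := by gcongr
    have : |√(-k)*v1 - t*u1| * |u2| ≤ (epsK k T * √(x0*x))*√(x0*x') := by gcongr
    linarith
  have b2 : (x0*(√(-k)*v))^2 ≤ (2*epsK k T*(√(x0*x)*√(x0*x')))^2 := by
    rw [← sq_abs (x0*(√(-k)*v))]; gcongr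
  have e2 : (2*epsK k T*(√(x0*x)*√(x0*x')))^2 = x0^2*(4*epsK k T^2*(x*x')) := by
    have s1 : √(x0*x)^2 = x0*x := Real.sq_sqrt (by positivity)
    have s2 : √(x0*x')^2 = x0*x' := Real.sq_sqrt (by positivity)
    calc _ = 4*epsK k T^2*(√(x0*x)^2*√(x0*x')^2) := by ring
      _ = _ := by rw [s1, s2]; ring
  rw [e2, mul_pow] at b2
  have b3 := le_of_mul_le_mul_left b2 (by positivity)
  rw [mul_pow, sK] at b3
  have e3 : epsK k T^2 * T^3 = 4*(-k) := by
    unfold epsK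
    have sT : √(T^3)^2 = T^3 := Real.sq_sqrt (by positivity)
    rw [div_pow, sT, mul_pow, sK]; field_simp; ring
  have b4 : 404*epsK k T^2 ≤ 1 := by
    have : T^3*(404*epsK k T^2) ≤ T^3*1 := by linarith
    exact le_of_mul_le_mul_left this (by positivity)
  have := mul_le_mul_of_nonneg_right b4 (show 0 ≤ x*x' by positivity)
  linarith

end
section

def Big (k x : ℤ) : Prop := 100000*|k|^2 ≤ x ∧ 6000000000*|k|^8 ≤ x^3

lemma Big.mono {k x x' : ℤ} (h : Big k x) (hx : x ≤ x') : Big k x' := by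
  have h0 : 0 ≤ x := le_trans (by positivity) h.1
  exact ⟨h.1.trans hx, h.2.trans (by gcongr)⟩

lemma pairOK {k x y x' y' u v : ℤ} (hk : k ≠ 0) (h1 : y^2 = x^3+k) (h2 : y'^2 = x'^3+k) (h : MRel k x y x' y' u v)
    (small : 100 * |k| * v^2 ≤ u^2) (hxx : x < x') (hx : 30 ≤ x) (hk3 : 1616 * |k| ≤ x^3) : 8*x^2 ≤ x' ∧ ¬ Big k x := by
  have hv := h.v_ne h1 h2 hxx.ne
  have gap : 8*x^2 ≤ x' := by
    have hv1 : 1 ≤ v^2 := by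
      have : 0 < v^2 := by positivity
      omega
    have := gapR k x y x' y' u v (by exact_mod_cast h.n1) (by exact_mod_cast h.c2) (by exact_mod_cast h1) (by exact_mod_cast h2) (by exact_mod_cast hv1) (by exact_mod_cast small) (by exact_mod_cast hxx.le) (by exact_mod_cast hx) (by exact_mod_cast hk3)
    exact_mod_cast this
  refine ⟨gap, fun hB => ?_⟩
  have hy : y ≠ 0 := by
    rintro rfl
    have h3 : (0:ℤ) < x^3 := by positivity
    have : x^3 = -k := by linarith
    have := neg_le_abs k
    linarith
  rcases lt_or_gt_of_ne hy with hy | hy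
  · exact thmA ⟨h.neg, hk, by linarith, by linarith, by linarith, by rw [neg_sq]; exact small, gap, hB.1, hB.2⟩
  · exact thmA ⟨h, hk, hy, h1, h2, small, gap, hB.1, hB.2⟩

def itr : ℕ → ℤ → ℤ
  | 0, T => T
  | j+1, T => itr j (8*T^2)

lemma card_chain (k : ℤ) (j : ℕ) : ∀ (T : ℤ) (X : Finset ℤ), 0 ≤ T → Big k (itr j T) → (∀ x ∈ X, T ≤ x) →
    (∀ x ∈ X, ∀ x' ∈ X, x < x' → 8*x^2 ≤ x' ∧ ¬ Big k x) → X.card ≤ j+1 := by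
  induction j with
  | zero =>
    intro T X hT hB hX hp
    by_contra hc
    push Not at hc
    obtain ⟨a, ha, b, hb, hab⟩ := Finset.one_lt_card.mp hc
    rcases lt_or_gt_of_ne hab with h | h
    · exact (hp a ha b hb h).2 (hB.mono (hX a ha))
    · exact (hp b hb a ha h).2 (hB.mono (hX b hb))
  | succ j ih =>
    intro T X hT hB hX hp
    rcases X.eq_empty_or_nonempty with rfl | hne
    · simp
    have hm := X.min'_mem hne
    have := ih (8*T^2) (X.erase (X.min' hne)) (by positivity) hB ?_ ?_
    · rw [Finset.card_erase_of_mem hm] at this; omega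
    · intro x hx
      have hx' := Finset.mem_of_mem_erase hx
      have hlt : X.min' hne < x := lt_of_le_of_ne (X.min'_le x hx') (Finset.ne_of_mem_erase hx).symm
      refine le_trans ?_ (hp _ hm x hx' hlt).1
      have := hX _ hm
      gcongr
    · intro x hx x' hx'
      exact hp x (Finset.mem_of_mem_erase hx) x' (Finset.mem_of_mem_erase hx')

lemma typeZ {k x y x' y' u v T : ℤ} (hk : k < 0) (hT : 0 < T) (r : MRel k x y x' y' u v)
   (h1 : y^2 = x^3+k) (h2 : y'^2 = x'^3+k) (hx : T ≤ x) (hx' : T ≤ x') :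
   ∃ t ∈ ({0, √3, -√3} : Finset ℝ), |√(-k)*v - t*u| ≤ epsK k T * √((x:ℝ)*x') :=
  typeR k x y x' y' u v T (by exact_mod_cast hk) (by exact_mod_cast hT) (by exact_mod_cast r.n1) (by exact_mod_cast r.c2) (by exact_mod_cast h1)
   (by exact_mod_cast h2) (by exact_mod_cast hx) (by exact_mod_cast hx')

lemma combZ {k x0 y0 x y x' y' u1 v1 u2 v2 u v T : ℤ} {t : ℝ} (hk : k < 0) (hT : 0 < T) (hx0 : T ≤ x0) (hx : T ≤ x) (hx' : T ≤ x')
   (r1 : MRel k x0 y0 x y u1 v1) (r2 : MRel k x0 y0 x' y' u2 v2) (r : MRel k x y x' y' u v) (hv : x0*v = u1*v2-v1*u2)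
   (t1 : |√(-k)*v1 - t*u1| ≤ epsK k T * √((x0:ℝ)*x)) (t2 : |√(-k)*v2 - t*u2| ≤ epsK k T * √((x0:ℝ)*x')) (hb : 1616 * |k| ≤ T^3) :
   100 * |k| * v^2 ≤ u^2 := by
  rw [abs_of_neg hk] at *
  have := combR k x0 x x' u1 v1 u2 v2 u v T t (by exact_mod_cast hk) (by exact_mod_cast hT) (by exact_mod_cast hT.trans_le hx0) (by exact_mod_cast hT.trans_le hx) (by exact_mod_cast hT.trans_le hx')
    (by exact_mod_cast r1.n1) (by exact_mod_cast r2.n1) (by exact_mod_cast r.n1) (by exact_mod_cast hv) t1 t2 (by exact_mod_cast hb)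
  exact_mod_cast this

lemma smallPosZ {k x y x' y' u v : ℤ} (k0 : 0 < k) (r : MRel k x y x' y' u v)
   (h1 : y^2 = x^3+k) (h2 : y'^2 = x'^3+k) (hxx : x ≤ x') (hx : 30 ≤ x) (hk : 1616 * |k| ≤ x^3) : 100 * |k| * v^2 ≤ u^2 := by
  rw [abs_of_pos k0] at *
  have := smallPos k x y x' y' u v (by exact_mod_cast k0) (by exact_mod_cast r.n1) (by exact_mod_cast r.c2) (by exact_mod_cast h1) (by exact_mod_cast h2) (by exact_mod_cast hxx) (by exact_mod_cast hx) (by exact_mod_cast hk)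
  exact_mod_cast this

/-- number of colours -/
def zz (k : ℤ) : ℕ := if k < 0 then 3 else 1

theorem fiber_card (k : ℤ) (hk : k ≠ 0) (j : ℕ) (T : ℤ) (hT : 30 ≤ T) (hT3 : 1616 * |k| ≤ T^3) (hB : Big k (itr j T)) (a b c d : ℤ) (S : Finset (ℤ×ℤ))
    (hS : ∀ P ∈ S, T ≤ P.1 ∧ P.2^2 = P.1^3 + k ∧ ∃ p q r s, RepM a b c d P.1 P.2 p q r s)
    (hinj : ∀ P ∈ S, ∀ Q ∈ S, P.1 = Q.1 → P = Q) : S.card ≤ zz k * (j+1) := by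
  have hx3 : ∀ P ∈ S, 1616 * |k| ≤ P.1^3 := fun P hP => hT3.trans (by have := (hS P hP).1; gcongr)
  obtain ⟨col, I, hI, hcolI, hcol⟩ : ∃ (col : ℤ×ℤ → ℝ) (I : Finset ℝ), I.card ≤ zz k ∧ (∀ P ∈ S, col P ∈ I) ∧
      ∀ P ∈ S, ∀ Q ∈ S, col P = col Q → P.1 < Q.1 → 8*P.1^2 ≤ Q.1 ∧ ¬ Big k P.1 := by
    rcases lt_or_gt_of_ne hk with hneg | hpos
    · rcases S.eq_empty_or_nonempty with rfl | ⟨P0, h0⟩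
      · exact ⟨fun _ => 0, ∅, by simp⟩
      obtain ⟨hT0, hc0, p0, q0, r0, s0, hr0⟩ := hS P0 h0
      have hch : ∀ P : ℤ×ℤ, ∃ (m : ℤ×ℤ×ℤ×ℤ) (t : ℝ), P ∈ S → RepM a b c d P.1 P.2 m.1 m.2.1 m.2.2.1 m.2.2.2 ∧ t ∈ ({0, √3, -√3} : Finset ℝ) ∧
          |√(-k)*((-(p0*m.2.1-q0*m.1):ℤ):ℝ) - t*((P0.1*(s0*m.1-r0*m.2.1)-P0.2*(p0*m.2.1-q0*m.1):ℤ):ℝ)| ≤ epsK k T * √((P0.1:ℝ)*P.1) := by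
        intro P
        by_cases hP : P ∈ S
        swap
        · exact ⟨0, 0, fun h => absurd h hP⟩
        obtain ⟨hTP, hcP, p, q, r, s, hr⟩ := hS P hP
        have rel := (hr0.comp hr).mrel hc0
        obtain ⟨t, ht, htt⟩ := typeZ hneg (by linarith) rel hc0 hcP hT0 hTP
        exact ⟨(p,q,r,s), t, fun _ => ⟨hr, ht, htt⟩⟩
      choose m t hmt using hch
      refine ⟨t, {0, √3, -√3}, ?_, fun P hP => (hmt P hP).2.1, ?_⟩
      · simp only [zz, hneg, if_true]; exact Finset.card_le_three
      · intro P hP Q hQ hPQ hlt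
        obtain ⟨r1, -, b1⟩ := hmt P hP
        obtain ⟨r2, -, b2⟩ := hmt Q hQ
        rw [← hPQ] at b2
        obtain ⟨hTP, hcP, -⟩ := hS P hP
        obtain ⟨hTQ, hcQ, -⟩ := hS Q hQ
        have rel1 := (hr0.comp r1).mrel hc0
        have rel2 := (hr0.comp r2).mrel hc0
        have rel := (r1.comp r2).mrel hcP
        refine pairOK hk hcP hcQ rel ?_ hlt (hT.trans hTP) (hx3 P hP)
        refine combZ hneg (by linarith) hT0 hTP hTQ rel1 rel2 rel ?_ b1 b2 hT3
        linear_combination (P0.1 * ((m P).1*(m Q).2.1-(m P).2.1*(m Q).1)) * hr0.det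
    · refine ⟨fun _ => 0, {0}, by simp [zz, hpos.not_gt], by simp, ?_⟩
      intro P hP Q hQ _ hlt
      obtain ⟨hTP, hcP, p, q, r, s, r1⟩ := hS P hP
      obtain ⟨hTQ, hcQ, p', q', r', s', r2⟩ := hS Q hQ
      have rel := (r1.comp r2).mrel hcP
      exact pairOK hk hcP hcQ rel (smallPosZ hpos rel hcP hcQ hlt.le (hT.trans hTP) (hx3 P hP)) hlt (hT.trans hTP) (hx3 P hP)
  have hmul : S.card ≤ (j+1) * I.card := by
    apply Finset.card_le_mul_card_image_of_maps_to hcolI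
    intro i _
    have hsub : ∀ P ∈ S.filter (fun P => col P = i), P ∈ S ∧ col P = i := fun P hP => Finset.mem_filter.mp hP
    rw [← Finset.card_image_of_injOn (f := Prod.fst) (fun P hP Q hQ h => hinj P (hsub P hP).1 Q (hsub Q hQ).1 h)]
    apply card_chain k j T _ (by linarith) hB
    · intro x hx
      obtain ⟨P, hP, rfl⟩ := Finset.mem_image.mp hx
      exact (hS P (hsub P hP).1).1
    · intro x hx x' hx' hlt
      obtain ⟨P, hP, rfl⟩ := Finset.mem_image.mp hx
      obtain ⟨Q, hQ, rfl⟩ := Finset.mem_image.mp hx'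
      exact hcol P (hsub P hP).1 Q (hsub Q hQ).1 ((hsub P hP).2.trans (hsub Q hQ).2.symm) hlt
  calc S.card ≤ (j+1) * I.card := hmul
    _ ≤ (j+1) * zz k := by gcongr
    _ = _ := by ring

end
section
open scoped MatrixGroups in
open UpperHalfPlane in
lemma redL (α β γ : ℝ) (hα : 0 < α) (hΔ : 0 < α*γ-β^2) : ∃ p q r s : ℤ, p*s-q*r = 1 ∧
    3*(α*p^2+2*β*p*q+γ*q^2)^2 ≤ 4*(α*γ-β^2) := by
  set D := α*γ-β^2 with hD
  set z : ℍ := ⟨⟨-β/α, Real.sqrt D/α⟩, by positivity⟩ with hz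
  obtain ⟨g, hg⟩ := ModularGroup.exists_smul_mem_fd z
  have h3 := ModularGroup.three_le_four_mul_im_sq_of_mem_fd hg
  rw [ModularGroup.im_smul_eq_div_normSq] at h3
  have hdet := Matrix.det_fin_two (g : Matrix (Fin 2) (Fin 2) ℤ)
  rw [g.det_coe] at hdet
  refine ⟨g 1 1, -g 1 0, -g 0 1, g 0 0, by linarith, ?_⟩
  have hzi : z.im = Real.sqrt D/α := rfl
  have hn : Complex.normSq (UpperHalfPlane.denom g z) = (α*(g 1 1)^2+2*β*(g 1 1)*(-g 1 0)+γ*(g 1 0)^2)/α := by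
    rw [ModularGroup.denom_apply, Complex.normSq_apply]
    have e1 : ((z:ℂ)).re = -β/α := rfl
    have e2 : ((z:ℂ)).im = Real.sqrt D/α := rfl
    simp only [Complex.add_re, Complex.mul_re, Complex.intCast_re, Complex.intCast_im, Complex.add_im, Complex.mul_im, e1, e2]
    field_simp
    have := Real.sq_sqrt hΔ.le
    linear_combination ((g 1 0 : ℤ) : ℝ)^2*this + ((g 1 0 : ℤ) : ℝ)^2*hD
  rw [hn, hzi] at h3
  have hpos : 0 < (α*(g 1 1)^2+2*β*(g 1 1)*(-g 1 0)+γ*(g 1 0)^2)/α := by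
    rw [← hn]; exact UpperHalfPlane.normSq_denom_pos _ (UpperHalfPlane.im_ne_zero z)
  set φ := (α*(g 1 1:ℝ)^2+2*β*(g 1 1)*(-g 1 0)+γ*(g 1 0)^2) with hφ
  have hφ0 : 0 < φ := by
    rcases div_pos_iff.1 hpos with h | h
    · exact h.1
    · linarith [h.2]
  have e : Real.sqrt D/α/(φ/α) = Real.sqrt D / φ := by field_simp
  rw [e, div_pow, Real.sq_sqrt hΔ.le] at h3
  have : 3 * φ^2 ≤ 4*D := by
    have h4 := mul_le_mul_of_nonneg_right h3 (sq_nonneg φ)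
    have e2 : 4*(D/φ^2)*φ^2 = 4*D := by field_simp
    linarith
  push_cast
  convert this using 3
  rw [hφ]; ring

/-- `(a,b,c,d)` is an SL2-form of the point with covariant values `A`, `g`. -/
structure Rk (k x y a b c d A g : ℤ) : Prop where
  rep : ∃ p q r s, RepM a b c d x y p q r s
  hA : A = b^2-a*c
  hg : 2*g = 2*b^3-3*a*b*c+a^2*d
  hk : g^2 = A^3+k*a^2

lemma Rk.mk0 {k x y : ℤ} (h : y^2 = x^3+k) (p q r s : ℤ) (hd : p*s-q*r = 1) :
    ∃ b c d, Rk k x y (p^3-3*x*p*q^2+2*y*q^3) b c d (x*p^2-2*y*p*q+x^2*q^2) (y*p^3-3*x^2*p^2*q+3*x*y*p*q^2-(2*y^2-x^3)*q^3) := by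
  refine ⟨p^2*r-x*(2*p*q*s+q^2*r)+2*y*q^2*s, p*r^2-x*(p*s^2+2*q*r*s)+2*y*q*s^2, r^3-3*x*r*s^2+2*y*s^3, ⟨s, -q, -r, p, ⟨by linarith, ?_⟩⟩, ?_, ?_, ?_⟩
  · intro X Y
    have e : ∀ U V : ℤ, cub (p^3-3*x*p*q^2+2*y*q^3) (p^2*r-x*(2*p*q*s+q^2*r)+2*y*q^2*s) (p*r^2-x*(p*s^2+2*q*r*s)+2*y*q*s^2) (r^3-3*x*r*s^2+2*y*s^3) U V = cub 1 0 (-x) (2*y) (p*U+r*V) (q*U+s*V) := by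
      intro U V; simp only [cub]; ring
    rw [e]
    congr 1
    · linear_combination X*hd
    · linear_combination Y*hd
  · have e : (p^2*r-x*(2*p*q*s+q^2*r)+2*y*q^2*s)^2-(p^3-3*x*p*q^2+2*y*q^3)*(p*r^2-x*(p*s^2+2*q*r*s)+2*y*q*s^2) = (p*s-q*r)^2*(x*p^2-2*y*p*q+x^2*q^2) := by ring
    rw [e, hd]; ring
  · have e : 2*(p^2*r-x*(2*p*q*s+q^2*r)+2*y*q^2*s)^3-3*(p^3-3*x*p*q^2+2*y*q^3)*(p^2*r-x*(2*p*q*s+q^2*r)+2*y*q^2*s)*(p*r^2-x*(p*s^2+2*q*r*s)+2*y*q*s^2)+(p^3-3*x*p*q^2+2*y*q^3)^2*(r^3-3*x*r*s^2+2*y*s^3)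
       = (p*s-q*r)^3*(2*(y*p^3-3*x^2*p^2*q+3*x*y*p*q^2-(2*y^2-x^3)*q^3)) := by ring
    rw [e, hd]; ring
  · have hk : k = y^2-x^3 := by linarith
    rw [hk]; ring

lemma Rk.trans {k x y a b c d A g : ℤ} (h : Rk k x y a b c d A g) (t : ℤ) :
    Rk k x y a (b+a*t) (c+2*b*t+a*t^2) (d+3*c*t+3*b*t^2+a*t^3) A g := by
  obtain ⟨⟨p, q, r, s, hr⟩, hA, hg, hk⟩ := h
  refine ⟨⟨p-t*q, q, r-t*s, s, ⟨by linear_combination hr.det, fun X Y => ?_⟩⟩, by rw [hA]; ring, by rw [hg]; ring, hk⟩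
  rw [← hr.eq]; simp only [cub]; ring

lemma Rk.neg {k x y a b c d A g : ℤ} (h : Rk k x y a b c d A g) : Rk k x y (-a) (-b) (-c) (-d) A (-g) := by
  obtain ⟨⟨p, q, r, s, hr⟩, hA, hg, hk⟩ := h
  refine ⟨⟨-p, -q, -r, -s, ⟨by linear_combination hr.det, fun X Y => ?_⟩⟩, by rw [hA]; ring, by linear_combination -hg, by linear_combination hk⟩
  rw [← hr.eq]; simp only [cub]; ring

lemma Rk.flip {k x y a b c d A g : ℤ} (h : Rk k x y a b c d A g) : Rk k x (-y) a (-b) c (-d) A (-g) := by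
  obtain ⟨⟨p, q, r, s, hr⟩, hA, hg, hk⟩ := h
  refine ⟨⟨p, -q, -r, s, ⟨by linear_combination hr.det, fun X Y => ?_⟩⟩, by rw [hA]; ring, by linear_combination -hg, by linear_combination hk⟩
  have := hr.eq X (-Y)
  simp only [cub] at this ⊢
  linear_combination this

/-- normalised form -/
structure Nf (k x y a b c d A g : ℤ) : Prop extends Rk k x y a b c d A g where
  ha : 1 ≤ a
  hb : 0 ≤ b
  hba : b < a
  hg0 : 0 ≤ g

lemma Rk.norm {k x y a b c d A g : ℤ} (h : Rk k x y a b c d A g) (ha : a ≠ 0) :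
    ∃ y' b' c' d' g', (y' = y ∨ y' = -y) ∧ Nf k x y' |a| b' c' d' A g' := by
  obtain ⟨b1, c1, d1, g1, h1⟩ : ∃ b1 c1 d1 g1, Rk k x y |a| b1 c1 d1 A g1 := by
    rcases abs_choice a with e | e <;> rw [e]
    · exact ⟨_, _, _, _, h⟩
    · exact ⟨_, _, _, _, h.neg⟩
  have hpos : 0 < |a| := abs_pos.2 ha
  obtain ⟨y', b2, c2, d2, g2, hy, hg2, h2⟩ : ∃ y' b2 c2 d2 g2, (y' = y ∨ y' = -y) ∧ 0 ≤ g2 ∧ Rk k x y' |a| b2 c2 d2 A g2 := by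
    rcases le_total 0 g1 with e | e
    · exact ⟨y, _, _, _, g1, Or.inl rfl, e, h1⟩
    · exact ⟨-y, _, _, _, -g1, Or.inr rfl, by linarith, h1.flip⟩
  have h3 := h2.trans (-(b2 / |a|))
  have e : b2 + |a| * -(b2 / |a|) = b2 % |a| := by rw [Int.emod_def]; ring
  rw [e] at h3
  exact ⟨y', _, _, _, g2, hy, h3, hpos, Int.emod_nonneg _ hpos.ne', Int.emod_lt_of_pos _ hpos, hg2⟩

lemma Nf.unique {k x y a b c d A g x' y' c' d' g' : ℤ} (h : Nf k x y a b c d A g) (h' : Nf k x' y' a b c' d' A g') :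
    c' = c ∧ d' = d ∧ g' = g := by
  have ha := h.ha
  have hc : c' = c := by
    have : a*c' = a*c := by linarith [h.hA, h'.hA]
    exact mul_left_cancel₀ (by linarith) this
  have hg : g' = g := by
    have : g'^2 = g^2 := by rw [h.hk, h'.hk]
    exact (sq_eq_sq₀ h'.hg0 h.hg0).1 this
  subst hc hg
  refine ⟨rfl, ?_, rfl⟩
  have : a^2*d' = a^2*d := by linarith [h.hg, h'.hg]
  exact mul_left_cancel₀ (by positivity) this

end
section
def RegN (k a A : ℤ) : Prop := 0 < A ∧ 3*A^2 ≤ 4*(-k) ∧ (-k)*a^2 ≤ A^3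
def RegP (k a A : ℤ) : Prop := 3*A^2 ≤ 4*k ∧ 27*a^4 ≤ 256*k ∧ 27*(4*k*a^2+2*A^3)^2 ≤ 16*k*(16*k-9*A^2)^2

lemma a_zero {x y p q r s : ℤ} (hd : p*s-q*r = 1) (h0 : p^3-3*x*p*q^2+2*y*q^3 = 0) :
    x*p^2-2*y*p*q+x^2*q^2 = (x-p^2)^2 ∧ 4*(y^2-x^3) = -(x-p^2)^2*(3*x+(x-p^2)) := by
  have hc : IsCoprime q p := ⟨-r, s, by linarith⟩
  have hq : q ∣ p^3 := ⟨3*x*p*q-2*y*q^2, by linear_combination h0⟩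
  have hu : IsUnit q := (hc.pow_right (n := 3)).isUnit_of_dvd' dvd_rfl hq
  have q2 : q^2 = 1 := by
    rcases Int.isUnit_iff.1 hu with rfl | rfl <;> norm_num
  have e : 2*y*q = 3*x*p-p^3 := by
    linear_combination h0 + (3*x*p-2*y*q)*q2
  constructor
  · linear_combination (-p)*e + x^2*q2
  · linear_combination (2*y*q+(3*x*p-p^3))*e-4*y^2*q2

lemma red_neg {k x y : ℤ} (hk : k < 0) (h : y^2 = x^3+k) :
    (∃ y' a b c d A g, (y' = y ∨ y' = -y) ∧ Nf k x y' a b c d A g ∧ RegN k a A) ∨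
    (∃ β : ℤ, β ≠ 0 ∧ 4*(-k) = β^2*(3*x+β) ∧ 3*β^4 ≤ 4*(-k)) := by
  have hx : 0 < x := by
    by_contra hx
    have : x^3 ≤ 0 := Odd.pow_nonpos (by decide) (by linarith)
    linarith [sq_nonneg y]
  have hkR : ((-k : ℤ):ℝ) = x*x^2-(-y)^2 := by
    have : -k = x*x^2-(-y)^2 := by linarith
    rw [this]; push_cast; ring
  have hk0 : (0:ℝ) < ((-k : ℤ):ℝ) := by exact_mod_cast (by linarith : 0 < -k)
  obtain ⟨p, q, r, s, hd, hm⟩ := redL x (-y) (x^2) (by exact_mod_cast hx) (by rw [← hkR]; exact hk0)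
  rw [← hkR] at hm
  obtain ⟨b, c, d, hR⟩ := Rk.mk0 h p q r s hd
  have hm' : 3*(x*p^2-2*y*p*q+x^2*q^2)^2 ≤ 4*(-k) := by
    have : (3*(x*p^2-2*y*p*q+x^2*q^2)^2:ℝ) ≤ 4*((-k:ℤ):ℝ) := by
      convert hm using 3; ring
    exact_mod_cast this
  by_cases ha : p^3-3*x*p*q^2+2*y*q^3 = 0
  · right
    obtain ⟨e1, e2⟩ := a_zero hd ha
    rw [e1] at hm'
    refine ⟨x-p^2, ?_, by linarith, by linarith⟩
    intro h0
    rw [h0] at e2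
    linarith
  · left
    obtain ⟨y', b', c', d', g', hy, hN⟩ := hR.norm ha
    refine ⟨y', _, b', c', d', _, g', hy, hN, ?_, hm', ?_⟩
    · by_contra hA
      push Not at hA
      have h1 := hN.hk
      have h2 : (x*p^2-2*y*p*q+x^2*q^2)^3 ≤ 0 := Odd.pow_nonpos (by decide) hA
      have h3 : 0 < |p^3-3*x*p*q^2+2*y*q^3|^2 := by positivity
      linarith [sq_nonneg g', mul_pos (neg_pos.2 hk) h3]
    · have h1 := hN.hk
      linarith [sq_nonneg g']

lemma cbrt_exists (z : ℝ) : ∃ s : ℝ, s^3 = z := by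
  rcases le_total 0 z with h | h
  · exact ⟨z^((3:ℕ):ℝ)⁻¹, Real.rpow_inv_natCast_pow h (by norm_num)⟩
  · refine ⟨-(-z)^((3:ℕ):ℝ)⁻¹, ?_⟩
    rw [Odd.neg_pow (by decide), Real.rpow_inv_natCast_pow (by linarith) (by norm_num), neg_neg]

set_option maxHeartbeats 1000000 in
lemma red_pos {k x y : ℤ} (hk : 0 < k) (hx : 0 < x) (h : y^2 = x^3+k) :
    (∃ y' a b c d A g, (y' = y ∨ y' = -y) ∧ Nf k x y' a b c d A g ∧ RegP k a A) := by
  have hkR : (0:ℝ) < (k:ℝ) := by exact_mod_cast hk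
  set κ := Real.sqrt k with hκ
  have hκ2 : κ^2 = k := Real.sq_sqrt hkR.le
  have hκ0 : 0 < κ := Real.sqrt_pos.2 hkR
  obtain ⟨s, hs⟩ := cbrt_exists (y+κ)
  obtain ⟨t, ht⟩ := cbrt_exists (y-κ)
  have hR : (y:ℝ)^2 = x^3+k := by exact_mod_cast h
  have hst : s*t = x := by
    have : (s*t)^3 = (x:ℝ)^3 := by
      rw [mul_pow, hs, ht]; linear_combination hR - hκ2
    exact (Odd.strictMono_pow (by decide : Odd 3)).injective this
  have hst0 : 0 < s*t := by rw [hst]; exact_mod_cast hx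
  have hα : 0 < s^2+t^2 := by linarith [sq_nonneg (s-t)]
  have hΔ : (s^2+t^2)*(s^4+t^4)-(-(s*t^2+t*s^2))^2 = 4*k := by
    rw [← hκ2]
    have : (s^3-t^3)^2 = 4*κ^2 := by rw [hs, ht]; ring
    linear_combination this
  obtain ⟨p, q, r, s', hd, hm⟩ := redL (s^2+t^2) (-(s*t^2+t*s^2)) (s^4+t^4) hα (by rw [hΔ]; linarith)
  rw [hΔ] at hm
  obtain ⟨b, c, d, hRk⟩ := Rk.mk0 h p q r s' hd
  set ξ := s*p-t^2*q with hξ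
  set η := t*p-s^2*q with hη
  set A := x*p^2-2*y*p*q+x^2*q^2 with hA
  set a := p^3-3*x*p*q^2+2*y*q^3 with ha
  have hy2 : (2*y:ℝ) = s^3+t^3 := by rw [hs, ht]; ring
  have hκ3 : 2*κ = s^3-t^3 := by rw [hs, ht]; ring
  have eA : (A:ℝ) = ξ*η := by
    rw [hA]; push_cast; rw [hξ, hη, ← hst, hy2]; ring
  have ea : 2*κ*(a:ℝ) = ξ^3-η^3 := by
    rw [ha]; push_cast; rw [hξ, hη, ← hst, hy2, hκ3]; ring
  have em : (s^2+t^2)*(p:ℝ)^2+2*(-(s*t^2+t*s^2))*p*q+(s^4+t^4)*q^2 = ξ^2+η^2 := by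
    rw [hξ, hη]; ring
  rw [em] at hm
  set m := ξ^2+η^2 with hmd
  have hm0 : 0 ≤ m := by positivity
  have hAm : 4*(A:ℝ)^2 ≤ m^2 := by
    rw [eA, hmd]; linarith [sq_nonneg (ξ^2-η^2)]
  have hl : 4*(k:ℝ)*a^2+2*A^3 = m*(m^2-3*A^2) := by
    have : 4*(k:ℝ)*a^2 = (ξ^3-η^3)^2 := by rw [← ea, ← hκ2]; ring
    rw [this, eA, hmd]; ring
  have ham : 4*(k:ℝ)*a^2 ≤ m^3 := by
    have e : 4*(k:ℝ)*a^2 = (ξ^3-η^3)^2 := by rw [← ea, ← hκ2]; ring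
    rw [e, hmd]
    have e2 : (ξ^2+η^2)^3 - (ξ^3-η^3)^2 = ξ^2*η^2*(2*(ξ^2+η^2)+(ξ+η)^2) := by ring
    have : 0 ≤ ξ^2*η^2*(2*(ξ^2+η^2)+(ξ+η)^2) := by positivity
    linarith
  have hm2 : 3*m^2 ≤ 16*k := by linarith
  clear_value m
  clear eA ea em hmd
  have c1 : 3*A^2 ≤ 4*k := by
    have : (3*A^2:ℝ) ≤ 4*k := by linarith
    exact_mod_cast this
  have c2 : 27*a^4 ≤ 256*k := by
    have h1 : (4*(k:ℝ)*a^2)^2 ≤ (m^3)^2 := pow_le_pow_left₀ (by positivity) ham 2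
    have h2 : (3*m^2)^3 ≤ (16*(k:ℝ))^3 := pow_le_pow_left₀ (by positivity) hm2 3
    have h3 : (16*(k:ℝ)^2)*(27*a^4) ≤ (16*(k:ℝ)^2)*(256*k) := by linarith
    have := le_of_mul_le_mul_left h3 (by positivity)
    exact_mod_cast this
  have c3 : 27*(4*k*a^2+2*A^3)^2 ≤ 16*k*(16*k-9*A^2)^2 := by
    have : (27*(4*k*a^2+2*A^3)^2:ℝ) ≤ 16*k*(16*k-9*A^2)^2 := by
      rw [hl]
      have u0 : 0 ≤ 3*(m^2-3*(A:ℝ)^2) := by linarith [sq_nonneg (A:ℝ)]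
      have u1 : (3*(m^2-3*(A:ℝ)^2))^2 ≤ (16*k-9*(A:ℝ)^2)^2 := pow_le_pow_left₀ u0 (by linarith) 2
      calc 27*(m*(m^2-3*(A:ℝ)^2))^2 = (3*m^2)*(3*(m^2-3*(A:ℝ)^2))^2 := by ring
        _ ≤ (16*k)*(16*k-9*(A:ℝ)^2)^2 := mul_le_mul hm2 u1 (by positivity) (by positivity)
    exact_mod_cast this
  have ha0 : a ≠ 0 := by
    intro h0
    obtain ⟨e1, e2⟩ := a_zero hd h0
    set β := x-p^2 with hβ
    have hkk : y^2-x^3 = k := by linarith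
    rw [hkk] at e2
    change A = β^2 at e1
    rw [e1] at c1
    have hβ2 : 0 < β^2 := by
      have : β ≠ 0 := by rintro h0; rw [h0] at e2; linarith
      positivity
    have h3 : 3*β^2 ≤ -(3*x+β) := by
      have : β^2*(3*β^2) ≤ β^2*(-(3*x+β)) := by linarith
      exact le_of_mul_le_mul_left this hβ2
    have h4 := sq_nonneg (6*β+1)
    clear_value β
    linarith
  obtain ⟨y', b', c', d', g', hy, hN⟩ := hRk.norm ha0
  refine ⟨y', _, b', c', d', _, g', hy, hN, c1, ?_, ?_⟩
  · have : |a|^4 = a^4 := Even.pow_abs (by decide) a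
    rw [this]; exact c2
  · rw [sq_abs]; exact c3

end
section
def Rep4 (f : ℤ×ℤ×ℤ×ℤ) (x y : ℤ) : Prop := ∃ p q r s, RepM f.1 f.2.1 f.2.2.1 f.2.2.2 x y p q r s

lemma total_gen {κ : Type} [DecidableEq κ] (k : ℤ) (hk : k ≠ 0) (j : ℕ) (T : ℤ) (hT : 30 ≤ T) (hT3 : 1616*|k| ≤ T^3) (hB : Big k (itr j T))
    (S : Finset (ℤ×ℤ)) (hS : ∀ P ∈ S, P.2^2 = P.1^3+k ∧ 0 < P.2) (Keys : Finset κ) (F : κ → ℤ×ℤ×ℤ×ℤ)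
    (Sm : Finset ℤ) (hSm : ∀ P ∈ S, P.1 < T → P.1 ∈ Sm) (E : Finset ℤ)
    (hK : ∀ P ∈ S, T ≤ P.1 → (∃ κ ∈ Keys, ∃ y', (y' = P.2 ∨ y' = -P.2) ∧ Rep4 (F κ) P.1 y') ∨ (∃ β ∈ E, β ≠ 0 ∧ 4*(-k) = β^2*(3*P.1+β))) :
    S.card ≤ Sm.card + zz k*(j+1)*Keys.card + E.card := by
  classical
  have hinj : ∀ P ∈ S, ∀ Q ∈ S, P.1 = Q.1 → P = Q := by
    intro P hP Q hQ e
    obtain ⟨h1, h2⟩ := hS P hP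
    obtain ⟨h3, h4⟩ := hS Q hQ
    refine Prod.ext e ?_
    rw [e, ← h3] at h1
    exact (sq_eq_sq₀ h2.le h4.le).1 h1
  let S1 := S.filter (fun P => P.1 < T)
  let S2 := S.filter (fun P => T ≤ P.1 ∧ ∃ κ ∈ Keys, ∃ y', (y' = P.2 ∨ y' = -P.2) ∧ Rep4 (F κ) P.1 y')
  let S3 := S.filter (fun P => ∃ β ∈ E, β ≠ 0 ∧ 4*(-k) = β^2*(3*P.1+β))
  have hcov : S ⊆ (S1 ∪ S2) ∪ S3 := by
    intro P hP
    simp only [Finset.mem_union, S1, S2, S3, Finset.mem_filter]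
    rcases lt_or_ge P.1 T with h | h
    · exact Or.inl (Or.inl ⟨hP, h⟩)
    · rcases hK P hP h with h' | h'
      · exact Or.inl (Or.inr ⟨hP, h, h'⟩)
      · exact Or.inr ⟨hP, h'⟩
  have c1 : S1.card ≤ Sm.card := by
    refine Finset.card_le_card_of_injOn (fun P => P.1) ?_ ?_
    · intro P hP
      have := Finset.mem_filter.1 hP
      exact hSm P this.1 this.2
    · intro P hP Q hQ e
      exact hinj P (Finset.mem_filter.1 hP).1 Q (Finset.mem_filter.1 hQ).1 e
  have c3 : S3.card ≤ E.card := by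
    have hch : ∀ P : ℤ×ℤ, ∃ β : ℤ, P ∈ S3 → (β ∈ E ∧ β ≠ 0 ∧ 4*(-k) = β^2*(3*P.1+β)) := by
      intro P
      by_cases h : P ∈ S3
      · obtain ⟨β, h1, h2⟩ := (Finset.mem_filter.1 h).2
        exact ⟨β, fun _ => ⟨h1, h2⟩⟩
      · exact ⟨0, fun h' => absurd h' h⟩
    choose β hβ using hch
    refine Finset.card_le_card_of_injOn β (fun P hP => (hβ P hP).1) ?_
    intro P hP Q hQ e
    obtain ⟨_, h1, h2⟩ := hβ P hP
    obtain ⟨_, h3, h4⟩ := hβ Q hQ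
    refine hinj P (Finset.mem_filter.1 hP).1 Q (Finset.mem_filter.1 hQ).1 ?_
    rw [h4, ← e] at h2
    have := mul_left_cancel₀ (pow_ne_zero 2 h1) h2
    linarith
  have c2 : S2.card ≤ zz k*(j+1)*Keys.card := by
    have hch : ∀ P : ℤ×ℤ, ∃ (κ : Option κ) (y' : ℤ), P ∈ S2 → ∃ κ', κ = some κ' ∧ κ' ∈ Keys ∧ (y' = P.2 ∨ y' = -P.2) ∧ Rep4 (F κ') P.1 y' := by
      intro P
      by_cases h : P ∈ S2
      · obtain ⟨_, κ', h1, y', h2⟩ := (Finset.mem_filter.1 h).2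
        exact ⟨some κ', y', fun _ => ⟨κ', rfl, h1, h2⟩⟩
      · exact ⟨none, 0, fun h' => absurd h' h⟩
    choose f yy hf using hch
    have hcard : (Keys.map ⟨some, Option.some_injective κ⟩).card = Keys.card := Finset.card_map _
    rw [← hcard]
    refine Finset.card_le_mul_card_image_of_maps_to (f := f) ?_ _ ?_
    · intro P hP
      obtain ⟨κ', e, h1, _⟩ := hf P hP
      rw [e]; simpa using h1
    · intro κ0 hκ0
      obtain ⟨κ', hκ', rfl⟩ := Finset.mem_map.1 hκ0
      let g : ℤ×ℤ → ℤ×ℤ := fun P => (P.1, yy P)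
      have himg : (S2.filter (fun P => f P = some κ')).card = ((S2.filter (fun P => f P = some κ')).image g).card := by
        refine (Finset.card_image_of_injOn ?_).symm
        intro P hP Q hQ e
        have hP := Finset.mem_filter.1 hP
        have hQ := Finset.mem_filter.1 hQ
        exact hinj P (Finset.mem_filter.1 hP.1).1 Q (Finset.mem_filter.1 hQ.1).1 (by have := congrArg Prod.fst e; exact this)
      have hmem : ∀ R ∈ (S2.filter (fun P => f P = some κ')).image g, ∃ P ∈ S2, f P = some κ' ∧ R = (P.1, yy P) := by
        intro R hR
        obtain ⟨P, hP, rfl⟩ := Finset.mem_image.1 hR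
        exact ⟨P, (Finset.mem_filter.1 hP).1, (Finset.mem_filter.1 hP).2, rfl⟩
      change (S2.filter (fun P => f P = some κ')).card ≤ _
      rw [himg]
      refine fiber_card k hk j T hT hT3 hB (F κ').1 (F κ').2.1 (F κ').2.2.1 (F κ').2.2.2 _ ?_ ?_
      · intro R hR
        obtain ⟨P, hP, hfP, rfl⟩ := hmem R hR
        obtain ⟨κ1, e1, _, hy, hr⟩ := hf P hP
        rw [hfP] at e1
        obtain rfl := Option.some.inj e1
        have h2 := Finset.mem_filter.1 hP
        refine ⟨h2.2.1, ?_, hr⟩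
        have := (hS P h2.1).1
        rcases hy with e | e <;> simp only [e]
        · exact this
        · rw [neg_sq]; exact this
      · intro R hR R' hR' e
        obtain ⟨P, hP, _, rfl⟩ := hmem R hR
        obtain ⟨Q, hQ, _, rfl⟩ := hmem R' hR'
        have := hinj P (Finset.mem_filter.1 hP).1 Q (Finset.mem_filter.1 hQ).1 e
        rw [this]
  calc S.card ≤ ((S1 ∪ S2) ∪ S3).card := Finset.card_le_card hcov
    _ ≤ (S1 ∪ S2).card + S3.card := Finset.card_union_le _ _
    _ ≤ S1.card + S2.card + S3.card := by gcongr; exact Finset.card_union_le _ _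
    _ ≤ _ := by gcongr

def Reg (k a A : ℤ) : Prop := (k < 0 → RegN k a A) ∧ (0 < k → RegP k a A)

/-- the form belonging to a key -/
def kform (k : ℤ) (t : ℤ×ℤ×ℤ) : ℤ×ℤ×ℤ×ℤ :=
  (t.1, t.2.1, (t.2.1^2-t.2.2)/t.1, (2*Int.sqrt (t.2.2^3+k*t.1^2)-2*t.2.1^3+3*t.1*t.2.1*((t.2.1^2-t.2.2)/t.1))/t.1^2)

lemma Nf.kform {k x y a b c d A g : ℤ} (h : Nf k x y a b c d A g) : kform k (a, b, A) = (a, b, c, d) := by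
  have ha : a ≠ 0 := by linarith [h.ha]
  have e1 : (b^2-A)/a = c := by
    rw [h.hA, show b^2-(b^2-a*c) = a*c by ring, Int.mul_ediv_cancel_left _ ha]
  have e2 : Int.sqrt (A^3+k*a^2) = g := by
    rw [← h.hk, sq, Int.sqrt_eq, Int.natAbs_of_nonneg h.hg0]
  simp only [_root_.kform, e1, e2]
  have : 2*g-2*b^3+3*a*b*c = a^2*d := by linarith [h.hg]
  rw [this, Int.mul_ediv_cancel_left _ (pow_ne_zero 2 ha)]

lemma total_keys (k : ℤ) (hk : k ≠ 0) (j : ℕ) (T : ℤ) (hT : 30 ≤ T) (hT3 : 1616*|k| ≤ T^3) (hB : Big k (itr j T))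
    (S : Finset (ℤ×ℤ)) (hS : ∀ P ∈ S, P.2^2 = P.1^3+k ∧ 0 < P.2) (Keys : Finset (ℤ×ℤ×ℤ))
    (hKeys : ∀ a b A g : ℤ, 1 ≤ a → 0 ≤ b → b < a → a ∣ b^2-A → g^2 = A^3+k*a^2 → Reg k a A → (a, b, A) ∈ Keys)
    (Sm : Finset ℤ) (hSm : ∀ x y : ℤ, x < T → y^2 = x^3+k → 0 < y → x ∈ Sm) (E : Finset ℤ)
    (hE : k < 0 → ∀ β x : ℤ, β ≠ 0 → T ≤ x → 4*(-k) = β^2*(3*x+β) → 3*β^4 ≤ 4*(-k) → β ∈ E) :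
    S.card ≤ Sm.card + zz k*(j+1)*Keys.card + E.card := by
  refine total_gen k hk j T hT hT3 hB S hS Keys (kform k) Sm (fun P hP h => hSm _ _ h (hS P hP).1 (hS P hP).2) E ?_
  intro P hP hx
  have hPk := (hS P hP).1
  have main : ∀ y' a b c d A g, Nf k P.1 y' a b c d A g → Reg k a A → (a, b, A) ∈ Keys ∧ Rep4 (kform k (a, b, A)) P.1 y' := by
    intro y' a b c d A g hN hR
    refine ⟨hKeys a b A g hN.ha hN.hb hN.hba ⟨c, by rw [hN.hA]; ring⟩ hN.hk hR, ?_⟩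
    rw [hN.kform]
    exact hN.rep
  rcases lt_or_gt_of_ne hk with h | h
  · rcases red_neg h hPk with ⟨y', a, b, c, d, A, g, hy, hN, hR⟩ | ⟨β, h1, h2, h3⟩
    · left
      obtain ⟨m1, m2⟩ := main y' a b c d A g hN ⟨fun _ => hR, fun h' => by linarith⟩
      exact ⟨_, m1, y', hy, m2⟩
    · right
      exact ⟨β, hE h β P.1 h1 hx h2 h3, h1, h2⟩
  · obtain ⟨y', a, b, c, d, A, g, hy, hN, hR⟩ := red_pos h (by linarith) hPk
    left
    obtain ⟨m1, m2⟩ := main y' a b c d A g hN ⟨fun h' => by linarith, fun _ => hR⟩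
    exact ⟨_, m1, y', hy, m2⟩

end
section
def sumTo (f : ℕ → ℕ) (n : ℕ) : ℕ := Nat.rec 0 (fun i s => f i + s) n
def allTo (f : ℕ → Bool) (n : ℕ) : Bool := Nat.rec true (fun i s => f i && s) n
lemma sumTo_eq (f : ℕ → ℕ) (n : ℕ) : sumTo f n = ∑ i ∈ Finset.range n, f i := by
  induction n with
  | zero => rfl
  | succ n ih => rw [Finset.sum_range_succ, ← ih]; exact Nat.add_comm _ _
lemma allTo_iff (f : ℕ → Bool) (n : ℕ) : allTo f n = true ↔ ∀ i < n, f i = true := by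
  induction n with
  | zero => simp [allTo]
  | succ n ih =>
    have : allTo f (n+1) = (f n && allTo f n) := rfl
    rw [this, Bool.and_eq_true, ih]
    constructor
    · rintro ⟨h1, h2⟩ i hi
      rcases Nat.lt_succ_iff_lt_or_eq.1 hi with h | rfl
      · exact h2 i h
      · exact h1
    · intro h
      exact ⟨h n (by omega), fun i hi => h i (by omega)⟩

def bitm (m mask v : ℕ) : ℕ := (mask >>> (v % m)) % 2
def goodMask (m mask : ℕ) : Bool := Nat.ble 1 m && allTo (fun y => Nat.beq (bitm m mask (y^2)) 1) m

lemma bit_sq {m mask v : ℕ} (h : goodMask m mask = true) (z : ℤ) (hz : (m:ℤ) ∣ z^2 - v) : bitm m mask v = 1 := by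
  simp only [goodMask, Bool.and_eq_true, Nat.ble_eq, allTo_iff, Nat.beq_eq] at h
  have h1 := h.2 (z.natAbs % m) (Nat.mod_lt _ (by omega))
  have e : v % m = (z.natAbs % m)^2 % m := by
    rw [← Nat.pow_mod]
    have : ((z.natAbs^2 : ℕ):ℤ) = z^2 := by push_cast; exact sq_abs z
    rw [← this] at hz
    have h2 : ((z.natAbs^2:ℕ):ℤ) % m = (v:ℤ) % m := Int.emod_eq_emod_iff_emod_sub_eq_zero.2 (Int.emod_eq_zero_of_dvd hz)
    exact_mod_cast h2.symm
  simp only [bitm] at h1 ⊢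
  rw [e]; exact h1

def keysOf (n : ℕ) (L : ℕ → ℕ → ℕ) (f : ℕ → ℕ → ℕ → ℕ) (A : ℕ → ℕ → ℕ → ℤ) : Finset (ℤ×ℤ×ℤ) :=
  (Finset.range n).biUnion fun a => (Finset.range (a+1)).biUnion fun b => (Finset.range (L a b)).biUnion fun t =>
    if f a b t = 0 then ∅ else {(((a+1:ℕ):ℤ), (b:ℤ), A a b t)}

lemma keysOf_card (n : ℕ) (L : ℕ → ℕ → ℕ) (f : ℕ → ℕ → ℕ → ℕ) (A : ℕ → ℕ → ℕ → ℤ) :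
    (keysOf n L f A).card ≤ sumTo (fun a => sumTo (fun b => sumTo (fun t => f a b t) (L a b)) (a+1)) n := by
  simp only [sumTo_eq]
  refine Finset.card_biUnion_le.trans (Finset.sum_le_sum fun a _ => ?_)
  refine Finset.card_biUnion_le.trans (Finset.sum_le_sum fun b _ => ?_)
  refine Finset.card_biUnion_le.trans (Finset.sum_le_sum fun t _ => ?_)
  split_ifs with h
  · simp
  · simp; omega

lemma mem_keysOf {n : ℕ} {L : ℕ → ℕ → ℕ} {f : ℕ → ℕ → ℕ → ℕ} {A : ℕ → ℕ → ℕ → ℤ} (a b t : ℕ) (ha : a < n) (hb : b < a+1) (ht : t < L a b)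
    (hf : f a b t ≠ 0) : (((a+1:ℕ):ℤ), (b:ℤ), A a b t) ∈ keysOf n L f A := by
  simp only [keysOf, Finset.mem_biUnion, Finset.mem_range]
  refine ⟨a, ha, b, hb, t, ht, ?_⟩
  rw [if_neg hf]; simp

def sum32 (f : ℕ → ℕ) (n : ℕ) : ℕ := sumTo (fun i => sumTo (fun l => f (32*i+l)) 32) n
def setOf32 (f : ℕ → ℕ) (X : ℕ → ℤ) (n : ℕ) : Finset ℤ :=
  (Finset.range n).biUnion fun i => (Finset.range 32).biUnion fun l => if f (32*i+l) = 0 then ∅ else {X (32*i+l)}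
lemma setOf32_card (f : ℕ → ℕ) (X : ℕ → ℤ) (n : ℕ) : (setOf32 f X n).card ≤ sum32 f n := by
  simp only [sum32, sumTo_eq]
  refine Finset.card_biUnion_le.trans (Finset.sum_le_sum fun a _ => ?_)
  refine Finset.card_biUnion_le.trans (Finset.sum_le_sum fun b _ => ?_)
  split_ifs with h
  · simp
  · simp; omega
lemma mem_setOf32 {f : ℕ → ℕ} {X : ℕ → ℤ} {n : ℕ} (x : ℕ) (hx : x < 32*n) (hf : f x ≠ 0) : X x ∈ setOf32 f X n := by
  simp only [setOf32, Finset.mem_biUnion, Finset.mem_range]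
  have e : 32*(x/32)+x%32 = x := Nat.div_add_mod x 32
  refine ⟨x/32, by omega, x%32, by omega, ?_⟩
  rw [e, if_neg hf]; simp

def itrN : ℕ → ℕ → ℕ | 0, T => T | j+1, T => itrN j (8*T^2)
lemma itrN_cast (j T : ℕ) : ((itrN j T : ℕ):ℤ) = itr j T := by
  induction j generalizing T with
  | zero => rfl
  | succ j ih => simp only [itrN, itr]; rw [ih]; push_cast; rfl

def okT (K2 j T : ℕ) : Bool := Nat.ble 30 T && Nat.ble (1616*K2) (T^3) && Nat.ble (100000*K2^2) (itrN j T) && Nat.ble (6000000000*K2^8) ((itrN j T)^3)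

lemma okT_sound {K2 j T : ℕ} (h : okT K2 j T = true) (k : ℤ) (hk : |k| ≤ K2) : 30 ≤ (T:ℤ) ∧ 1616*|k| ≤ (T:ℤ)^3 ∧ Big k (itr j T) := by
  simp only [okT, Bool.and_eq_true, Nat.ble_eq] at h
  obtain ⟨⟨⟨h1, h2⟩, h3⟩, h4⟩ := h
  have h0 := abs_nonneg k
  have h2' : 1616*(K2:ℤ) ≤ (T:ℤ)^3 := by exact_mod_cast h2
  have h3' : 100000*(K2:ℤ)^2 ≤ itr j T := by rw [← itrN_cast]; exact_mod_cast h3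
  have h4' : 6000000000*(K2:ℤ)^8 ≤ (itr j T)^3 := by rw [← itrN_cast]; exact_mod_cast h4
  have p2 := pow_le_pow_left₀ h0 hk 2
  have p8 := pow_le_pow_left₀ h0 hk 8
  exact ⟨by exact_mod_cast h1, by linarith, by linarith, by linarith⟩

end
section
def smN (K1 m mask r : ℕ) (x : ℕ) : ℕ := bif Nat.ble (x^3) K1 then 0 else bitm m mask (x^3+r)
def vA (a b t : ℕ) : ℕ := b^2 % (a+1) + (a+1)*t
def fN (K1 K2 m mask r a b t : ℕ) : ℕ :=
  bif Nat.ble (K1*(a+1)^2) ((vA a b t)^3) && Nat.ble (3*(vA a b t)^2) (4*K2) then bitm m mask ((vA a b t)^3+r*(a+1)^2) else 0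
def LA (B a b : ℕ) : ℕ := (B - b^2 % (a+1)) / (a+1) + 1
def hN (K1 K2 m mask r n B : ℕ) : ℕ := sumTo (fun a => sumTo (fun b => sumTo (fun t => fN K1 K2 m mask r a b t) (LA B a b)) (a+1)) n
def chkN (K1 K2 m mask r j T n B e δ : ℕ) : Bool :=
  okT K2 j (32*T) && Nat.blt (4*K2) (3*(B+1)^2) && Nat.blt (B^3) (K1*(n+1)^2) && Nat.blt (4*K2) ((e+1)^2*(2*(32*T))) &&
  Nat.ble (sum32 (smN K1 m mask r) T + 3*(j+1)*hN K1 K2 m mask r n B + 2*e + δ) K1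

lemma vA_cast {a b : ℤ} {A : ℤ} {a' b' : ℕ} (ha : a = a'+1) (hb : b = b') (hA : 0 ≤ A) (hd : a ∣ b^2-A) :
    ∃ t : ℕ, (vA a' b' t : ℤ) = A ∧ ∀ B : ℕ, A ≤ B → t < LA B a' b' := by
  lift A to ℕ using hA
  have h1 : A % (a'+1) = b'^2 % (a'+1) := by
    rw [ha, hb] at hd
    have h2 : (b':ℤ)^2 % ((a':ℤ)+1) = (A:ℤ) % ((a':ℤ)+1) := Int.emod_eq_emod_iff_emod_sub_eq_zero.2 (Int.emod_eq_zero_of_dvd hd)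
    exact_mod_cast h2.symm
  have e : vA a' b' (A/(a'+1)) = A := by
    rw [vA, ← h1]; exact Nat.mod_add_div A (a'+1)
  refine ⟨A/(a'+1), by rw [e], fun B hB => ?_⟩
  have hB' : A ≤ B := by exact_mod_cast hB
  rw [LA, Nat.lt_succ_iff, Nat.le_div_iff_mul_le (by omega)]
  rw [vA] at e
  rw [Nat.mul_comm]
  omega

lemma beta_bound {K T β x : ℤ} {e : ℕ} (hT : 30 ≤ T) (hT3 : 1616*K ≤ T^3) (hK : 4*K < (e+1)^2*(2*T)) (hx : T ≤ x)
    (h1 : 4*K = β^2*(3*x+β)) (h2 : 3*β^4 ≤ 4*K) : |β| ≤ e := by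
  have hb : |β| ≤ T := by
    by_contra hc
    push Not at hc
    have h3 : T^4 ≤ |β|^4 := pow_le_pow_left₀ (by linarith) hc.le 4
    rw [Even.pow_abs (by decide)] at h3
    have : 0 < T^3 := by positivity
    linarith [mul_le_mul_of_nonneg_left hT this.le]
  have h4 : -β ≤ T := (neg_le_abs β).trans hb
  have h5 : β^2*(2*T) ≤ 4*K := by rw [h1]; gcongr; linarith
  by_contra hc
  push Not at hc
  have h6 : ((e:ℤ)+1)^2 ≤ |β|^2 := pow_le_pow_left₀ (by positivity) (by linarith) 2
  rw [sq_abs] at h6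
  linarith [mul_le_mul_of_nonneg_right h6 (by linarith : 0 ≤ 2*T)]

lemma soundN_gen {K1 K2 m mask r n B e : ℕ} (hm : goodMask m mask = true) (c2 : 4*K2 < 3*(B+1)^2) (c3 : B^3 < K1*(n+1)^2)
    (k : ℤ) (h1 : (K1:ℤ) ≤ -k) (h2 : -k ≤ K2) (hK1 : 0 < K1) (hr : (m:ℤ) ∣ k - r) (j T : ℕ) (c4 : 4*K2 < (e+1)^2*(2*T)) (hj : okT K2 j T = true)
    (S : Finset (ℤ×ℤ)) (hS : ∀ P ∈ S, P.2^2 = P.1^3+k ∧ 0 < P.2)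
    (Sm : Finset ℤ) (hSm : ∀ x y : ℤ, x < T → y^2 = x^3+k → 0 < y → x ∈ Sm) :
    S.card ≤ Sm.card + 3*(j+1)*hN K1 K2 m mask r n B + 2*e := by
  have hk1 : (0:ℤ) < K1 := by exact_mod_cast hK1
  have hkn : k < 0 := by linarith
  have habs : |k| = -k := abs_of_neg hkn
  obtain ⟨t1, t2, t3⟩ := okT_sound hj k (by rw [habs]; exact h2)
  have hT4 : 4*(-k) < ((e:ℤ)+1)^2*(2*(T:ℤ)) := by
    have : (4*K2:ℤ) < ((e:ℤ)+1)^2*(2*(T:ℤ)) := by exact_mod_cast c4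
    linarith
  have main := total_keys k hkn.ne j T t1 t2 t3 S hS
    (keysOf n (LA B) (fN K1 K2 m mask r) (fun a b t => (vA a b t : ℤ))) ?_
    Sm hSm ((Finset.Icc (-(e:ℤ)) e).erase 0) ?_
  · have zk : zz k = 3 := by simp [zz, hkn]
    have k1 := keysOf_card n (LA B) (fN K1 K2 m mask r) (fun a b t => (vA a b t : ℤ))
    rw [zk, Finset.card_erase_of_mem (by simp), Int.card_Icc] at main
    have e3 : ((e:ℤ)+1 - -(e:ℤ)).toNat - 1 = 2*e := by omega
    rw [e3] at main
    have k3 := Nat.mul_le_mul_left (3*(j+1)) k1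
    exact main.trans (by gcongr; exact k1)
  · intro a b A g ha hb hba hd hg hR
    obtain ⟨r1, r2, r3⟩ := hR.1 hkn
    lift b to ℕ using hb
    obtain ⟨a', rfl⟩ : ∃ a' : ℕ, a = a'+1 := ⟨(a-1).toNat, by omega⟩
    obtain ⟨t, e1, e2⟩ := vA_cast rfl rfl r1.le hd
    have hAB : A ≤ B := by
      by_contra hc
      push Not at hc
      have : (4*K2:ℤ) < 3*((B:ℤ)+1)^2 := by exact_mod_cast c2
      nlinarith
    have hA3 : (K1:ℤ)*((a':ℤ)+1)^2 ≤ A^3 := le_trans (by gcongr) r3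
    have han : a' < n := by
      by_contra hc
      push Not at hc
      have h3 : (B:ℤ)^3 < K1*((n:ℤ)+1)^2 := by exact_mod_cast c3
      have h4 : A^3 ≤ (B:ℤ)^3 := pow_le_pow_left₀ r1.le hAB 3
      have h5 : ((n:ℤ)+1)^2 ≤ ((a':ℤ)+1)^2 := by gcongr
      nlinarith
    have := mem_keysOf (L := LA B) (f := fN K1 K2 m mask r) (A := fun a b t => (vA a b t : ℤ)) a' b t han (by omega) (e2 B hAB) ?_
    · simp only [e1] at this
      exact_mod_cast this
    · have q1 : Nat.ble (K1*(a'+1)^2) ((vA a' b t)^3) = true := by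
        rw [Nat.ble_eq]; rw [← e1] at hA3; exact_mod_cast hA3
      have q2 : Nat.ble (3*(vA a' b t)^2) (4*K2) = true := by
        rw [Nat.ble_eq]
        have : 3*A^2 ≤ 4*(K2:ℤ) := by linarith
        rw [← e1] at this; exact_mod_cast this
      simp only [fN, q1, q2, Bool.and_true, cond_true]
      rw [bit_sq hm g]
      · exact one_ne_zero
      · rw [hg]; push_cast; rw [e1]
        have : A^3+k*((a':ℤ)+1)^2-(A^3+r*((a':ℤ)+1)^2) = (k-r)*((a':ℤ)+1)^2 := by ring
        rw [this]; exact hr.mul_right _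
  · intro _ β x hβ hx h3 h4
    rw [habs] at t2
    have := beta_bound t1 t2 hT4 hx h3 h4
    rw [Finset.mem_erase, Finset.mem_Icc]
    exact ⟨hβ, abs_le.1 this⟩

lemma chkN_sound {K1 K2 m mask r j T n B e δ : ℕ} (hm : goodMask m mask = true) (h : chkN K1 K2 m mask r j T n B e δ = true)
    (k : ℤ) (h1 : (K1:ℤ) ≤ -k) (h2 : -k ≤ K2) (hK1 : 0 < K1) (hr : (m:ℤ) ∣ k - r) (S : Finset (ℤ×ℤ)) (hS : ∀ P ∈ S, P.2^2 = P.1^3+k ∧ 0 < P.2) :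
    S.card + δ ≤ K1 := by
  simp only [chkN, Bool.and_eq_true, Nat.ble_eq, Nat.blt_eq] at h
  obtain ⟨⟨⟨⟨c1, c2⟩, c3⟩, c4⟩, c5⟩ := h
  have main := soundN_gen hm c2 c3 k h1 h2 hK1 hr j (32*T) c4 c1 S hS (setOf32 (smN K1 m mask r) (fun x => (x:ℤ)) T) ?_
  · have k2 := setOf32_card (smN K1 m mask r) (fun x => (x:ℤ)) T
    omega
  · intro x y hx hy hy0
    have hx0 : 0 < x := by
      by_contra hx
      have : x^3 ≤ 0 := Odd.pow_nonpos (by decide) (by linarith)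
      linarith [sq_nonneg y]
    lift x to ℕ using hx0.le
    refine mem_setOf32 (X := fun x => (x:ℤ)) x (by exact_mod_cast hx) ?_
    have q : Nat.ble (x^3) K1 = false := by
      rw [Bool.eq_false_iff, ne_eq, Nat.ble_eq]
      intro hc
      have : (x:ℤ)^3 ≤ K1 := by exact_mod_cast hc
      nlinarith
    simp only [smN, q, cond_false]
    rw [bit_sq hm y]
    · exact one_ne_zero
    · rw [hy]; push_cast
      have : (x:ℤ)^3+k-(x^3+r) = k-r := by ring
      rw [this]; exact hr

end
section
def smP (m mask r : ℕ) (x : ℕ) : ℕ := bitm m mask (x^3+r)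
def smP' (K2 m mask r : ℕ) (x : ℕ) : ℕ := bif Nat.ble 1 x && Nat.blt (x^3) K2 then bitm m mask ((m-1)*x^3+r) else 0
def fP (K1 K2 m mask r a b t : ℕ) : ℕ :=
  bif Nat.ble (27*(4*K1*(a+1)^2+2*(vA a b t)^3)^2) (16*K2*(16*K2-9*(vA a b t)^2)^2) then bitm m mask ((vA a b t)^3+r*(a+1)^2) else 0
def vB (a b t : ℕ) : ℕ := (b*(a+1-b)) % (a+1) + (a+1)*t
def LB (B a b : ℕ) : ℕ := (B - (b*(a+1-b)) % (a+1)) / (a+1) + 1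
def fP' (K1 K2 m mask r a b t : ℕ) : ℕ :=
  bif Nat.ble 1 (vB a b t) && (Nat.ble ((vB a b t)^3) (K2*(a+1)^2) && Nat.ble (27*(4*K1*(a+1)^2-2*(vB a b t)^3)^2) (16*K2*(16*K2-9*(vB a b t)^2)^2))
   then bitm m mask ((m-1)*(vB a b t)^3+r*(a+1)^2) else 0
def hP (K1 K2 m mask r n B : ℕ) : ℕ := sumTo (fun a => sumTo (fun b => sumTo (fun t => fP K1 K2 m mask r a b t) (LA B a b)) (a+1)) n
def hP' (K1 K2 m mask r n B : ℕ) : ℕ := sumTo (fun a => sumTo (fun b => sumTo (fun t => fP' K1 K2 m mask r a b t) (LB B a b)) (a+1)) n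
def chkP (K1 K2 m mask r j T c n B δ : ℕ) : Bool :=
  okT K2 j (32*T) && Nat.blt (4*K2) (3*(B+1)^2) && Nat.blt (256*K2) (27*(n+1)^4) && Nat.ble K2 ((32*c)^3) &&
  Nat.ble (sum32 (smP m mask r) T + sum32 (smP' K2 m mask r) c + (j+1)*(hP K1 K2 m mask r n B + hP' K1 K2 m mask r n B) + δ) K1

lemma vB_cast {a b : ℤ} {A : ℤ} {a' b' : ℕ} (ha : a = a'+1) (hb : b = b') (hba : b' < a'+1) (hA : A ≤ 0) (hd : a ∣ b^2-A) :
    ∃ t : ℕ, (vB a' b' t : ℤ) = -A ∧ ∀ B : ℕ, -A ≤ B → t < LB B a' b' := by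
  obtain ⟨C, hC⟩ : ∃ C : ℕ, -A = C := ⟨(-A).toNat, by omega⟩
  have h1 : C % (a'+1) = (b'*(a'+1-b')) % (a'+1) := by
    rw [ha, hb, show (b':ℤ)^2-A = b'^2+C by rw [← hC]; ring] at hd
    have h2 : (C:ℤ) % ((a':ℤ)+1) = (b'*((a':ℤ)+1-b')) % ((a':ℤ)+1) := by
      apply Int.emod_eq_emod_iff_emod_sub_eq_zero.2 (Int.emod_eq_zero_of_dvd _)
      have : (C:ℤ)-b'*((a':ℤ)+1-b') = (b'^2+C) - b'*((a':ℤ)+1) := by ring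
      rw [this]
      exact dvd_sub hd (dvd_mul_left _ _)
    have e : ((a'+1-b' : ℕ):ℤ) = (a':ℤ)+1-b' := by omega
    rw [← e] at h2
    exact_mod_cast h2
  have e : vB a' b' (C/(a'+1)) = C := by
    rw [vB, ← h1]; exact Nat.mod_add_div C (a'+1)
  refine ⟨C/(a'+1), by rw [e, hC], fun B hB => ?_⟩
  have hB' : C ≤ B := by rw [hC] at hB; exact_mod_cast hB
  rw [LB, Nat.lt_succ_iff, Nat.le_div_iff_mul_le (by omega)]
  rw [vB] at e
  rw [Nat.mul_comm]
  omega

lemma fine_aux {k K2 l l1 A : ℤ} (h2 : k ≤ K2) (h0 : 0 ≤ l1) (hl : l1 ≤ l) (hk : 0 < k) (hA : 3*A^2 ≤ 4*k)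
    (h : 27*l^2 ≤ 16*k*(16*k-9*A^2)^2) : 27*l1^2 ≤ 16*K2*(16*K2-9*A^2)^2 := by
  have u1 : l1^2 ≤ l^2 := pow_le_pow_left₀ h0 hl 2
  have u2 : (16*k-9*A^2)^2 ≤ (16*K2-9*A^2)^2 := pow_le_pow_left₀ (by linarith) (by linarith) 2
  have u3 : 16*k*(16*k-9*A^2)^2 ≤ 16*K2*(16*K2-9*A^2)^2 := mul_le_mul (by linarith) u2 (by positivity) (by linarith)
  linarith

lemma soundP_gen {K1 K2 m mask r n B : ℕ} (hm : goodMask m mask = true) (c2 : 4*K2 < 3*(B+1)^2) (c3 : 256*K2 < 27*(n+1)^4)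
    (k : ℤ) (h1 : (K1:ℤ) ≤ k) (h2 : k ≤ K2) (hK1 : 0 < K1) (hr : (m:ℤ) ∣ k - r) (j T : ℕ) (hj : okT K2 j T = true)
    (S : Finset (ℤ×ℤ)) (hS : ∀ P ∈ S, P.2^2 = P.1^3+k ∧ 0 < P.2)
    (Sm : Finset ℤ) (hSm : ∀ x y : ℤ, x < T → y^2 = x^3+k → 0 < y → x ∈ Sm) :
    S.card ≤ Sm.card + (j+1)*(hP K1 K2 m mask r n B + hP' K1 K2 m mask r n B) := by
  have hm1 : 1 ≤ m := by
    simp only [goodMask, Bool.and_eq_true, Nat.ble_eq] at hm; exact hm.1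
  have hmc : ((m-1:ℕ):ℤ) = m - 1 := by omega
  have hk1 : (0:ℤ) < K1 := by exact_mod_cast hK1
  have hkp : 0 < k := by linarith
  obtain ⟨t1, t2, t3⟩ := okT_sound hj k (by rw [abs_of_pos hkp]; exact h2)
  have main := total_keys k hkp.ne' j T t1 t2 t3 S hS
    (keysOf n (LA B) (fP K1 K2 m mask r) (fun a b t => (vA a b t : ℤ)) ∪ keysOf n (LB B) (fP' K1 K2 m mask r) (fun a b t => -(vB a b t : ℤ))) ?_
    Sm hSm ∅ ?_
  · have zk : zz k = 1 := by simp [zz, not_lt.2 hkp.le]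
    have k1 := keysOf_card n (LA B) (fP K1 K2 m mask r) (fun a b t => (vA a b t : ℤ))
    have k1' := keysOf_card n (LB B) (fP' K1 K2 m mask r) (fun a b t => -(vB a b t : ℤ))
    have u1 := Finset.card_union_le (keysOf n (LA B) (fP K1 K2 m mask r) (fun a b t => (vA a b t : ℤ))) (keysOf n (LB B) (fP' K1 K2 m mask r) (fun a b t => -(vB a b t : ℤ)))
    rw [zk, one_mul, Finset.card_empty, add_zero] at main
    exact main.trans (by gcongr; exact u1.trans (add_le_add k1 k1'))
  · intro a b A g ha hb hba hd hg hR
    obtain ⟨r1, r2, r3⟩ := hR.2 hkp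
    lift b to ℕ using hb
    obtain ⟨a', rfl⟩ : ∃ a' : ℕ, a = a'+1 := ⟨(a-1).toNat, by omega⟩
    have hB2 : (4*K2:ℤ) < 3*((B:ℤ)+1)^2 := by exact_mod_cast c2
    have hAB : |A| ≤ B := by
      by_contra hc
      push Not at hc
      have h3 : ((B:ℤ)+1)^2 ≤ |A|^2 := pow_le_pow_left₀ (by positivity) (by linarith) 2
      rw [sq_abs] at h3
      linarith
    have han : a' < n := by
      by_contra hc
      push Not at hc
      have h3 : (256*K2:ℤ) < 27*((n:ℤ)+1)^4 := by exact_mod_cast c3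
      have h5 : ((n:ℤ)+1)^4 ≤ ((a':ℤ)+1)^4 := by gcongr
      linarith
    have hKa : (K1:ℤ)*((a':ℤ)+1)^2 ≤ k*((a':ℤ)+1)^2 := by gcongr
    have hKa2 : k*((a':ℤ)+1)^2 ≤ (K2:ℤ)*((a':ℤ)+1)^2 := by gcongr
    have hgn := sq_nonneg g
    have hKa0 : 0 ≤ (K1:ℤ)*((a':ℤ)+1)^2 := by positivity
    rw [Finset.mem_union]
    rcases le_or_gt 0 A with hA | hA
    · left
      obtain ⟨t, e1, e2⟩ := vA_cast rfl rfl hA hd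
      have hA3 : 0 ≤ A^3 := by positivity
      have := mem_keysOf (L := LA B) (f := fP K1 K2 m mask r) (A := fun a b t => (vA a b t : ℤ)) a' b t han (by omega) (e2 B ((le_abs_self A).trans hAB)) ?_
      · simp only [e1] at this
        exact_mod_cast this
      · have q1 : Nat.ble (27*(4*K1*(a'+1)^2+2*(vA a' b t)^3)^2) (16*K2*(16*K2-9*(vA a' b t)^2)^2) = true := by
          rw [Nat.ble_eq]
          have e9 : 9*(vA a' b t)^2 ≤ 16*K2 := by
            have : 9*A^2 ≤ 16*(K2:ℤ) := by linarith
            rw [← e1] at this; exact_mod_cast this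
          have := fine_aux (l1 := 4*K1*((a':ℤ)+1)^2+2*A^3) h2 (by linarith) (by linarith) hkp r1 r3
          rw [← e1] at this
          zify [e9]
          exact this
        simp only [fP, q1, cond_true]
        rw [bit_sq hm g]
        · exact one_ne_zero
        · rw [hg]; push_cast; rw [e1]
          have : A^3+k*((a':ℤ)+1)^2-(A^3+r*((a':ℤ)+1)^2) = (k-r)*((a':ℤ)+1)^2 := by ring
          rw [this]; exact hr.mul_right _
    · have hA0 := hA
      have hA := hA.le
      right
      obtain ⟨t, e1, e2⟩ := vB_cast rfl rfl (by omega) hA hd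
      have := mem_keysOf (L := LB B) (f := fP' K1 K2 m mask r) (A := fun a b t => -(vB a b t : ℤ)) a' b t han (by omega) (e2 B ((neg_le_abs A).trans hAB)) ?_
      · simp only [e1, neg_neg] at this
        exact_mod_cast this
      · have e3 : (vB a' b t:ℤ)^3 = -A^3 := by rw [e1]; ring
        have e4 : (vB a' b t:ℤ)^2 = A^2 := by rw [e1]; ring
        have q0 : Nat.ble 1 (vB a' b t) = true := by
          rw [Nat.ble_eq]; omega
        have q2 : Nat.ble ((vB a' b t)^3) (K2*(a'+1)^2) = true := by
          rw [Nat.ble_eq]; zify; rw [e3]; linarith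
        have q1 : Nat.ble (27*(4*K1*(a'+1)^2-2*(vB a' b t)^3)^2) (16*K2*(16*K2-9*(vB a' b t)^2)^2) = true := by
          rw [Nat.ble_eq]
          have e9 : 9*(vB a' b t)^2 ≤ 16*K2 := by
            zify; rw [e4]; linarith
          rcases le_total (2*(vB a' b t)^3) (4*K1*(a'+1)^2) with hc | hc
          · have hc' : 2*(vB a' b t:ℤ)^3 ≤ 4*K1*((a':ℤ)+1)^2 := by exact_mod_cast hc
            rw [e3] at hc'
            have := fine_aux (l1 := 4*K1*((a':ℤ)+1)^2-2*(-A^3)) h2 (by linarith) (by linarith) hkp r1 r3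
            zify [e9, hc]
            rw [e3, e4]
            exact this
          · rw [Nat.sub_eq_zero_of_le hc]; simp
        simp only [fP', q0, q1, q2, Bool.and_true, cond_true]
        rw [bit_sq hm g]
        · exact one_ne_zero
        · rw [hg]; push_cast; rw [e3, hmc]
          have : A^3+k*((a':ℤ)+1)^2-(((m:ℤ)-1)*(-A^3)+r*((a':ℤ)+1)^2) = (k-r)*((a':ℤ)+1)^2 + m*A^3 := by ring
          rw [this]; exact dvd_add (hr.mul_right _) (dvd_mul_right _ _)
  · intro h; linarith

lemma chkP_sound {K1 K2 m mask r j T c n B δ : ℕ} (hm : goodMask m mask = true) (h : chkP K1 K2 m mask r j T c n B δ = true)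
    (k : ℤ) (h1 : (K1:ℤ) ≤ k) (h2 : k ≤ K2) (hK1 : 0 < K1) (hr : (m:ℤ) ∣ k - r) (S : Finset (ℤ×ℤ)) (hS : ∀ P ∈ S, P.2^2 = P.1^3+k ∧ 0 < P.2) :
    S.card + δ ≤ K1 := by
  have hm1 : 1 ≤ m := by
    simp only [goodMask, Bool.and_eq_true, Nat.ble_eq] at hm; exact hm.1
  have hmc : ((m-1:ℕ):ℤ) = m - 1 := by omega
  simp only [chkP, Bool.and_eq_true, Nat.ble_eq, Nat.blt_eq] at h
  obtain ⟨⟨⟨⟨c1, c2⟩, c3⟩, c4⟩, c5⟩ := h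
  have main := soundP_gen hm c2 c3 k h1 h2 hK1 hr j (32*T) c1 S hS
    (setOf32 (smP m mask r) (fun x => (x:ℤ)) T ∪ setOf32 (smP' K2 m mask r) (fun x => -(x:ℤ)) c) ?_
  · have k2 := setOf32_card (smP m mask r) (fun x => (x:ℤ)) T
    have k2' := setOf32_card (smP' K2 m mask r) (fun x => -(x:ℤ)) c
    have u2 := Finset.card_union_le (setOf32 (smP m mask r) (fun x => (x:ℤ)) T) (setOf32 (smP' K2 m mask r) (fun x => -(x:ℤ)) c)
    omega
  · intro x y hx hy hy0
    rw [Finset.mem_union]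
    rcases le_or_gt 0 x with hx0 | hx0
    · left
      lift x to ℕ using hx0
      refine mem_setOf32 (X := fun x => (x:ℤ)) x (by exact_mod_cast hx) ?_
      simp only [smP]
      rw [bit_sq hm y]
      · exact one_ne_zero
      · rw [hy]; push_cast
        have : (x:ℤ)^3+k-(x^3+r) = k-r := by ring
        rw [this]; exact hr
    · right
      obtain ⟨z, rfl⟩ : ∃ z : ℕ, x = -(z:ℤ) := ⟨(-x).toNat, by omega⟩
      have hz3 : (z:ℤ)^3 < K2 := by
        have : 0 < y^2 := by positivity
        have e : (-(z:ℤ))^3 = -(z:ℤ)^3 := by ring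
        linarith
      have hz3' : z^3 < K2 := by exact_mod_cast hz3
      refine mem_setOf32 (X := fun x => -(x:ℤ)) z ?_ ?_
      · by_contra hc
        push Not at hc
        have := Nat.pow_le_pow_left hc 3
        omega
      · have q0 : Nat.ble 1 z = true := by rw [Nat.ble_eq]; omega
        have q1 : Nat.blt (z^3) K2 = true := by rw [Nat.blt_eq]; exact hz3'
        simp only [smP', q0, q1, Bool.and_true, cond_true]
        rw [bit_sq hm y]
        · exact one_ne_zero
        · rw [hy]; push_cast; rw [hmc]
          have : (-(z:ℤ))^3+k-(((m:ℤ)-1)*z^3+r) = (k-r) - m*z^3 := by ring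
          rw [this]; exact dvd_sub hr (dvd_mul_right _ _)

end
section
set_option maxRecDepth 100000
def mk1 : ℕ := 0x1
lemma gm1 : goodMask 1 mk1 = true := by decide +kernel
def mk5 : ℕ := 0x13
lemma gm5 : goodMask 5 mk5 = true := by decide +kernel
def mk7 : ℕ := 0x17
lemma gm7 : goodMask 7 mk7 = true := by decide +kernel
def mk24 : ℕ := 0x11213
lemma gm24 : goodMask 24 mk24 = true := by decide +kernel
def mk35 : ℕ := 0x6221ca13
lemma gm35 : goodMask 35 mk35 = true := by decide +kernel
def mk120 : ℕ := 0x211001210011002011003010213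
lemma gm120 : goodMask 120 mk120 = true := by decide +kernel
def mk5040 : ℕ := 0x10000000002000010000000000000000002010010000000000200000002010002000000000000000000010000000002000012000200000010000002010000000000000000000000010002001000000003000000000000000002000002000002000011000000010000000000010002000000000210000000000002000200000000001000000002000002000010000000000010001000010002000002000010000000000002000000010201000000000010000002000000000002000210000000010002000002010012000000000000000000010000000202000010000000000000000002010010000200000000001002010003000000000000000200010000001002000012000000000010000002010000000000000200000000010002000000000002000000000200000002000002000202000010000000010000000000010002000000000010001000000003000000000000000200000002000002000011000000000010000000010002000002000211000000000002000000010000000000000010000002000000000002000010001000010002000002010012000000000000000000010001000002000010000200000000000002010210000000000000000002010002000000000001000000010000000002000012000000000010000002010000000200000000001000010002000000000002000200000000001002000002000002000010000000010000001000010202000000000010000000000002000000000201000000000002000002000010000000000210000000010002000002000010001000000002000000010000000200000010000002000001000002000010000200010002001002010213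
lemma gm5040 : goodMask 5040 mk5040 = true := by decide +kernel

def Pts (k : ℤ) (S : Finset (ℤ×ℤ)) : Prop := ∀ P ∈ S, P.2^2 = P.1^3+k ∧ 0 < P.2
def OK (δ : ℕ) (k : ℤ) : Prop := ∀ S, Pts k S → S.card + δ ≤ k.natAbs
def blkN (K1 K2 m mask T n B e : ℕ) : Bool := allTo (fun r => chkN K1 K2 m mask r 2 T n B e 2) m
def blkP (K1 K2 m mask T c n B : ℕ) : Bool := allTo (fun r => chkP K1 K2 m mask r 2 T c n B 2) m
lemma exres {m : ℕ} (hm : 0 < m) (k : ℤ) : ∃ r < m, (m:ℤ) ∣ k - (r:ℕ) := by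
  have h0 : (0:ℤ) < m := by exact_mod_cast hm
  refine ⟨(k % m).toNat, ?_, ?_⟩
  · have := Int.emod_lt_of_pos k h0
    have := Int.emod_nonneg k h0.ne'
    omega
  · rw [Int.toNat_of_nonneg (Int.emod_nonneg k h0.ne')]
    exact Int.dvd_self_sub_emod
lemma gm_pos {m mask : ℕ} (hm : goodMask m mask = true) : 0 < m := by
  simp only [goodMask, Bool.and_eq_true, Nat.ble_eq] at hm; exact hm.1
lemma blkN_sound {K1 K2 m mask T n B e : ℕ} (hm : goodMask m mask = true) (h : blkN K1 K2 m mask T n B e = true) (hK : 0 < K1)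
    (k : ℤ) (h1 : (K1:ℤ) ≤ -k) (h2 : -k ≤ K2) : OK 2 k := by
  intro S hS
  obtain ⟨r, hr, hd⟩ := exres (gm_pos hm) k
  have := chkN_sound hm ((allTo_iff _ _).1 h r hr) k h1 h2 hK hd S hS
  omega
lemma blkP_sound {K1 K2 m mask T c n B : ℕ} (hm : goodMask m mask = true) (h : blkP K1 K2 m mask T c n B = true) (hK : 0 < K1)
    (k : ℤ) (h1 : (K1:ℤ) ≤ k) (h2 : k ≤ K2) : OK 2 k := by
  intro S hS
  obtain ⟨r, hr, hd⟩ := exres (gm_pos hm) k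
  have := chkP_sound hm ((allTo_iff _ _).1 h r hr) k h1 h2 hK hd S hS
  omega
def perN (ex : ℕ) (lo T n B e : ℕ) : ℕ → Bool := allTo (fun i => Nat.beq ((ex >>> (lo+i)) % 2) 1 || chkN (lo+i) (lo+i) 5040 mk5040 (5040-(lo+i)) 2 T n B e 2)
def perP (ex : ℕ) (lo T c n B : ℕ) : ℕ → Bool := allTo (fun i => Nat.beq ((ex >>> (lo+i)) % 2) 1 || chkP (lo+i) (lo+i) 5040 mk5040 (lo+i) 2 T c n B 2)
lemma perN_sound {ex lo T n B e N : ℕ} (h : perN ex lo T n B e N = true) (K : ℕ) (hK : 0 < K) (h1 : lo ≤ K) (h2 : K < lo+N) (h3 : K ≤ 5040) (hx : (ex >>> K) % 2 = 0) :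
    OK 2 (-(K:ℤ)) := by
  intro S hS
  have h4 := (allTo_iff _ _).1 h (K-lo) (by omega)
  rw [Nat.add_sub_cancel' h1, Bool.or_eq_true, Nat.beq_eq, hx] at h4
  rcases h4 with h4 | h4
  · omega
  have := chkN_sound gm5040 h4 (-(K:ℤ)) (by simp) (by simp) hK ⟨-1, by push_cast [h3]; ring⟩ S hS
  omega
lemma perP_sound {ex lo T c n B N : ℕ} (h : perP ex lo T c n B N = true) (K : ℕ) (hK : 0 < K) (h1 : lo ≤ K) (h2 : K < lo+N) (hx : (ex >>> K) % 2 = 0) :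
    OK 2 (K:ℤ) := by
  intro S hS
  have h4 := (allTo_iff _ _).1 h (K-lo) (by omega)
  rw [Nat.add_sub_cancel' h1, Bool.or_eq_true, Nat.beq_eq, hx] at h4
  rcases h4 with h4 | h4
  · omega
  have := chkP_sound gm5040 h4 (K:ℤ) le_rfl le_rfl hK ⟨0, by ring⟩ S hS
  omega


end
section
set_option maxRecDepth 100000
lemma bN0 : blkN 150 191 24 mk24 3 4 15 1 = true := by decide +kernel
lemma bN1 : blkN 192 242 35 mk35 3 5 17 2 = true := by decide +kernel
lemma bN2 : blkN 243 330 35 mk35 3 5 20 2 = true := by decide +kernel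
lemma bN3 : blkN 331 431 5 mk5 3 6 23 2 = true := by decide +kernel
lemma bN4 : blkN 432 506 5 mk5 3 6 25 3 = true := by decide +kernel
lemma bN5 : blkN 507 674 5 mk5 4 6 29 3 = true := by decide +kernel
lemma bN6 : blkN 675 971 5 mk5 5 7 35 3 = true := by decide +kernel
lemma bN7 : blkN 972 1026 1 mk1 5 6 36 3 = true := by decide +kernel
lemma bN8 : blkN 1027 1140 1 mk1 5 7 38 3 = true := by decide +kernel
lemma bN9 : blkN 1141 1258 1 mk1 5 7 40 3 = true := by decide +kernel
lemma bN10 : blkN 1259 1451 1 mk1 6 7 43 3 = true := by decide +kernel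
lemma bN11 : blkN 1452 1654 1 mk1 6 8 46 4 = true := by decide +kernel
lemma bN12 : blkN 1655 1950 1 mk1 7 8 50 4 = true := by decide +kernel
lemma bN13 : blkN 1951 2436 1 mk1 8 9 56 4 = true := by decide +kernel
lemma bN14 : blkN 2437 3071 1 mk1 10 10 63 4 = true := by decide +kernel
lemma bN15 : blkN 3072 4106 1 mk1 11 11 73 4 = true := by decide +kernel
lemma bN16 : blkN 4107 5807 1 mk1 14 12 87 5 = true := by decide +kernel
lemma bN17 : blkN 5808 8596 1 mk1 18 14 107 5 = true := by decide +kernel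
lemma bN18 : blkN 8597 13756 1 mk1 25 16 135 5 = true := by decide +kernel
lemma bN19 : blkN 13757 22012 1 mk1 34 19 171 6 = true := by decide +kernel
lemma bN20 : blkN 22013 35221 1 mk1 47 21 216 6 = true := by decide +kernel
lemma bN21 : blkN 35222 50000 1 mk1 59 22 258 7 = true := by decide +kernel
lemma midN (k : ℤ) (h1 : 150 ≤ -k) (h2 : -k ≤ 50000) : OK 2 k := by
  rcases le_or_gt (-k) 191 with h | h
  · exact blkN_sound gm24 bN0 (by decide) k (by push_cast; omega) (by push_cast; omega)
  rcases le_or_gt (-k) 242 with h | h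
  · exact blkN_sound gm35 bN1 (by decide) k (by push_cast; omega) (by push_cast; omega)
  rcases le_or_gt (-k) 330 with h | h
  · exact blkN_sound gm35 bN2 (by decide) k (by push_cast; omega) (by push_cast; omega)
  rcases le_or_gt (-k) 431 with h | h
  · exact blkN_sound gm5 bN3 (by decide) k (by push_cast; omega) (by push_cast; omega)
  rcases le_or_gt (-k) 506 with h | h
  · exact blkN_sound gm5 bN4 (by decide) k (by push_cast; omega) (by push_cast; omega)
  rcases le_or_gt (-k) 674 with h | h
  · exact blkN_sound gm5 bN5 (by decide) k (by push_cast; omega) (by push_cast; omega)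
  rcases le_or_gt (-k) 971 with h | h
  · exact blkN_sound gm5 bN6 (by decide) k (by push_cast; omega) (by push_cast; omega)
  rcases le_or_gt (-k) 1026 with h | h
  · exact blkN_sound gm1 bN7 (by decide) k (by push_cast; omega) (by push_cast; omega)
  rcases le_or_gt (-k) 1140 with h | h
  · exact blkN_sound gm1 bN8 (by decide) k (by push_cast; omega) (by push_cast; omega)
  rcases le_or_gt (-k) 1258 with h | h
  · exact blkN_sound gm1 bN9 (by decide) k (by push_cast; omega) (by push_cast; omega)
  rcases le_or_gt (-k) 1451 with h | h
  · exact blkN_sound gm1 bN10 (by decide) k (by push_cast; omega) (by push_cast; omega)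
  rcases le_or_gt (-k) 1654 with h | h
  · exact blkN_sound gm1 bN11 (by decide) k (by push_cast; omega) (by push_cast; omega)
  rcases le_or_gt (-k) 1950 with h | h
  · exact blkN_sound gm1 bN12 (by decide) k (by push_cast; omega) (by push_cast; omega)
  rcases le_or_gt (-k) 2436 with h | h
  · exact blkN_sound gm1 bN13 (by decide) k (by push_cast; omega) (by push_cast; omega)
  rcases le_or_gt (-k) 3071 with h | h
  · exact blkN_sound gm1 bN14 (by decide) k (by push_cast; omega) (by push_cast; omega)
  rcases le_or_gt (-k) 4106 with h | h
  · exact blkN_sound gm1 bN15 (by decide) k (by push_cast; omega) (by push_cast; omega)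
  rcases le_or_gt (-k) 5807 with h | h
  · exact blkN_sound gm1 bN16 (by decide) k (by push_cast; omega) (by push_cast; omega)
  rcases le_or_gt (-k) 8596 with h | h
  · exact blkN_sound gm1 bN17 (by decide) k (by push_cast; omega) (by push_cast; omega)
  rcases le_or_gt (-k) 13756 with h | h
  · exact blkN_sound gm1 bN18 (by decide) k (by push_cast; omega) (by push_cast; omega)
  rcases le_or_gt (-k) 22012 with h | h
  · exact blkN_sound gm1 bN19 (by decide) k (by push_cast; omega) (by push_cast; omega)
  rcases le_or_gt (-k) 35221 with h | h
  · exact blkN_sound gm1 bN20 (by decide) k (by push_cast; omega) (by push_cast; omega)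
  exact blkN_sound gm1 bN21 (by decide) k (by push_cast; omega) (by push_cast; omega)
lemma bP0 : blkP 432 477 35 mk35 3 1 8 25 = true := by decide +kernel
lemma bP1 : blkP 478 533 35 mk35 3 1 8 26 = true := by decide +kernel
lemma bP2 : blkP 534 617 35 mk35 4 1 8 28 = true := by decide +kernel
lemma bP3 : blkP 618 707 35 mk35 4 1 9 30 = true := by decide +kernel
lemma bP4 : blkP 708 863 35 mk35 4 1 9 33 = true := by decide +kernel
lemma bP5 : blkP 864 1119 35 mk35 5 1 10 38 = true := by decide +kernel
lemma bP6 : blkP 1120 1577 35 mk35 6 1 11 45 = true := by decide +kernel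
lemma bP7 : blkP 1578 2525 35 mk35 8 1 12 58 = true := by decide +kernel
lemma bP8 : blkP 2526 2927 5 mk5 9 1 12 62 = true := by decide +kernel
lemma bP9 : blkP 2928 3448 5 mk5 10 1 13 67 = true := by decide +kernel
lemma bP10 : blkP 3449 4188 5 mk5 12 1 14 74 = true := by decide +kernel
lemma bP11 : blkP 4189 5339 5 mk5 14 1 14 84 = true := by decide +kernel
lemma bP12 : blkP 5340 7203 5 mk5 16 1 16 98 = true := by decide +kernel
lemma bP13 : blkP 7204 11071 5 mk5 22 1 17 121 = true := by decide +kernel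
lemma bP14 : blkP 11072 12293 1 mk1 23 1 18 128 = true := by decide +kernel
lemma bP15 : blkP 12294 13823 1 mk1 25 1 19 135 = true := by decide +kernel
lemma bP16 : blkP 13824 16331 1 mk1 28 1 19 147 = true := by decide +kernel
lemma bP17 : blkP 16332 20243 1 mk1 32 1 20 164 = true := by decide +kernel
lemma bP18 : blkP 20244 25955 1 mk1 38 1 22 186 = true := by decide +kernel
lemma bP19 : blkP 25956 35316 1 mk1 47 2 24 216 = true := by decide +kernel
lemma bP20 : blkP 35317 50000 1 mk1 59 2 26 258 = true := by decide +kernel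
lemma midP (k : ℤ) (h1 : 432 ≤ k) (h2 : k ≤ 50000) : OK 2 k := by
  rcases le_or_gt (k) 477 with h | h
  · exact blkP_sound gm35 bP0 (by decide) k (by push_cast; omega) (by push_cast; omega)
  rcases le_or_gt (k) 533 with h | h
  · exact blkP_sound gm35 bP1 (by decide) k (by push_cast; omega) (by push_cast; omega)
  rcases le_or_gt (k) 617 with h | h
  · exact blkP_sound gm35 bP2 (by decide) k (by push_cast; omega) (by push_cast; omega)
  rcases le_or_gt (k) 707 with h | h
  · exact blkP_sound gm35 bP3 (by decide) k (by push_cast; omega) (by push_cast; omega)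
  rcases le_or_gt (k) 863 with h | h
  · exact blkP_sound gm35 bP4 (by decide) k (by push_cast; omega) (by push_cast; omega)
  rcases le_or_gt (k) 1119 with h | h
  · exact blkP_sound gm35 bP5 (by decide) k (by push_cast; omega) (by push_cast; omega)
  rcases le_or_gt (k) 1577 with h | h
  · exact blkP_sound gm35 bP6 (by decide) k (by push_cast; omega) (by push_cast; omega)
  rcases le_or_gt (k) 2525 with h | h
  · exact blkP_sound gm35 bP7 (by decide) k (by push_cast; omega) (by push_cast; omega)
  rcases le_or_gt (k) 2927 with h | h
  · exact blkP_sound gm5 bP8 (by decide) k (by push_cast; omega) (by push_cast; omega)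
  rcases le_or_gt (k) 3448 with h | h
  · exact blkP_sound gm5 bP9 (by decide) k (by push_cast; omega) (by push_cast; omega)
  rcases le_or_gt (k) 4188 with h | h
  · exact blkP_sound gm5 bP10 (by decide) k (by push_cast; omega) (by push_cast; omega)
  rcases le_or_gt (k) 5339 with h | h
  · exact blkP_sound gm5 bP11 (by decide) k (by push_cast; omega) (by push_cast; omega)
  rcases le_or_gt (k) 7203 with h | h
  · exact blkP_sound gm5 bP12 (by decide) k (by push_cast; omega) (by push_cast; omega)
  rcases le_or_gt (k) 11071 with h | h
  · exact blkP_sound gm5 bP13 (by decide) k (by push_cast; omega) (by push_cast; omega)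
  rcases le_or_gt (k) 12293 with h | h
  · exact blkP_sound gm1 bP14 (by decide) k (by push_cast; omega) (by push_cast; omega)
  rcases le_or_gt (k) 13823 with h | h
  · exact blkP_sound gm1 bP15 (by decide) k (by push_cast; omega) (by push_cast; omega)
  rcases le_or_gt (k) 16331 with h | h
  · exact blkP_sound gm1 bP16 (by decide) k (by push_cast; omega) (by push_cast; omega)
  rcases le_or_gt (k) 20243 with h | h
  · exact blkP_sound gm1 bP17 (by decide) k (by push_cast; omega) (by push_cast; omega)
  rcases le_or_gt (k) 25955 with h | h
  · exact blkP_sound gm1 bP18 (by decide) k (by push_cast; omega) (by push_cast; omega)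
  rcases le_or_gt (k) 35316 with h | h
  · exact blkP_sound gm1 bP19 (by decide) k (by push_cast; omega) (by push_cast; omega)
  exact blkP_sound gm1 bP20 (by decide) k (by push_cast; omega) (by push_cast; omega)

end
section
set_option maxRecDepth 100000
lemma pN1 : perN 0x999e 5 1 3 4 1 12 = true := by decide +kernel
lemma pN2 : perN 0 17 2 5 8 1 34 = true := by decide +kernel
lemma pN3 : perN 0 51 2 7 14 2 99 = true := by decide +kernel
lemma pP1 : perP 0x2000313fe 10 2 1 4 7 31 = true := by decide +kernel
lemma pP2 : perP 0 41 2 1 6 14 110 = true := by decide +kernel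
lemma pP3 : perP 0 151 3 1 7 19 141 = true := by decide +kernel
lemma pP4 : perP 0 292 3 1 7 23 140 = true := by decide +kernel
lemma lowN (K : ℕ) (h1 : 5 ≤ K) (h2 : K < 150) (hx : (0x999e >>> K) % 2 = 0) : OK 2 (-(K:ℤ)) := by
  rcases lt_or_ge K 17 with h | h
  · exact perN_sound pN1 K (by omega) (by omega) (by omega) (by omega) hx
  rcases lt_or_ge K 51 with h | h
  · exact perN_sound pN2 K (by omega) (by omega) (by omega) (by omega) (by simp)
  · exact perN_sound pN3 K (by omega) (by omega) (by omega) (by omega) (by simp)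
lemma lowP (K : ℕ) (h1 : 10 ≤ K) (h2 : K < 432) (hx : (0x2000313fe >>> K) % 2 = 0) : OK 2 (K:ℤ) := by
  rcases lt_or_ge K 41 with h | h
  · exact perP_sound pP1 K (by omega) (by omega) (by omega) hx
  rcases lt_or_ge K 151 with h | h
  · exact perP_sound pP2 K (by omega) (by omega) (by omega) (by simp)
  rcases lt_or_ge K 292 with h | h
  · exact perP_sound pP3 K (by omega) (by omega) (by omega) (by simp)
  · exact perP_sound pP4 K (by omega) (by omega) (by omega) (by simp)
lemma ok_m3 : OK 1 (-3) := fun S hS => chkN_sound (K1 := 3) (K2 := 3) (r := 5037) (j := 2) (T := 1) (n := 1) (B := 2) (e := 0) gm5040 (by decide +kernel) (-3) (by norm_num) (by norm_num) (by norm_num) ⟨-1, by norm_num⟩ S hS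
lemma ok_m12 : OK 1 (-12) := fun S hS => chkN_sound (K1 := 12) (K2 := 12) (r := 5028) (j := 2) (T := 1) (n := 2) (B := 4) (e := 0) gm5040 (by decide +kernel) (-12) (by norm_num) (by norm_num) (by norm_num) ⟨-1, by norm_num⟩ S hS
lemma ok_16 : OK 1 16 := fun S hS => chkP_sound (K1 := 16) (K2 := 16) (r := 16) (j := 2) (T := 1) (c := 1) (n := 3) (B := 4) gm5040 (by decide +kernel) 16 (by norm_num) (by norm_num) (by norm_num) ⟨0, by norm_num⟩ S hS

end
section
lemma bitm_le (m mask v : ℕ) : bitm m mask v ≤ 1 := by unfold bitm; omega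
lemma sumTo_le {f : ℕ → ℕ} {n c : ℕ} (h : ∀ i, f i ≤ c) : sumTo f n ≤ n*c := by
  rw [sumTo_eq]
  calc _ ≤ ∑ _i ∈ Finset.range n, c := Finset.sum_le_sum fun i _ => h i
    _ = n*c := by simp
lemma sum32_le {f : ℕ → ℕ} (h : ∀ i, f i ≤ 1) (n : ℕ) : sum32 f n ≤ 32*n := by
  have := sumTo_le (f := fun i => sumTo (fun l => f (32*i+l)) 32) (n := n) (c := 32) (fun i => (sumTo_le (c := 1) (fun l => h _)).trans (by norm_num))
  unfold sum32; omega
lemma box_le {f : ℕ → ℕ → ℕ → ℕ} {B : ℕ} {L : ℕ → ℕ → ℕ} (hL : ∀ a b, L a b ≤ B/(a+1)+1) (h : ∀ a b t, f a b t ≤ 1) (n : ℕ) :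
    2*sumTo (fun a => sumTo (fun b => sumTo (fun t => f a b t) (L a b)) (a+1)) n ≤ 2*(n*B) + n*(n+1) := by
  have h1 : ∀ a, sumTo (fun b => sumTo (fun t => f a b t) (L a b)) (a+1) ≤ B + (a+1) := by
    intro a
    have := sumTo_le (n := a+1) (f := fun b => sumTo (fun t => f a b t) (L a b)) (c := B/(a+1)+1) (fun b => (sumTo_le (c := 1) (fun t => h a b t)).trans (by rw [mul_one]; exact hL a b))
    refine this.trans ?_
    rw [mul_add, mul_one]
    gcongr
    exact Nat.mul_div_le B (a+1)
  induction n with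
  | zero => simp [sumTo]
  | succ n ih =>
    have e : ∀ g : ℕ → ℕ, sumTo g (n+1) = g n + sumTo g n := fun _ => rfl
    rw [e]
    have := h1 n
    linarith
lemma LA_le (B a b : ℕ) : LA B a b ≤ B/(a+1)+1 := by
  unfold LA; gcongr; omega
lemma LB_le (B a b : ℕ) : LB B a b ≤ B/(a+1)+1 := by
  unfold LB; gcongr; omega
lemma smN_le (K1 m mask r x : ℕ) : smN K1 m mask r x ≤ 1 := by
  unfold smN; cases Nat.ble (x^3) K1 <;> simp [bitm_le]
lemma smP'_le (K2 m mask r x : ℕ) : smP' K2 m mask r x ≤ 1 := by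
  unfold smP'; cases (Nat.ble 1 x && Nat.blt (x^3) K2) <;> simp [bitm_le]
lemma fN_le (K1 K2 m mask r a b t : ℕ) : fN K1 K2 m mask r a b t ≤ 1 := by
  unfold fN; cases (Nat.ble (K1*(a+1)^2) ((vA a b t)^3) && Nat.ble (3*(vA a b t)^2) (4*K2)) <;> simp [bitm_le]
lemma fP_le (K1 K2 m mask r a b t : ℕ) : fP K1 K2 m mask r a b t ≤ 1 := by
  unfold fP; rw [Bool.cond_eq_ite]; split_ifs <;> simp [bitm_le]
lemma fP'_le (K1 K2 m mask r a b t : ℕ) : fP' K1 K2 m mask r a b t ≤ 1 := by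
  unfold fP'; rw [Bool.cond_eq_ite]; split_ifs <;> simp [bitm_le]

lemma root12 (K : ℕ) (hK : 50000 ≤ K) : ∃ s : ℝ, 2.46 ≤ s ∧ s^12 = K := by
  refine ⟨(K:ℝ)^((1:ℝ)/12), ?_, ?_⟩
  · have h : (50000:ℝ) ≤ K := by exact_mod_cast hK
    by_contra hc
    push Not at hc
    have h0 : (0:ℝ) ≤ (K:ℝ)^((1:ℝ)/12) := by positivity
    have h1 := pow_le_pow_left₀ h0 hc.le 12
    rw [← Real.rpow_natCast, ← Real.rpow_mul (by positivity)] at h1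
    norm_num at h1
    linarith
  · rw [← Real.rpow_natCast, ← Real.rpow_mul (by positivity)]; norm_num

lemma okT_big {K T : ℕ} {s : ℝ} (hs : 2.46 ≤ s) (hK : s^12 = K) (hT : 1.375*s^8 ≤ T) : okT K 2 T = true := by
  have hs0 : 0 < s := by linarith
  have h8 : (1300:ℝ) ≤ s^8 := le_trans (by norm_num) (pow_le_pow_left₀ (by norm_num) hs 8)
  have h12 : (40000:ℝ) ≤ s^12 := le_trans (by norm_num) (pow_le_pow_left₀ (by norm_num) hs 12)
  have p := fun m => pow_le_pow_left₀ (by positivity) hT m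
  simp only [okT, Bool.and_eq_true, Nat.ble_eq, itrN]
  refine ⟨⟨⟨?_, ?_⟩, ?_⟩, ?_⟩
  · have : (30:ℝ) ≤ T := by linarith
    exact_mod_cast this
  · have : 1616*(K:ℝ) ≤ (T:ℝ)^3 := by
      refine le_trans ?_ (p 3)
      rw [← hK]
      have : (1.375*s^8)^3 = 1.375^3*(s^12*s^12) := by ring
      rw [this]; nlinarith
    exact_mod_cast this
  · have : 100000*(K:ℝ)^2 ≤ 8*(8*(T:ℝ)^2)^2 := by
      have e : 8*(8*(T:ℝ)^2)^2 = 512*(T:ℝ)^4 := by ring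
      rw [e]
      have h4 := p 4
      have : (1.375*s^8)^4 = 1.375^4*(s^8*s^24) := by ring
      rw [this] at h4
      rw [← hK]
      have h24 : 0 < s^24 := by positivity
      have : (s^12)^2 = s^24 := by ring
      rw [this]; nlinarith
    exact_mod_cast this
  · have : 6000000000*(K:ℝ)^8 ≤ (8*(8*(T:ℝ)^2)^2)^3 := by
      have e : (8*(8*(T:ℝ)^2)^2)^3 = 512^3*(T:ℝ)^12 := by ring
      rw [e]
      have h4 := p 12
      have : (1.375*s^8)^12 = 1.375^12*s^96 := by ring
      rw [this] at h4
      rw [← hK]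
      have h24 : 0 < s^96 := by positivity
      have : (s^12)^8 = s^96 := by ring
      rw [this]
      norm_num at h4 ⊢
      linarith
    exact_mod_cast this

lemma ceil32 (u : ℝ) (hu : 0 ≤ u) : ∃ T : ℕ, u ≤ ((32*T:ℕ):ℝ) ∧ ((32*T:ℕ):ℝ) ≤ u+32 := by
  refine ⟨⌈u/32⌉₊, ?_, ?_⟩
  · have := Nat.le_ceil (u/32); push_cast; linarith
  · have := Nat.ceil_lt_add_one (a := u/32) (by positivity); push_cast; linarith
lemma floor_ex (u : ℝ) (hu : 0 ≤ u) : ∃ n : ℕ, (n:ℝ) ≤ u ∧ u < n+1 := ⟨⌊u⌋₊, Nat.floor_le hu, Nat.lt_floor_add_one u⟩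

lemma B_aux {K B : ℕ} {s : ℝ} (hs : 0 < s) (hK : s^12 = K) (hB : 1.1548*s^6 < B+1) : 4*K < 3*(B+1)^2 := by
  have : 4*(K:ℝ) < 3*((B:ℝ)+1)^2 := by
    have h := pow_lt_pow_left₀ hB (by positivity) (n := 2) (by norm_num)
    have e : (1.1548*s^6)^2 = 1.1548^2*s^12 := by ring
    have : 0 < s^12 := by positivity
    rw [e] at h
    rw [← hK]; norm_num at h ⊢; linarith
  exact_mod_cast this

lemma bigN (k : ℤ) (hk : 50000 ≤ -k) : OK 2 k := by
  obtain ⟨K, rfl⟩ : ∃ K : ℕ, k = -(K:ℤ) := ⟨(-k).toNat, by omega⟩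
  have hK0 : 50000 ≤ K := by omega
  obtain ⟨s, hs, hK⟩ := root12 K hK0
  have hs0 : 0 < s := by linarith
  obtain ⟨T, t1, t2⟩ := ceil32 (1.375*s^8) (by positivity)
  obtain ⟨B, b1, b2⟩ := floor_ex (1.1548*s^6) (by positivity)
  obtain ⟨n, n1, n2⟩ := floor_ex (1.2411*s^3) (by positivity)
  obtain ⟨e, e1, e2⟩ := floor_ex (1.21*s^2) (by positivity)
  intro S hS
  have hc : chkN K K 1 mk1 0 2 T n B e 2 = true := by
    simp only [chkN, Bool.and_eq_true, Nat.ble_eq, Nat.blt_eq]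
    refine ⟨⟨⟨⟨okT_big hs hK t1, B_aux hs0 hK b2⟩, ?_⟩, ?_⟩, ?_⟩
    · have : (B:ℝ)^3 < K*((n:ℝ)+1)^2 := by
        have h := pow_lt_pow_left₀ n2 (by positivity) (n := 2) (by norm_num)
        have h' := pow_le_pow_left₀ (by positivity) b1 3
        have e : (1.1548*s^6)^3 = s^12*(1.1548^3*s^6) := by ring
        rw [e] at h'
        refine lt_of_le_of_lt h' ?_
        rw [← hK]
        refine mul_lt_mul_of_pos_left ?_ (by positivity)
        refine lt_of_le_of_lt ?_ h
        have e : (1.2411*s^3)^2 = 1.2411^2*s^6 := by ring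
        rw [e]; gcongr; norm_num
      exact_mod_cast this
    · have : 4*(K:ℝ) < ((e:ℝ)+1)^2*(2*((32*T:ℕ):ℝ)) := by
        have h := pow_lt_pow_left₀ e2 (by positivity) (n := 2) (by norm_num)
        have p8 : 0 < s^8 := by positivity
        have p12 : 0 < s^12 := by positivity
        calc 4*(K:ℝ) < (1.21*s^2)^2*(2*(1.375*s^8)) := by
              rw [← hK, show (1.21*s^2)^2*(2*(1.375*s^8)) = 1.21^2*2.75*s^12 by ring]; norm_num; linarith
          _ ≤ _ := by gcongr
      exact_mod_cast this
    · have h1 := sum32_le (smN_le K 1 mk1 0) T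
      have h2 : 2*hN K K 1 mk1 0 n B ≤ 2*(n*B)+n*(n+1) := box_le (LA_le B) (fN_le K K 1 mk1 0) n
      have h3 : 2*((32*T:ℕ):ℝ) + 9*(2*(n*B)+n*(n+1)) + 4*e+4 ≤ 2*K := by
        rw [← hK]
        have q1 : (n:ℝ)*B ≤ (1.2411*s^3)*(1.1548*s^6) := by gcongr
        have q2 : (n:ℝ)*(n+1) ≤ (1.2411*s^3)*(1.2411*s^3+1) := by gcongr
        have p3 : 14.8 ≤ s^3 := le_trans (by norm_num) (pow_le_pow_left₀ (by norm_num) hs 3)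
        have m1 : 14.8*s^9 ≤ s^12 := by rw [show s^12 = s^3*s^9 by ring]; gcongr
        have m2 : 2.46*s^8 ≤ s^9 := by rw [show s^9 = s*s^8 by ring]; gcongr
        have m3 : 14.8*s^6 ≤ s^9 := by rw [show s^9 = s^3*s^6 by ring]; gcongr
        have m4 : 14.8*s^3 ≤ s^6 := by rw [show s^6 = s^3*s^3 by ring]; gcongr
        have m5 : 2.46*s^2 ≤ s^3 := by rw [show s^3 = s*s^2 by ring]; gcongr
        clear t1 h1
        generalize ((32*T:ℕ):ℝ) = TT at t2 ⊢
        ring_nf at q1 q2 ⊢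
        linarith
      have h3' : 2*(32*T) + 9*(2*(n*B)+n*(n+1)) + 4*e+4 ≤ 2*K := by exact_mod_cast h3
      omega
  have := chkN_sound gm1 hc (-(K:ℤ)) (by simp) (by simp) (by omega) (by simp) S hS
  simpa using this

lemma bigP (k : ℤ) (hk : 50000 ≤ k) : OK 2 k := by
  obtain ⟨K, rfl⟩ : ∃ K : ℕ, k = (K:ℤ) := ⟨k.toNat, by omega⟩
  have hK0 : 50000 ≤ K := by omega
  obtain ⟨s, hs, hK⟩ := root12 K hK0
  have hs0 : 0 < s := by linarith
  obtain ⟨T, t1, t2⟩ := ceil32 (1.375*s^8) (by positivity)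
  obtain ⟨c, c1, c2⟩ := ceil32 (s^4) (by positivity)
  obtain ⟨B, b1, b2⟩ := floor_ex (1.1548*s^6) (by positivity)
  obtain ⟨n, n1, n2⟩ := floor_ex (1.7548*s^3) (by positivity)
  intro S hS
  have hc : chkP K K 1 mk1 0 2 T c n B 2 = true := by
    simp only [chkP, Bool.and_eq_true, Nat.ble_eq, Nat.blt_eq]
    refine ⟨⟨⟨⟨okT_big hs hK t1, B_aux hs0 hK b2⟩, ?_⟩, ?_⟩, ?_⟩
    · have : 256*(K:ℝ) < 27*((n:ℝ)+1)^4 := by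
        have h := pow_lt_pow_left₀ n2 (by positivity) (n := 4) (by norm_num)
        have e : (1.7548*s^3)^4 = 1.7548^4*s^12 := by ring
        have p12 : 0 < s^12 := by positivity
        rw [e] at h
        rw [← hK]
        norm_num at h ⊢
        linarith
      exact_mod_cast this
    · have : (K:ℝ) ≤ ((32*c:ℕ):ℝ)^3 := by
        have h := pow_le_pow_left₀ (by positivity) c1 3
        rw [← hK]
        calc s^12 = (s^4)^3 := by ring
          _ ≤ _ := h
      exact_mod_cast this
    · have h1 := sum32_le (f := smP 1 mk1 0) (fun x => bitm_le _ _ _) T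
      have h1' := sum32_le (smP'_le K 1 mk1 0) c
      have h2 : 2*hP K K 1 mk1 0 n B ≤ 2*(n*B)+n*(n+1) := box_le (LA_le B) (fP_le K K 1 mk1 0) n
      have h2' : 2*hP' K K 1 mk1 0 n B ≤ 2*(n*B)+n*(n+1) := box_le (LB_le B) (fP'_le K K 1 mk1 0) n
      have h3 : ((32*T:ℕ):ℝ) + ((32*c:ℕ):ℝ) + 3*(2*(n*B)+n*(n+1)) + 2 ≤ K := by
        rw [← hK]
        have q1 : (n:ℝ)*B ≤ (1.7548*s^3)*(1.1548*s^6) := by gcongr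
        have q2 : (n:ℝ)*(n+1) ≤ (1.7548*s^3)*(1.7548*s^3+1) := by gcongr
        have p3 : 14.8 ≤ s^3 := le_trans (by norm_num) (pow_le_pow_left₀ (by norm_num) hs 3)
        have m1 : 14.8*s^9 ≤ s^12 := by rw [show s^12 = s^3*s^9 by ring]; gcongr
        have m2 : 2.46*s^8 ≤ s^9 := by rw [show s^9 = s*s^8 by ring]; gcongr
        have m3 : 14.8*s^6 ≤ s^9 := by rw [show s^9 = s^3*s^6 by ring]; gcongr
        have m4 : 14.8*s^3 ≤ s^6 := by rw [show s^6 = s^3*s^3 by ring]; gcongr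
        have m5 : 5*s^4 ≤ s^6 := by rw [show s^6 = s^2*s^4 by ring]; gcongr; nlinarith
        clear t1 h1 c1 h1'
        generalize ((32*T:ℕ):ℝ) = TT at t2 ⊢
        generalize ((32*c:ℕ):ℝ) = TC at c2 ⊢
        ring_nf at q1 q2 ⊢
        linarith
      have h3' : 32*T + 32*c + 3*(2*(n*B)+n*(n+1)) + 2 ≤ K := by exact_mod_cast h3
      omega
  have := chkP_sound gm1 hc (K:ℤ) le_rfl le_rfl (by omega) (by simp) S hS
  simpa using this

end
section
set_option maxRecDepth 100000
def patB (p mask r o : ℕ) (n : ℕ) : ℕ := Nat.rec 0 (fun ρ s => s ||| (bitm p mask ((ρ+o)^3+r) <<< ρ)) n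
def repB (p q n : ℕ) : ℕ := Nat.rec q (fun i R => R*(2^(p*2^i)+1)) n
def sieveB (r o C : ℕ) (l : List (ℕ×ℕ)) : ℕ := List.rec (2^C-1) (fun e _ acc => acc &&& repB e.1 (patB e.1 e.2 r o e.1) (Nat.log2 (C/e.1)+1)) l
def tgtB (o C : ℕ) (X : List ℕ) : ℕ := List.rec 0 (fun x _ acc => bif Nat.ble o x && Nat.blt x (o+C) then acc ||| (1 <<< (x-o)) else acc) X
def bsOK (r C n : ℕ) (l : List (ℕ×ℕ)) (X : List ℕ) : Bool := allTo (fun i => Nat.beq (sieveB r (C*i) C l) (tgtB (C*i) C X)) n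

lemma patB_succ (p mask r o n : ℕ) : patB p mask r o (n+1) = patB p mask r o n ||| (bitm p mask ((n+o)^3+r) <<< n) := rfl
lemma patB_lt (p mask r o n : ℕ) : patB p mask r o n < 2^n := by
  induction n with
  | zero => simp [patB]
  | succ n ih =>
    rw [patB_succ]
    apply Nat.or_lt_two_pow
    · exact ih.trans (Nat.pow_lt_pow_right (by norm_num) (by omega))
    · have := bitm_le p mask ((n+o)^3+r)
      rw [Nat.shiftLeft_eq]
      have e : 2^(n+1) = 2^n*2 := pow_succ 2 n
      rw [e]
      have h0 : 0 < 2^n := by positivity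
      have := Nat.mul_le_mul_right (2^n) this
      omega
lemma patB_bit (p mask r o n ρ : ℕ) (h : ρ < n) (hb : bitm p mask ((ρ+o)^3+r) = 1) : (patB p mask r o n).testBit ρ = true := by
  induction n with
  | zero => omega
  | succ n ih =>
    rw [patB_succ, Nat.testBit_or, Bool.or_eq_true]
    rcases Nat.lt_succ_iff_lt_or_eq.1 h with h | rfl
    · exact Or.inl (ih h)
    · right; rw [hb]; simp
lemma repB_spec (p q : ℕ) (hq : q < 2^p) (hp : 0 < p) (n : ℕ) : repB p q n < 2^(p*2^n) ∧ ∀ x < p*2^n, q.testBit (x%p) = true → (repB p q n).testBit x = true := by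
  induction n with
  | zero =>
    refine ⟨by simpa [repB] using hq, fun x hx h => ?_⟩
    rw [Nat.mod_eq_of_lt (by simpa using hx)] at h
    exact h
  | succ n ih =>
    obtain ⟨h1, h2⟩ := ih
    have e : repB p q (n+1) = 2^(p*2^n)*repB p q n + repB p q n := by
      have : repB p q (n+1) = repB p q n*(2^(p*2^n)+1) := rfl
      rw [this]; ring
    have e2 : p*2^(n+1) = p*2^n+p*2^n := by ring
    constructor
    · rw [e, e2, pow_add]
      have : repB p q n + 1 ≤ 2^(p*2^n) := h1
      nlinarith
    · intro x hx hb
      rw [e, Nat.testBit_two_pow_mul_add _ h1]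
      split_ifs with hc
      · exact h2 x hc hb
      · refine h2 _ (by omega) ?_
        have : (x - p*2^n) % p = x % p := by
          obtain ⟨y, rfl⟩ : ∃ y, x = p*2^n+y := ⟨x-p*2^n, by omega⟩
          rw [Nat.add_sub_cancel_left, Nat.mul_add_mod]
        rw [this]; exact hb
lemma sieveB_bit {k : ℤ} {r o C : ℕ} {l : List (ℕ×ℕ)} (hl : ∀ e ∈ l, goodMask e.1 e.2 = true ∧ (e.1:ℤ) ∣ k-r) (x : ℕ) (hx : x < C) (y : ℤ) (hy : y^2 = ((x+o:ℕ):ℤ)^3+k) :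
    (sieveB r o C l).testBit x = true := by
  induction l with
  | nil => simp [sieveB, Nat.testBit_two_pow_sub_one, hx]
  | cons e l ih =>
    have e1 : sieveB r o C (e::l) = sieveB r o C l &&& repB e.1 (patB e.1 e.2 r o e.1) (Nat.log2 (C/e.1)+1) := rfl
    rw [e1, Nat.testBit_and, ih (fun e he => hl e (List.mem_cons_of_mem _ he)), Bool.true_and]
    obtain ⟨h1, h2⟩ := hl e List.mem_cons_self
    have hp := gm_pos h1
    refine (repB_spec _ _ (patB_lt _ _ _ _ _) hp _).2 x ?_ (patB_bit _ _ _ _ _ _ (Nat.mod_lt _ hp) (bit_sq h1 y ?_))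
    · have : C/e.1 < 2^(Nat.log2 (C/e.1)+1) := Nat.lt_log2_self
      have := (Nat.div_lt_iff_lt_mul hp).1 this
      rw [Nat.mul_comm] at this
      omega
    · rw [hy]
      have h3 : (e.1:ℤ) ∣ ((x+o:ℕ):ℤ) - ((x % e.1 + o:ℕ):ℤ) := by
        push_cast
        have : (x:ℤ)+o-(x%e.1+o) = x - x%e.1 := by ring
        rw [this]; exact Int.dvd_self_sub_emod
      have h4 := h3.trans (sub_dvd_pow_sub_pow _ _ 3)
      have := dvd_add h4 h2
      have e5 : ((x+o:ℕ):ℤ)^3 + k - ((((x%e.1+o)^3+r:ℕ)):ℤ) = (((x+o:ℕ):ℤ)^3 - ((x%e.1+o:ℕ):ℤ)^3) + (k-r) := by push_cast; ring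
      rw [e5]; exact this
lemma tgtB_bit {o C : ℕ} {X : List ℕ} {x : ℕ} (h : (tgtB o C X).testBit x = true) : x+o ∈ X := by
  induction X with
  | nil => simp [tgtB] at h
  | cons a X ih =>
    have e : tgtB o C (a::X) = bif Nat.ble o a && Nat.blt a (o+C) then tgtB o C X ||| (1 <<< (a-o)) else tgtB o C X := rfl
    rw [e, Bool.cond_eq_ite] at h
    split_ifs at h with hc
    · rw [Bool.and_eq_true, Nat.ble_eq, Nat.blt_eq] at hc
      rw [Nat.testBit_or, Bool.or_eq_true] at h
      rcases h with h | h
      · exact List.mem_cons_of_mem _ (ih h)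
      · rw [Nat.one_shiftLeft, Nat.testBit_two_pow] at h
        have : a - o = x := by simpa using h
        have : x+o = a := by omega
        rw [this]; exact List.mem_cons_self
    · exact List.mem_cons_of_mem _ (ih h)
lemma bsOK_sound {k : ℤ} {r C n : ℕ} {l : List (ℕ×ℕ)} {X : List ℕ} (hC : 0 < C) (h : bsOK r C n l X = true) (hl : ∀ e ∈ l, goodMask e.1 e.2 = true ∧ (e.1:ℤ) ∣ k-r)
    (x : ℕ) (hx : x < C*n) (y : ℤ) (hy : y^2 = (x:ℤ)^3+k) : x ∈ X := by
  have hi : x/C < n := by rw [Nat.div_lt_iff_lt_mul hC, Nat.mul_comm]; exact hx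
  have h1 := (allTo_iff _ _).1 h (x/C) hi
  rw [Nat.beq_eq] at h1
  have e : x%C + C*(x/C) = x := Nat.mod_add_div x C
  have h2 := sieveB_bit (o := C*(x/C)) hl (x%C) (Nat.mod_lt _ hC) y (by rw [e]; exact hy)
  rw [h1] at h2
  have := tgtB_bit h2
  rwa [e] at this
def mods : List (ℕ×ℕ) := [(64,144680414395695635), (27,38348435), (25,19483219), (49,97518889569047), (11,571), (13,5659), (17,107287), (19,199411), (23,340831), (29,332473075), (31,303908791), (37,96068509339), (41,1870503675703), (43,3678700564051), (47,4626135339999), (53,5310023542746835), (59,156326468341437115), (61,1662926210933060155), (67,61808106872519771731), (71,20052041432995567487), (73,9059857384996697084767), (79,89932533647391829339959), (83,2911111237809585785085595), (89,526807005835216593886842679), (97,152076272278209298711361952607), (101,1550432784880709368503235994227), (103,1760368345969468176824550810519), (107,50079290986288516948354744811035), (109,473022961816146413042658758988475), (113,8586949319576899938239170417650583)]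
lemma mods_good : ∀ e ∈ mods, goodMask e.1 e.2 = true := by decide +kernel
def mprod : ℕ := 64*27*25*49*11*13*17*19*23*29*31*37*41*43*47*53*59*61*67*71*73*79*83*89*97*101*103*107*109*113
lemma mods_dvd : ∀ e ∈ mods, e.1 ∣ mprod := by decide +kernel
lemma mods_ok (k : ℤ) (r : ℕ) (h : (mprod:ℤ) ∣ k - r) : ∀ e ∈ mods, goodMask e.1 e.2 = true ∧ (e.1:ℤ) ∣ k-r :=
  fun e he => ⟨mods_good e he, (Int.natCast_dvd_natCast.2 (mods_dvd e he)).trans h⟩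

end
section
set_option maxRecDepth 100000
def xN (K : ℕ) (X : List ℕ) : List ℕ := X.filter (fun x => Nat.blt K (x^3))
lemma smallN {K T C n : ℕ} {X : List ℕ} (hC : 0 < C) (hT : T ≤ C*n) (hK : K ≤ mprod) (h : bsOK (mprod-K) C n mods X = true) :
    ∃ Sm : Finset ℤ, Sm.card ≤ (xN K X).length ∧ ∀ x y : ℤ, x < T → y^2 = x^3+(-(K:ℤ)) → 0 < y → x ∈ Sm := by
  refine ⟨((xN K X).map (fun x : ℕ => (x:ℤ))).toFinset, (List.toFinset_card_le _).trans (by simp), fun x y hx hy hy0 => ?_⟩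
  have hx0 : 0 < x := by
    by_contra hx
    have : x^3 ≤ 0 := Odd.pow_nonpos (by decide) (by linarith)
    have : 0 < y^2 := by positivity
    linarith [Int.natCast_nonneg K]
  lift x to ℕ using hx0.le
  have := bsOK_sound hC h (mods_ok (-(K:ℤ)) _ ⟨-1, by rw [Nat.cast_sub hK]; ring⟩) x (by
    have : x < T := by exact_mod_cast hx
    omega) y hy
  simp only [List.mem_toFinset, List.mem_map]
  refine ⟨x, List.mem_filter.2 ⟨this, ?_⟩, rfl⟩
  rw [Nat.blt_eq]
  have : 0 < y^2 := by positivity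
  have : (K:ℤ) < (x:ℤ)^3 := by linarith
  exact_mod_cast this
lemma smallP {K T C n c : ℕ} {X : List ℕ} (hC : 0 < C) (hT : T ≤ C*n) (hc : K ≤ (32*c)^3) (h : bsOK K C n mods X = true) :
    ∃ Sm : Finset ℤ, Sm.card ≤ X.length + sum32 (smP' K 5040 mk5040 K) c ∧ ∀ x y : ℤ, x < T → y^2 = x^3+(K:ℤ) → 0 < y → x ∈ Sm := by
  refine ⟨(X.map (fun x : ℕ => (x:ℤ))).toFinset ∪ setOf32 (smP' K 5040 mk5040 K) (fun x => -(x:ℤ)) c, ?_, fun x y hx hy hy0 => ?_⟩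
  · refine (Finset.card_union_le _ _).trans (add_le_add ((List.toFinset_card_le _).trans (by simp)) (setOf32_card _ _ _))
  rw [Finset.mem_union]
  rcases le_or_gt 0 x with hx0 | hx0
  · left
    lift x to ℕ using hx0
    have := bsOK_sound hC h (mods_ok (K:ℤ) _ ⟨0, by ring⟩) x (by
      have : x < T := by exact_mod_cast hx
      omega) y hy
    simp only [List.mem_toFinset, List.mem_map]
    exact ⟨x, this, rfl⟩
  · right
    obtain ⟨z, rfl⟩ : ∃ z : ℕ, x = -(z:ℤ) := ⟨(-x).toNat, by omega⟩
    have hz3 : (z:ℤ)^3 < K := by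
      have : 0 < y^2 := by positivity
      have e : (-(z:ℤ))^3 = -(z:ℤ)^3 := by ring
      linarith
    have hz3' : z^3 < K := by exact_mod_cast hz3
    refine mem_setOf32 (X := fun x => -(x:ℤ)) z ?_ ?_
    · by_contra hc'
      push Not at hc'
      have := Nat.pow_le_pow_left hc' 3
      omega
    · have q0 : Nat.ble 1 z = true := by rw [Nat.ble_eq]; omega
      have q1 : Nat.blt (z^3) K = true := by rw [Nat.blt_eq]; exact hz3'
      simp only [smP', q0, q1, Bool.and_true, cond_true]
      rw [bit_sq gm5040 y]
      · exact one_ne_zero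
      · rw [hy]; push_cast
        have : (-(z:ℤ))^3-5039*z^3 = 5040*(-(z:ℤ)^3) := by ring
        norm_num
        rw [this]; exact dvd_mul_right _ _
def spN (K j T C n B nn δ : ℕ) (X : List ℕ) : Bool :=
  okT K j T && Nat.blt (4*K) (3*(B+1)^2) && Nat.blt (B^3) (K*(nn+1)^2) && Nat.blt (4*K) (2*T) && Nat.ble T (C*n) && Nat.blt 0 C && Nat.blt 0 K && Nat.ble K 5040 &&
  Nat.ble ((xN K X).length + 3*(j+1)*hN K K 5040 mk5040 (5040-K) nn B + δ) K && bsOK (mprod-K) C n mods X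
lemma spN_sound {K j T C n B nn δ : ℕ} {X : List ℕ} (h : spN K j T C n B nn δ X = true) : OK δ (-(K:ℤ)) := by
  simp only [spN, Bool.and_eq_true, Nat.ble_eq, Nat.blt_eq] at h
  obtain ⟨⟨⟨⟨⟨⟨⟨⟨⟨c1, c2⟩, c3⟩, c4⟩, c5⟩, c6⟩, c7⟩, c8⟩, c9⟩, c10⟩ := h
  have hmp : 5040 ≤ mprod := by decide +kernel
  obtain ⟨Sm, s1, s2⟩ := smallN c6 c5 (c8.trans hmp) c10
  intro S hS
  have := soundN_gen (e := 0) gm5040 c2 c3 (-(K:ℤ)) (by simp) (by simp) c7 ⟨-1, by rw [Nat.cast_sub c8]; push_cast; ring⟩ j T (by simpa using c4) c1 S hS Sm s2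
  simp only [Int.natAbs_neg, Int.natAbs_natCast]
  omega
def spP (K j T C n B nn δ : ℕ) (X : List ℕ) : Bool :=
  okT K j T && Nat.blt (4*K) (3*(B+1)^2) && Nat.blt (256*K) (27*(nn+1)^4) && Nat.ble T (C*n) && Nat.blt 0 C && Nat.blt 0 K && Nat.ble K 5040 &&
  Nat.ble (X.length + sum32 (smP' K 5040 mk5040 K) 1 + (j+1)*(hP K K 5040 mk5040 K nn B + hP' K K 5040 mk5040 K nn B) + δ) K && bsOK K C n mods X
lemma spP_sound {K j T C n B nn δ : ℕ} {X : List ℕ} (h : spP K j T C n B nn δ X = true) : OK δ (K:ℤ) := by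
  simp only [spP, Bool.and_eq_true, Nat.ble_eq, Nat.blt_eq] at h
  obtain ⟨⟨⟨⟨⟨⟨⟨⟨c1, c2⟩, c3⟩, c5⟩, c6⟩, c7⟩, c8⟩, c9⟩, c10⟩ := h
  obtain ⟨Sm, s1, s2⟩ := smallP c6 c5 (c := 1) (c8.trans (by norm_num)) c10
  intro S hS
  have := soundP_gen gm5040 c2 c3 (K:ℤ) le_rfl le_rfl c7 ⟨0, by ring⟩ j T c1 S hS Sm s2
  simp only [Int.natAbs_natCast]
  omega
lemma sk_m2 : OK 1 (-2) := spN_sound (K := 2) (j := 2) (T := 32) (C := 32) (n := 1) (B := 1) (nn := 0) (X := [3]) (by decide +kernel)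
lemma sk_m7 : OK 1 (-7) := spN_sound (K := 7) (j := 0) (T := 4900000) (C := 1633334) (n := 3) (B := 3) (nn := 1) (X := [2, 32]) (by decide +kernel)
lemma sk_m8 : OK 2 (-8) := spN_sound (K := 8) (j := 1) (T := 895) (C := 895) (n := 1) (B := 3) (nn := 1) (X := [2]) (by decide +kernel)
lemma sk_m11 : OK 1 (-11) := spN_sound (K := 11) (j := 1) (T := 1230) (C := 1230) (n := 1) (B := 3) (nn := 1) (X := [3, 15]) (by decide +kernel)
lemma sk_m15 : OK 1 (-15) := spN_sound (K := 15) (j := 1) (T := 1678) (C := 1678) (n := 1) (B := 4) (nn := 2) (X := [4]) (by decide +kernel)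
lemma sk_p3 : OK 1 (3) := spP_sound (K := 3) (j := 0) (T := 900000) (C := 900000) (n := 1) (B := 2) (nn := 2) (X := [1]) (by decide +kernel)
lemma sk_p4 : OK 1 (4) := spP_sound (K := 4) (j := 0) (T := 1600000) (C := 1600000) (n := 1) (B := 2) (nn := 2) (X := [0]) (by decide +kernel)
lemma sk_p5 : OK 1 (5) := spP_sound (K := 5) (j := 1) (T := 560) (C := 560) (n := 1) (B := 2) (nn := 2) (X := []) (by decide +kernel)
lemma sk_p6 : OK 1 (6) := spP_sound (K := 6) (j := 1) (T := 671) (C := 671) (n := 1) (B := 2) (nn := 2) (X := []) (by decide +kernel)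
lemma sk_p7 : OK 1 (7) := spP_sound (K := 7) (j := 1) (T := 783) (C := 783) (n := 1) (B := 3) (nn := 2) (X := []) (by decide +kernel)
lemma sk_p8 : OK 2 (8) := spP_sound (K := 8) (j := 0) (T := 6400000) (C := 1600000) (n := 4) (B := 3) (nn := 2) (X := [1, 2, 46]) (by decide +kernel)
lemma sk_p12 : OK 1 (12) := spP_sound (K := 12) (j := 1) (T := 1342) (C := 1342) (n := 1) (B := 4) (nn := 3) (X := [13]) (by decide +kernel)
lemma sk_p17 : OK 1 (17) := spP_sound (K := 17) (j := 0) (T := 28900000) (C := 2064286) (n := 14) (B := 4) (nn := 3) (X := [2, 4, 8, 43, 52, 5234]) (by decide +kernel)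
lemma sk_p33 : OK 1 (33) := spP_sound (K := 33) (j := 2) (T := 64) (C := 64) (n := 1) (B := 6) (nn := 4) (X := []) (by decide +kernel)

end
section
lemma rep_one {c d x y r s p q : ℤ} (h : RepM 1 0 c d x y p q r s) (hp : p = 1) (hq : q = 0) : x = -c := by
  obtain ⟨_, h2, h3, _⟩ := h.coeffs
  have h0 := h.det
  subst hp hq
  have hs : s = 1 := by linarith
  subst hs
  have hr : r = 0 := by linarith
  subst hr
  linarith
lemma pts_m1 {x y : ℤ} (h : y^2 = x^3+(-1)) : x = 1 := by
  rcases red_neg (by norm_num) h with ⟨y', a, b, c, d, A, g, hy, hN, h1, h2, h3⟩ | ⟨β, h1, h2, h3⟩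
  · have hA : A = 1 := by nlinarith
    subst hA
    have ha : a = 1 := by nlinarith [hN.ha]
    subst ha
    have hb : b = 0 := by linarith [hN.hb, hN.hba]
    subst hb
    have hc : c = -1 := by linarith [hN.hA]
    subst hc
    have hg : g = 0 := by
      have := hN.hk
      norm_num at this; exact this
    subst hg
    have hd : d = 0 := by linarith [hN.hg]
    subst hd
    obtain ⟨p, q, r, s, hR⟩ := hN.rep
    have h4 := hR.coeffs.1
    simp only [cub] at h4
    have h5 : p*(p^2-3*q^2) = 1 := by linarith
    rcases Int.eq_one_or_neg_one_of_mul_eq_one h5 with rfl | rfl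
    · have : q = 0 := by nlinarith
      have := rep_one hR rfl this
      linarith
    · omega
  · have hb1 : β ≤ 1 := by nlinarith [sq_nonneg (β^2-1), sq_nonneg β]
    have hb2 : -1 ≤ β := by nlinarith [sq_nonneg (β^2-1), sq_nonneg β]
    interval_cases β
    · omega
    · omega
    · omega
lemma pts_m4 {x y : ℤ} (h : y^2 = x^3+(-4)) : x = 2 ∨ x = 5 := by
  rcases red_neg (by norm_num) h with ⟨y', a, b, c, d, A, g, hy, hN, h1, h2, h3⟩ | ⟨β, h1, h2, h3⟩
  · have hA : A ≤ 2 := by nlinarith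
    have hA2 : A = 2 := by
      have := hN.ha
      interval_cases A
      · nlinarith
      · rfl
    subst hA2
    have ha : a = 1 := by nlinarith [hN.ha]
    subst ha
    have hb : b = 0 := by linarith [hN.hb, hN.hba]
    subst hb
    have hc : c = -2 := by linarith [hN.hA]
    subst hc
    have hg : g = 2 := by
      have := hN.hk
      have := hN.hg0
      nlinarith
    subst hg
    have hd : d = 4 := by linarith [hN.hg]
    subst hd
    obtain ⟨p, q, r, s, hR⟩ := hN.rep
    obtain ⟨h4, h5, h6, h7⟩ := hR.coeffs
    have h8 := hR.det
    simp only [cub] at h4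
    have h9 : (p-2*q)*(p^2+2*p*q-2*q^2) = 1 := by linarith
    left
    rcases Int.eq_one_or_neg_one_of_mul_eq_one h9 with e | e
    · have e' : p = 2*q+1 := by linarith
      subst e'
      have : q*(q+1) = 0 := by linarith
      rcases mul_eq_zero.1 this with rfl | e2
      · have := rep_one hR (by norm_num) rfl
        linarith
      · have e2 : q = -1 := by linarith
        subst e2
        have hr : r = s+1 := by linarith
        subst hr
        have hs : s = -1 := by linarith
        subst hs
        linarith
    · have e' : p = 2*q-1 := by linarith
      subst e'
      rw [e] at h9
      have : 3*(q*q-q) = -1 := by linarith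
      omega
  · have hb1 : β ≤ 1 := by nlinarith [sq_nonneg (β^2-1), sq_nonneg β, sq_nonneg (β^2-4)]
    have hb2 : -1 ≤ β := by nlinarith [sq_nonneg (β^2-1), sq_nonneg β, sq_nonneg (β^2-4)]
    interval_cases β
    · omega
    · omega
    · omega
lemma ok_list {k : ℤ} (L : List ℤ) (δ : ℕ) (hL : ∀ x y : ℤ, y^2 = x^3+k → 0 < y → x ∈ L) (h : L.length + δ ≤ k.natAbs) : OK δ k := by
  intro S hS
  have : S.card ≤ L.toFinset.card := by
    apply Finset.card_le_card_of_injOn Prod.fst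
    · intro P hP
      simp only [List.coe_toFinset, Set.mem_ofPred_eq]
      exact hL _ _ (hS P hP).1 (hS P hP).2
    · intro P hP Q hQ e
      obtain ⟨h1, h2⟩ := hS P hP
      obtain ⟨h3, h4⟩ := hS Q hQ
      refine Prod.ext e ?_
      rw [show P.1 = Q.1 from e, ← h3] at h1
      exact (sq_eq_sq₀ h2.le h4.le).1 h1
  have := L.toFinset_card_le
  omega
lemma ok_m4 : OK 2 (-4) := ok_list [2, 5] 2 (fun x y h _ => by simpa using pts_m4 h) (by decide)

lemma x3_6 {X Y : ℤ} (h : X^3+6*Y^3 = 1) : X = 1 ∧ Y = 0 := by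
  have h3 : X % 3 = 1 := by
    have : (X^3+6*Y^3)%3 = 1 := by rw [h]; rfl
    rcases (by omega : X%3 = 0 ∨ X%3 = 1 ∨ X%3 = 2) with e | e | e
    · exfalso
      have : X^3 % 3 = 0 := by rw [pow_succ, Int.mul_emod, e]; simp
      omega
    · exact e
    · exfalso
      have : X^3 % 3 = 2 := by rw [pow_succ, pow_two, Int.mul_emod, Int.mul_emod X X, e]; rfl
      omega
  obtain ⟨s, rfl⟩ : ∃ s, X = 1+3*s := ⟨X/3, by omega⟩
  have h1 : 3*(s*(3*s^2+3*s+1)) = -2*Y^3 := by linarith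
  have hY : (3:ℤ) ∣ Y := by
    have : (3:ℤ) ∣ Y^3 := by omega
    exact Int.prime_three.dvd_of_dvd_pow this
  obtain ⟨w, rfl⟩ := hY
  have h2 : s*(3*s^2+3*s+1) = -18*w^3 := by linarith
  have h18 : (18:ℤ) ∣ s := by
    have hc : IsCoprime (18:ℤ) (3*s^2+3*s+1) := by
      have c3 : IsCoprime (3:ℤ) (3*s^2+3*s+1) := ⟨-(s^2+s), 1, by ring⟩
      have c2 : IsCoprime (2:ℤ) (3*s^2+3*s+1) := by
        obtain ⟨t, ht⟩ : ∃ t, s^2+s = 2*t := by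
          obtain ⟨t, ht⟩ := Int.even_mul_succ_self s
          exact ⟨t, by linarith⟩
        exact ⟨-3*t, 1, by linarith⟩
      have : (18:ℤ) = 2*(3*3) := by norm_num
      rw [this]
      exact c2.mul_left (c3.mul_left c3)
    exact hc.dvd_of_dvd_mul_right ⟨-w^3, by linarith⟩
  obtain ⟨α, rfl⟩ := h18
  have h4 : (3*(18*α)^2+3*(18*α)+1)*α = (-w)^3 := by linarith
  have hc : IsCoprime (3*(18*α)^2+3*(18*α)+1) α := ⟨1, -(972*α+54), by ring⟩
  obtain ⟨⟨β, hβ⟩, -⟩ := Int.eq_pow_of_mul_eq_pow_odd hc (by decide) h4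
  have flt := (fermatLastTheoremFor_iff_int.1 fermatLastTheoremThree) (18*α) β (18*α+1)
  have hα : α = 0 := by
    by_contra hne
    refine flt (by omega) ?_ (by omega) (by rw [← hβ]; ring)
    rintro rfl
    have e : 972*(α^2)+54*α+1 = 0 := by linarith
    omega
  subst hα
  have : w = 0 := by
    have : w^3 = 0 := by linarith
    exact pow_eq_zero_iff (by norm_num) |>.1 this
  subst this
  constructor <;> norm_num

lemma bs9 : bsOK 9 2025000 4 mods [0, 3, 6, 40] = true := by decide +kernel
lemma sm9 : sum32 (smP' 9 5040 mk5040 9) 1 ≤ 1 := by decide +kernel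
def k9 (a A g b : ℤ) : Bool := !(decide (b < a) && decide ((b^2-A)%a = 0) && decide ((2*g-2*b^3+3*b*(b^2-A))%(a^2) = 0) && decide (g^2 = A^3+9*a^2) && decide (27*(4*9*a^2+2*A^3)^2 ≤ 16*9*(16*9-9*A^2)^2)) ||
  decide ((a,b,A,g) ∈ [((1:ℤ),(0:ℤ),(-2:ℤ),(1:ℤ)),(1,0,0,3),(1,0,3,6),(2,1,-3,3),(2,0,0,6),(3,0,0,9)])
lemma k9_all : ∀ a ∈ Finset.Icc (1:ℤ) 3, ∀ A ∈ Finset.Icc (-3:ℤ) 3, ∀ g ∈ Finset.Icc (0:ℤ) 12, ∀ b ∈ Finset.Icc (0:ℤ) 2, k9 a A g b = true := by decide +kernel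
lemma ok_9 : OK 1 9 := by
  intro S hS
  obtain ⟨Sm, s1, s2⟩ := smallP (K := 9) (T := 8100000) (c := 1) (by norm_num) (by norm_num) (by norm_num) bs9
  have hB : okT 9 0 8100000 = true := by decide +kernel
  obtain ⟨b1, b2, b3⟩ := okT_sound hB 9 (by norm_num)
  have main := total_gen (κ := Fin 3) 9 (by norm_num) 0 8100000 (by norm_num) (by norm_num) (by exact_mod_cast b3) S hS Finset.univ
    ![(1,0,2,2), (1,0,-3,12), (2,0,0,3)] Sm (fun P hP hT => s2 P.1 P.2 (by exact_mod_cast hT) (hS P hP).1 (hS P hP).2) ∅ ?_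
  · have e : zz 9 = 1 := by norm_num [zz]
    rw [e] at main
    simp at main s1
    have := sm9
    show S.card + 1 ≤ 9
    omega
  intro P hP hT
  left
  obtain ⟨y', a, b, c, d, A, g, hy, hN, h1, h2, h3⟩ := red_pos (by norm_num) (by linarith) (hS P hP).1
  have ha : a ≤ 3 := by
    by_contra hc
    have : 4 ≤ a := by linarith
    have := pow_le_pow_left₀ (by norm_num) this 4
    linarith
  have ha1 := hN.ha
  have hA1 : A ≤ 3 := by nlinarith
  have hA2 : -3 ≤ A := by nlinarith
  have hb := hN.hb
  have hba := hN.hba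
  have hg0 := hN.hg0
  have hg1 : g ≤ 12 := by
    have := hN.hk
    have : A^3 ≤ 27 := by
      have := Odd.pow_le_pow (n := 3) (by decide) |>.2 hA1
      linarith
    nlinarith
  have hA := hN.hA
  have hg := hN.hg
  have key := k9_all a (Finset.mem_Icc.2 ⟨ha1, ha⟩) A (Finset.mem_Icc.2 ⟨hA2, hA1⟩) g (Finset.mem_Icc.2 ⟨hg0, hg1⟩) b (Finset.mem_Icc.2 ⟨hb, by linarith⟩)
  have q2 : (b^2-A)%a = 0 := Int.emod_eq_zero_of_dvd ⟨c, by rw [hA]; ring⟩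
  have q3 : (2*g-2*b^3+3*b*(b^2-A))%(a^2) = 0 := Int.emod_eq_zero_of_dvd ⟨d, by rw [hA]; linarith⟩
  simp only [k9, decide_eq_true hba, decide_eq_true q2, decide_eq_true q3, decide_eq_true hN.hk, decide_eq_true h3, Bool.and_true, Bool.not_true, Bool.false_or,
    decide_eq_true_eq, List.mem_cons, List.not_mem_nil, or_false, Prod.mk.injEq] at key
  obtain ⟨p, q, r, s, hR⟩ := hN.rep
  rcases key with ⟨rfl, rfl, rfl, rfl⟩ | ⟨rfl, rfl, rfl, rfl⟩ | ⟨rfl, rfl, rfl, rfl⟩ | ⟨rfl, rfl, rfl, rfl⟩ | ⟨rfl, rfl, rfl, rfl⟩ | ⟨rfl, rfl, rfl, rfl⟩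
  · obtain rfl : c = 2 := by linarith
    obtain rfl : d = 2 := by linarith
    exact ⟨0, Finset.mem_univ _, y', hy, p, q, r, s, hR⟩
  · obtain rfl : c = 0 := by linarith
    obtain rfl : d = 6 := by linarith
    have h4 := hR.coeffs.1
    simp only [cub] at h4
    obtain ⟨e1, e2⟩ := x3_6 (X := p) (Y := q) (by linarith)
    have := rep_one hR e1 e2
    linarith
  · obtain rfl : c = -3 := by linarith
    obtain rfl : d = 12 := by linarith
    exact ⟨1, Finset.mem_univ _, y', hy, p, q, r, s, hR⟩
  · obtain rfl : c = 2 := by linarith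
    obtain rfl : d = 4 := by linarith
    refine ⟨1, Finset.mem_univ _, y', hy, 2*p+q, p+q, 2*r+s, r+s, by linarith [hR.det], fun X Y => ?_⟩
    rw [← hR.eq]
    simp only [cub, Matrix.cons_val_one, Matrix.cons_val_zero]
    ring
  · obtain rfl : c = 0 := by linarith
    obtain rfl : d = 3 := by linarith
    exact ⟨2, Finset.mem_univ _, y', hy, p, q, r, s, hR⟩
  · obtain rfl : c = 0 := by linarith
    obtain rfl : d = 2 := by linarith
    refine ⟨2, Finset.mem_univ _, -y', by rcases hy with rfl | rfl <;> simp, q, p, -s, -r, by linarith [hR.det], fun X Y => ?_⟩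
    have := hR.eq X (-Y)
    simp only [cub] at this ⊢
    simp
    linarith


end
section
@[ext] structure Cu where
  a : ℤ
  b : ℤ
  c : ℤ
namespace Cu
instance : Zero Cu := ⟨⟨0,0,0⟩⟩
instance : One Cu := ⟨⟨1,0,0⟩⟩
instance : Add Cu := ⟨fun x y => ⟨x.a+y.a, x.b+y.b, x.c+y.c⟩⟩
instance : Neg Cu := ⟨fun x => ⟨-x.a, -x.b, -x.c⟩⟩
instance : Mul Cu := ⟨fun x y => ⟨x.a*y.a-2*(x.b*y.c+x.c*y.b), x.a*y.b+x.b*y.a-3*(x.b*y.c+x.c*y.b)-2*(x.c*y.c), x.a*y.c+x.b*y.b+x.c*y.a-3*(x.c*y.c)⟩⟩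
lemma zero_def : (0:Cu) = ⟨0,0,0⟩ := rfl
lemma one_def : (1:Cu) = ⟨1,0,0⟩ := rfl
lemma add_def (x y : Cu) : x+y = ⟨x.a+y.a, x.b+y.b, x.c+y.c⟩ := rfl
lemma neg_def (x : Cu) : -x = ⟨-x.a, -x.b, -x.c⟩ := rfl
lemma mul_def (x y : Cu) : x*y = ⟨x.a*y.a-2*(x.b*y.c+x.c*y.b), x.a*y.b+x.b*y.a-3*(x.b*y.c+x.c*y.b)-2*(x.c*y.c), x.a*y.c+x.b*y.b+x.c*y.a-3*(x.c*y.c)⟩ := rfl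
instance : CommRing Cu where
  add_assoc x y z := by simp only [add_def, add_assoc]
  zero_add x := by ext <;> simp [add_def, zero_def]
  add_zero x := by ext <;> simp [add_def, zero_def]
  add_comm x y := by ext <;> simp only [add_def] <;> ring
  neg_add_cancel x := by ext <;> simp [add_def, neg_def, zero_def]
  mul_assoc x y z := by ext <;> simp only [mul_def] <;> ring
  mul_comm x y := by ext <;> simp only [mul_def] <;> ring
  one_mul x := by ext <;> simp only [mul_def, one_def] <;> ring
  mul_one x := by ext <;> simp only [mul_def, one_def] <;> ring
  left_distrib x y z := by ext <;> simp only [mul_def, add_def] <;> ring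
  right_distrib x y z := by ext <;> simp only [mul_def, add_def] <;> ring
  zero_mul x := by ext <;> simp only [mul_def, zero_def] <;> ring
  mul_zero x := by ext <;> simp only [mul_def, zero_def] <;> ring
  nsmul := nsmulRec
  zsmul := zsmulRec
  natCast n := ⟨n,0,0⟩
  natCast_zero := rfl
  natCast_succ n := by ext <;> simp [add_def, one_def]
  intCast n := ⟨n,0,0⟩
  intCast_ofNat n := rfl
  intCast_negSucc n := rfl
lemma cast_def (n : ℤ) : (n:Cu) = ⟨n,0,0⟩ := rfl
lemma c_smul (n : ℤ) (x : Cu) : ((n:Cu)*x).c = n*x.c := by simp [mul_def, cast_def]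
lemma c_add (x y : Cu) : (x+y).c = x.c+y.c := rfl
lemma c_one : (1:Cu).c = 0 := rfl
lemma pow_one_add (x : Cu) (m : ℕ) : ∃ B, (1+x)^m = 1+((m:ℤ):Cu)*x+x^2*B := by
  induction m with
  | zero => exact ⟨0, by simp⟩
  | succ m ih =>
    obtain ⟨B, hB⟩ := ih
    refine ⟨B+x*B+((m:ℤ):Cu), ?_⟩
    rw [pow_succ, hB]; push_cast; ring
lemma skolem (e ξ : Cu) (h3 : e^3 = 1+((3:ℤ):Cu)*ξ) (hξ : ¬ (3:ℤ) ∣ ξ.c) (h1 : ¬ (3:ℤ) ∣ e.c) (h2 : ¬ (3:ℤ) ∣ (e^2).c) (n : ℕ) (h : (e^n).c = 0) : n = 0 := by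
  obtain ⟨m, i, hi, rfl⟩ : ∃ m i, i < 3 ∧ n = 3*m+i := ⟨n/3, n%3, Nat.mod_lt _ (by norm_num), by omega⟩
  have hm : ∃ B, e^(3*m) = 1+((3:ℤ):Cu)*B := by
    obtain ⟨B, hB⟩ := pow_one_add (((3:ℤ):Cu)*ξ) m
    refine ⟨((m:ℤ):Cu)*ξ+((3:ℤ):Cu)*ξ^2*B, ?_⟩
    rw [pow_mul, h3, hB]; ring
  obtain ⟨B, hB⟩ := hm
  have h4 : (e^i).c + 3*(B*e^i).c = 0 := by
    rw [← h, pow_add, hB, ← c_smul, ← c_add]; congr 1; ring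
  obtain rfl : i = 0 := by
    interval_cases i
    · rfl
    · rw [pow_one] at h4; omega
    · omega
  rw [Nat.add_zero] at h ⊢
  by_contra hn
  obtain ⟨s, m', hm', rfl⟩ := Nat.exists_eq_pow_mul_and_not_dvd (n := m) (by omega) 3 (by norm_num)
  have key : ∀ s : ℕ, ∃ A : Cu, (e^3)^(3^s) = 1+((3^(s+1):ℤ):Cu)*A ∧ ¬ (3:ℤ) ∣ A.c := by
    intro s
    induction s with
    | zero => exact ⟨ξ, by rw [pow_zero, pow_one, h3]; rfl, hξ⟩
    | succ s ih =>
      obtain ⟨A, hA, hc⟩ := ih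
      refine ⟨A + ((3:ℤ):Cu)*(((3^s:ℤ):Cu)*A^2+((3^s:ℤ):Cu)^2*A^3), ?_, ?_⟩
      · rw [pow_succ 3 s, pow_mul, hA]; push_cast; ring
      · rw [c_add, c_smul]; omega
  obtain ⟨A, hA, hc⟩ := key s
  obtain ⟨D, hD⟩ := pow_one_add (((3^(s+1):ℤ):Cu)*A) m'
  rw [← hA, ← pow_mul, ← pow_mul, ← mul_assoc] at hD
  have e1 : (e^(3*3^s*m')) = 1 + ((3^(s+1):ℤ):Cu)*(((m':ℤ):Cu)*A + ((3:ℤ):Cu)*(((3^s:ℤ):Cu)*A^2*D)) := by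
    rw [hD]; push_cast; ring
  rw [← mul_assoc, e1, c_add, c_smul, c_one, c_add, c_smul, c_smul, zero_add] at h
  have h5 := (mul_eq_zero.1 h).resolve_left (by positivity)
  have : (3:ℤ) ∣ m'*A.c := ⟨-(((3^s:ℤ):Cu)*A^2*D).c, by linarith⟩
  rcases Int.prime_three.dvd_or_dvd this with h6 | h6
  · exact hm' (by exact_mod_cast h6)
  · exact hc h6
def N (x : Cu) : ℤ := x.a^3-6*x.a^2*x.c+9*x.a*x.c^2+3*x.a*x.b^2+6*x.a*x.b*x.c-2*x.b^3-6*x.b*x.c^2+4*x.c^3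
lemma N_mul (x y : Cu) : N (x*y) = N x * N y := by simp only [N, mul_def]; ring
lemma N_pow (x : Cu) (hx : N x = 1) (n : ℕ) : N (x^n) = 1 := by
  induction n with
  | zero => rfl
  | succ n ih => rw [pow_succ, N_mul, ih, hx]; rfl
def eta : Cu := ⟨1,1,-1⟩
def zet : Cu := ⟨17,-3,5⟩
instance : DecidableEq Cu := fun x y => decidable_of_iff (x.a = y.a ∧ x.b = y.b ∧ x.c = y.c) ⟨fun h => Cu.ext h.1 h.2.1 h.2.2, fun h => by subst h; simp⟩
lemma ez : eta*zet = 1 := by decide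
def ev (t : ℝ) (ht : t^3+3*t+2 = 0) : Cu →+* ℝ where
  toFun x := x.a+x.b*t+x.c*t^2
  map_one' := by simp [one_def]
  map_zero' := by simp [zero_def]
  map_add' x y := by simp only [add_def]; push_cast; ring
  map_mul' x y := by
    simp only [mul_def]; push_cast
    linear_combination (-(x.b*y.c+x.c*y.b+x.c*y.c*t:ℝ))*ht
lemma exists_root : ∃ t : ℝ, t^3+3*t+2 = 0 ∧ -0.597 < t ∧ t < -0.596 := by
  have := intermediate_value_Ioo (a := (-0.597:ℝ)) (b := -0.596) (f := fun t => t^3+3*t+2) (by norm_num) (by fun_prop)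
  obtain ⟨t, ⟨h1, h2⟩, h3⟩ := this (show (0:ℝ) ∈ _ by constructor <;> norm_num)
  exact ⟨t, h3, h1, h2⟩
lemma enumC : ∀ c ∈ Finset.Icc (0:ℤ) 6, ∀ b ∈ Finset.Icc (-6:ℤ) 0, ∀ a ∈ Finset.Icc (-30:ℤ) 40, 1000*b ≤ 580-596*c → -580-597*c ≤ 1000*b → N ⟨a,b,c⟩ = 1 → (a,b,c) = (1,0,0) ∨ (a,b,c) = (17,-3,5) := by decide +kernel
lemma aux1 {v Q : ℝ} (h : v*Q = 1) (hv : 1 ≤ v) (hQ : 0 ≤ Q) : Q ≤ 1 := by nlinarith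
lemma aux2 {e : ℝ} (h : 3*e^2 ≤ 1) : e ≤ 0.58 ∧ -0.58 ≤ e := ⟨by nlinarith, by nlinarith⟩
lemma aux3 {e t : ℝ} (h1 : e ≤ 0.58) (h2 : -0.58 ≤ e) (h3 : -0.597 < t) (h4 : t < -0.596) : e*t ≤ 0.36 ∧ -0.36 ≤ e*t := ⟨by nlinarith, by nlinarith⟩
lemma aux4 {c u : ℝ} (h1 : 4 ≤ u) (h2 : -0.6 ≤ c*u) (h3 : c*u ≤ 24) : -1 < c ∧ c < 7 := ⟨by nlinarith, by nlinarith⟩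
lemma aux5 {b c t : ℝ} (h1 : b-c*t ≤ 0.58) (h2 : -0.58 ≤ b-c*t) (h3 : -0.597 < t) (h4 : t < -0.596) (hc : 0 ≤ c) : 1000*b ≤ 580-596*c ∧ -580-597*c ≤ 1000*b :=
  ⟨by nlinarith, by nlinarith⟩
lemma aux6 {b t : ℝ} (h1 : b ≤ 0) (h2 : -5 ≤ b) (h3 : -0.597 < t) (h4 : t < -0.596) : b*t ≤ 4 ∧ 0 ≤ b*t := ⟨by nlinarith, by nlinarith⟩
lemma base (t : ℝ) (ht : t^3+3*t+2 = 0) (h1 : -0.597 < t) (h2 : t < -0.596) (w : Cu) (hN : N w = 1) (hw : 1 ≤ ev t ht w) (hw2 : ev t ht w ≤ 22) : w = 1 ∨ w = zet := by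
  obtain ⟨a, b, c⟩ := w
  have hv : ev t ht ⟨a,b,c⟩ = a+b*t+c*t^2 := rfl
  rw [hv] at hw hw2
  have t1 : 0.355 ≤ t^2 := by nlinarith
  have t2 : t^2 ≤ 0.357 := by nlinarith
  have hNR : (a:ℝ)^3-6*a^2*c+9*a*c^2+3*a*b^2+6*a*b*c-2*b^3-6*b*c^2+4*c^3 = 1 := by exact_mod_cast hN
  have hprod : (a+b*t+c*t^2:ℝ)*((a-b*t/2-c*(t^2/2+3))^2+(3+3*t^2/4)*(b-c*t)^2) = 1 := by
    linear_combination hNR + (c^3*t^3+3*c^3*t-3*a*b*c+b^3+3*b*c^2-2*c^3:ℝ)*ht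
  set R : ℝ := a-b*t/2-c*(t^2/2+3) with hR
  set e : ℝ := b-c*t with he
  have hQ0 : 0 ≤ R^2+(3+3*t^2/4)*e^2 := by positivity
  have hQ := aux1 hprod hw hQ0
  have hte := mul_nonneg (sq_nonneg t) (sq_nonneg e)
  have he2 : 3*e^2 ≤ 1 := by linarith [sq_nonneg R]
  have hR2 : R^2 ≤ 1 := by linarith [sq_nonneg e]
  obtain ⟨e1, e2⟩ := aux2 he2
  obtain ⟨r2, r1⟩ := abs_le.1 ((sq_le_one_iff_abs_le_one R).1 hR2)
  have hdiff : (a+b*t+c*t^2:ℝ) - R = c*(3+3*t^2)+1.5*(e*t) := by rw [hR, he]; ring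
  obtain ⟨et1, et2⟩ := aux3 e1 e2 h1 h2
  obtain ⟨hc0, hc6⟩ := aux4 (c := (c:ℝ)) (u := 3+3*t^2) (by linarith) (by linarith) (by linarith)
  have hc0' : -1 < c := by exact_mod_cast hc0
  have hc6' : c < 7 := by exact_mod_cast hc6
  have hcn : (0:ℝ) ≤ c := by exact_mod_cast (by omega : 0 ≤ c)
  obtain ⟨hb1, hb2⟩ := aux5 e1 e2 h1 h2 hcn
  have hb1' : 1000*b ≤ 580-596*c := by exact_mod_cast hb1
  have hb2' : -580-597*c ≤ 1000*b := by exact_mod_cast hb2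
  have hbn : (b:ℝ) ≤ 0 := by exact_mod_cast (by omega : b ≤ 0)
  have hb5 : (-5:ℝ) ≤ b := by exact_mod_cast (by omega : -5 ≤ b)
  obtain ⟨hbt1, hbt2⟩ := aux6 hbn hb5 h1 h2
  have hct1 : 0 ≤ (c:ℝ)*t^2 := by positivity
  have hct2 : (c:ℝ)*t^2 ≤ 7*0.357 := by gcongr
  have ha1 : (-30:ℝ) ≤ a := by linarith
  have ha2 : (a:ℝ) ≤ 40 := by linarith
  have ha1' : -30 ≤ a := by exact_mod_cast ha1
  have ha2' : a ≤ 40 := by exact_mod_cast ha2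
  rcases enumC c (Finset.mem_Icc.2 ⟨by omega, by omega⟩) b (Finset.mem_Icc.2 ⟨by omega, by omega⟩) a (Finset.mem_Icc.2 ⟨ha1', ha2'⟩) hb1' hb2' hN with h | h
  · left; simp only [Prod.mk.injEq] at h; obtain ⟨rfl, rfl, rfl⟩ := h; rfl
  · right; simp only [Prod.mk.injEq] at h; obtain ⟨rfl, rfl, rfl⟩ := h; rfl
lemma units (w : Cu) (hN : N w = 1) : ∃ n : ℕ, w = eta^n ∨ w = zet^n := by
  obtain ⟨t, ht, h1, h2⟩ := exists_root
  have t1 : 0.355 ≤ t^2 := by nlinarith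
  have t2 : t^2 ≤ 0.357 := by nlinarith
  have hz1 : 1 < ev t ht zet := by
    have : ev t ht zet = ((17:ℤ):ℝ)+((-3:ℤ):ℝ)*t+((5:ℤ):ℝ)*t^2 := rfl
    rw [this]; push_cast; linarith
  have hz2 : ev t ht zet ≤ 22 := by
    have : ev t ht zet = ((17:ℤ):ℝ)+((-3:ℤ):ℝ)*t+((5:ℤ):ℝ)*t^2 := rfl
    rw [this]; push_cast; linarith
  have hez : ev t ht eta * ev t ht zet = 1 := by rw [← map_mul, ez, map_one]
  have hpow : ∀ n : ℕ, (eta)^n*zet^n = 1 := fun n => by rw [← mul_pow, ez, one_pow]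
  have hpowR : ∀ n : ℕ, (ev t ht eta)^n*(ev t ht zet)^n = 1 := fun n => by rw [← mul_pow, hez, one_pow]
  have he0 : 0 < ev t ht eta := by
    by_contra h; nlinarith
  have hw : 0 < ev t ht w := by
    obtain ⟨a, b, c⟩ := w
    have hv : ev t ht ⟨a,b,c⟩ = a+b*t+c*t^2 := rfl
    rw [hv]
    have hNR : (a:ℝ)^3-6*a^2*c+9*a*c^2+3*a*b^2+6*a*b*c-2*b^3-6*b*c^2+4*c^3 = 1 := by exact_mod_cast hN
    have hprod : (a+b*t+c*t^2:ℝ)*((a-b*t/2-c*(t^2/2+3))^2+(3+3*t^2/4)*(b-c*t)^2) = 1 := by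
      linear_combination hNR + (c^3*t^3+3*c^3*t-3*a*b*c+b^3+3*b*c^2-2*c^3:ℝ)*ht
    by_contra h
    have : 0 ≤ (a-b*t/2-c*(t^2/2+3):ℝ)^2+(3+3*t^2/4)*(b-c*t)^2 := by positivity
    nlinarith
  rcases le_or_gt 1 (ev t ht w) with h | h
  · obtain ⟨n, n1, n2⟩ := exists_nat_pow_near h hz1
    have hp : 0 < (ev t ht eta)^n := by positivity
    have hb := base t ht h1 h2 (w*eta^n) (by rw [N_mul, hN, N_pow eta rfl]; rfl) (by
      rw [map_mul, map_pow, ← hpowR n, mul_comm]; gcongr) (by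
      rw [map_mul, map_pow]
      have : ev t ht w * (ev t ht eta)^n ≤ (ev t ht zet)^(n+1) * (ev t ht eta)^n := by gcongr
      have e : (ev t ht zet)^(n+1) * (ev t ht eta)^n = ev t ht zet := by
        rw [pow_succ]; linear_combination (ev t ht zet)*(hpowR n)
      linarith)
    rcases hb with hb | hb
    · exact ⟨n, Or.inr (by linear_combination zet^n*hb - w*hpow n)⟩
    · exact ⟨n+1, Or.inr (by rw [pow_succ]; linear_combination zet^n*hb - w*hpow n)⟩
  · have he1 : ev t ht eta < 1 := by by_contra h; nlinarith
    obtain ⟨n, n1, n2⟩ := exists_nat_pow_near_of_lt_one hw h.le he0 he1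
    have hp : 0 < (ev t ht zet)^(n+1) := by positivity
    have hb := base t ht h1 h2 (w*zet^(n+1)) (by rw [N_mul, hN, N_pow zet rfl]; rfl) (by
      rw [map_mul, map_pow, ← hpowR (n+1)]; gcongr) (by
      rw [map_mul, map_pow]
      have : ev t ht w * (ev t ht zet)^(n+1) ≤ (ev t ht eta)^n * (ev t ht zet)^(n+1) := by gcongr
      have e : (ev t ht eta)^n * (ev t ht zet)^(n+1) = ev t ht zet := by
        rw [pow_succ]; linear_combination (ev t ht zet)*(hpowR n)
      linarith)
    rcases hb with hb | hb
    · exact ⟨n+1, Or.inl (by linear_combination eta^(n+1)*hb - w*hpow (n+1))⟩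
    · exact ⟨n, Or.inl (by
        have := hpow (n+1)
        rw [pow_succ eta, pow_succ zet] at this
        rw [pow_succ zet] at hb
        linear_combination eta^n*eta*hb - w*this + eta^n*ez)⟩
lemma c_zero (w : Cu) (hN : N w = 1) (hc : w.c = 0) : w = 1 := by
  obtain ⟨n, h | h⟩ := units w hN
  · rw [h] at hc
    have := skolem eta ⟨8,11,-5⟩ (by decide) (by decide) (by decide) (by decide) n hc
    rw [h, this, pow_zero]
  · rw [h] at hc
    have := skolem zet ⟨2392,-425,713⟩ (by decide) (by decide) (by decide) (by decide) n hc
    rw [h, this, pow_zero]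
end Cu
lemma thue2 {p q : ℤ} (h : p^3+3*p*q^2+2*q^3 = 1) : p = 1 ∧ q = 0 := by
  have := Cu.c_zero ⟨p, -q, 0⟩ (by simp only [Cu.N]; linarith) rfl
  rw [Cu.one_def, Cu.mk.injEq] at this
  exact ⟨this.1, by omega⟩
lemma pts_2 {x y : ℤ} (h : y^2 = x^3+2) (hy : 0 < y) : x = -1 := by
  rcases lt_or_ge 0 x with hx | hx
  · exfalso
    obtain ⟨y', a, b, c, d, A, g, hy, hN, h1, h2, h3⟩ := red_pos (by norm_num) hx h
    have ha : a ≤ 2 := by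
      by_contra hc
      have : 3 ≤ a := by linarith
      have := pow_le_pow_left₀ (by norm_num) this 4
      linarith
    have ha1 := hN.ha
    have hA1 : A ≤ 1 := by nlinarith
    have hA2 : -1 ≤ A := by nlinarith
    have hg0 := hN.hg0
    have hk := hN.hk
    have hg1 : g ≤ 3 := by
      have : A^3 ≤ 1 := by
        have := Odd.pow_le_pow (n := 3) (by decide) |>.2 hA1
        linarith
      nlinarith
    have key : a = 1 ∧ A = -1 ∧ g = 1 := by
      interval_cases a <;> interval_cases A <;> interval_cases g <;> omega
    obtain ⟨rfl, rfl, rfl⟩ := key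
    obtain rfl : b = 0 := by linarith [hN.hb, hN.hba]
    obtain rfl : c = 1 := by linarith [hN.hA]
    obtain rfl : d = 2 := by linarith [hN.hg]
    obtain ⟨p, q, r, s, hR⟩ := hN.rep
    have h4 := hR.coeffs.1
    simp only [cub] at h4
    obtain ⟨e1, e2⟩ := thue2 (p := p) (q := q) (by linarith)
    have := rep_one hR e1 e2
    linarith
  · have hx2 : -2 < x := by
      by_contra hc
      have : x ≤ -2 := by linarith
      have := Odd.pow_le_pow (n := 3) (by decide) |>.2 this
      nlinarith
    have : y ≤ 1 := by
      have : x^3 ≤ 0 := Odd.pow_nonpos (by decide) hx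
      nlinarith
    interval_cases x
    · rfl
    · interval_cases y
      omega
lemma ok_2 : OK 1 2 := ok_list [-1] 1 (fun x y h h0 => by simpa using pts_2 h h0) (by decide)

end
section
def Mset (k : ℤ) : Set (ℤ×ℤ) := {p : ℤ×ℤ | p.2^2 = p.1^3 + k}
lemma mset_card {k : ℤ} (hf : (Mset k).Finite) : ∃ S : Finset (ℤ×ℤ), Pts k S ∧ (Mset k).ncard ≤ 2*S.card + 1 ∧ ((∀ x : ℤ, x^3 ≠ -k) → (Mset k).ncard ≤ 2*S.card) := by
  classical
  set F := hf.toFinset with hF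
  have hmem : ∀ P, P ∈ F ↔ P.2^2 = P.1^3+k := fun P => by rw [hF, Set.Finite.mem_toFinset]; rfl
  have hcard : (Mset k).ncard = F.card := Set.ncard_eq_toFinset_card _ hf
  let S := F.filter (fun P => 0 < P.2)
  let S' := F.filter (fun P => P.2 < 0)
  let Z := F.filter (fun P => P.2 = 0)
  have hcov : F ⊆ (S ∪ S') ∪ Z := by
    intro P hP
    simp only [S, S', Z, Finset.mem_union, Finset.mem_filter]
    rcases lt_trichotomy P.2 0 with h | h | h <;> simp [hP, h]
  have c1 : F.card ≤ S.card + S'.card + Z.card :=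
    (Finset.card_le_card hcov).trans ((Finset.card_union_le _ _).trans (Nat.add_le_add_right (Finset.card_union_le _ _) _))
  have c2 : S'.card ≤ S.card := by
    apply Finset.card_le_card_of_injOn (fun P => (P.1, -P.2))
    · intro P hP
      have hP := Finset.mem_filter.1 hP
      refine Finset.mem_coe.2 (Finset.mem_filter.2 ⟨(hmem _).2 ?_, ?_⟩)
      · have := (hmem _).1 hP.1
        simpa using this
      · have := hP.2
        simpa using this
    · intro P _ Q _ e
      simp only [Prod.mk.injEq, neg_inj] at e
      exact Prod.ext e.1 e.2
  have hz : ∀ P ∈ Z, P.1^3 = -k ∧ P.2 = 0 := by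
    intro P hP
    have hP := Finset.mem_filter.1 hP
    have := (hmem _).1 hP.1
    rw [hP.2] at this
    exact ⟨by linarith, hP.2⟩
  refine ⟨S, fun P hP => ?_, ?_, fun hn => ?_⟩
  · have hP := Finset.mem_filter.1 hP
    exact ⟨(hmem _).1 hP.1, hP.2⟩
  · have : Z.card ≤ 1 := by
      rw [Finset.card_le_one]
      intro P hP Q hQ
      obtain ⟨a1, a2⟩ := hz P hP
      obtain ⟨b1, b2⟩ := hz Q hQ
      refine Prod.ext ?_ (by rw [a2, b2])
      exact Odd.pow_injective (n := 3) (by decide) (a1.trans b1.symm)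
    omega
  · have : Z = ∅ := by
      rw [Finset.eq_empty_iff_forall_notMem]
      intro P hP
      exact hn _ (hz P hP).1
    rw [this, Finset.card_empty] at c1
    omega
lemma fin2 {k : ℤ} (h : OK 2 k) : (Mset k).ncard + 1 < 2*k.natAbs := by
  have h0 := h ∅ (fun P hP => by simp at hP)
  rw [Finset.card_empty] at h0
  by_cases hf : (Mset k).Finite
  · obtain ⟨S, h1, h2, _⟩ := mset_card hf
    have := h S h1
    omega
  · rw [Set.Infinite.ncard hf]; omega
lemma fin1 {k : ℤ} (h : OK 1 k) (hl : -64 < k) (hu : k < 64) (hc : ∀ x ∈ Finset.Icc (-4:ℤ) 4, x^3 ≠ -k) : (Mset k).ncard + 1 < 2*k.natAbs := by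
  have h0 := h ∅ (fun P hP => by simp at hP)
  rw [Finset.card_empty] at h0
  by_cases hf : (Mset k).Finite
  · obtain ⟨S, h1, _, h2⟩ := mset_card hf
    have := h S h1
    have := h2 (fun x hx => hc x (by
      rw [Finset.mem_Icc]
      constructor
      · by_contra hh
        have := Odd.pow_le_pow (n := 3) (by decide) |>.2 (by linarith : x ≤ -4)
        linarith
      · by_contra hh
        have := Odd.pow_le_pow (n := 3) (by decide) |>.2 (by linarith : 4 ≤ x)
        linarith) hx)
    omega
  · rw [Set.Infinite.ncard hf]; omega
lemma bm4 : (Mset (-4)).ncard + 1 < 2*Int.natAbs (-4) := fin2 ok_m4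
lemma exN : ∀ K ∈ Finset.range 150, 5 ≤ K → K = 7 ∨ K = 8 ∨ K = 11 ∨ K = 12 ∨ K = 15 ∨ (0x999e >>> K)%2 = 0 := by decide +kernel
lemma exP : ∀ K ∈ Finset.range 432, 10 ≤ K → K = 12 ∨ K = 16 ∨ K = 17 ∨ K = 33 ∨ (0x2000313fe >>> K)%2 = 0 := by decide +kernel
lemma mainN (K : ℕ) (h2 : 2 ≤ K) : (Mset (-(K:ℤ))).ncard + 1 < 2*(-(K:ℤ)).natAbs := by
  rcases le_or_gt 50000 K with h | h
  · exact fin2 (bigN _ (by omega))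
  rcases le_or_gt 150 K with h' | h'
  · exact fin2 (midN _ (by omega) (by omega))
  rcases le_or_gt 5 K with h5 | h5
  · rcases exN K (Finset.mem_range.2 h') h5 with rfl | rfl | rfl | rfl | rfl | hx
    · exact fin1 sk_m7 (by norm_num) (by norm_num) (by decide)
    · exact fin2 sk_m8
    · exact fin1 sk_m11 (by norm_num) (by norm_num) (by decide)
    · exact fin1 ok_m12 (by norm_num) (by norm_num) (by decide)
    · exact fin1 sk_m15 (by norm_num) (by norm_num) (by decide)
    · exact fin2 (lowN K h5 h' hx)
  · interval_cases K
    · exact fin1 sk_m2 (by norm_num) (by norm_num) (by decide)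
    · exact fin1 ok_m3 (by norm_num) (by norm_num) (by decide)
    · exact fin2 ok_m4
lemma mainP (K : ℕ) (h2 : 2 ≤ K) : (Mset (K:ℤ)).ncard + 1 < 2*(K:ℤ).natAbs := by
  rcases le_or_gt 50000 K with h | h
  · exact fin2 (bigP _ (by omega))
  rcases le_or_gt 432 K with h' | h'
  · exact fin2 (midP _ (by omega) (by omega))
  rcases le_or_gt 10 K with h5 | h5
  · rcases exP K (Finset.mem_range.2 h') h5 with rfl | rfl | rfl | rfl | hx
    · exact fin1 sk_p12 (by norm_num) (by norm_num) (by decide)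
    · exact fin1 ok_16 (by norm_num) (by norm_num) (by decide)
    · exact fin1 sk_p17 (by norm_num) (by norm_num) (by decide)
    · exact fin1 sk_p33 (by norm_num) (by norm_num) (by decide)
    · exact fin2 (lowP K h5 h' hx)
  · interval_cases K
    · exact fin1 ok_2 (by norm_num) (by norm_num) (by decide)
    · exact fin1 sk_p3 (by norm_num) (by norm_num) (by decide)
    · exact fin1 sk_p4 (by norm_num) (by norm_num) (by decide)
    · exact fin1 sk_p5 (by norm_num) (by norm_num) (by decide)
    · exact fin1 sk_p6 (by norm_num) (by norm_num) (by decide)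
    · exact fin1 sk_p7 (by norm_num) (by norm_num) (by decide)
    · exact fin2 sk_p8
    · exact fin1 ok_9 (by norm_num) (by norm_num) (by decide)
lemma mset_m1 : (Mset (-1)).ncard = 1 := by
  have : Mset (-1) = {((1:ℤ), (0:ℤ))} := by
    ext ⟨x, y⟩
    simp only [Mset, Set.mem_ofPred_eq, Set.mem_singleton_iff, Prod.mk.injEq]
    constructor
    · intro h
      have := pts_m1 h
      subst this
      norm_num at h
      exact ⟨rfl, h⟩
    · rintro ⟨rfl, rfl⟩; norm_num
  rw [this, Set.ncard_singleton]
lemma mset_1 : (Mset 1).ncard = 0 ∨ 3 ≤ (Mset 1).ncard := by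
  by_cases hf : (Mset 1).Finite
  · right
    have hs : (({((0:ℤ),(1:ℤ)), (0,-1), (-1,0)} : Finset (ℤ×ℤ)) : Set (ℤ×ℤ)) ⊆ Mset 1 := by
      intro P hP
      simp only [Finset.coe_insert, Finset.coe_singleton, Set.mem_insert_iff, Set.mem_singleton_iff] at hP
      rcases hP with rfl | rfl | rfl <;> simp [Mset]
    have := Set.ncard_le_ncard hs hf
    rw [Set.ncard_coe_finset] at this
    exact le_trans (by decide) this
  · left; exact Set.Infinite.ncard hf
lemma final (k : ℤ) (hk : k ≠ 0) (h1 : k ≠ -1) : (Mset k).ncard ≠ 2*k.natAbs ∧ (Mset k).ncard + 1 ≠ 2*k.natAbs := by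
  by_cases hk1 : k = 1
  · subst hk1
    have := mset_1
    simp only [Int.natAbs_one]
    omega
  have : (Mset k).ncard + 1 < 2*k.natAbs := by
    rcases lt_or_gt_of_ne hk with h | h
    · obtain ⟨K, rfl⟩ : ∃ K : ℕ, k = -(K:ℤ) := ⟨k.natAbs, by omega⟩
      exact mainN K (by omega)
    · obtain ⟨K, rfl⟩ : ∃ K : ℕ, k = (K:ℤ) := ⟨k.natAbs, by omega⟩
      exact mainP K (by omega)
  omega

end
/-- Excluding the point at infinity, no nonzero integer `k` has
`#{(x,y) : y² = x³ + k} = 2|k|`; including the point at infinity, the only nonzero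
integer `k` with `#{(x,y) : y² = x³ + k} + 1 = 2|k|` is `k = -1`. -/
theorem stmt_3 :
    ({k : ℤ | k ≠ 0 ∧
        Set.ncard {p : ℤ × ℤ | p.2 ^ 2 = p.1 ^ 3 + k} = 2 * k.natAbs} = (∅ : Set ℤ)) ∧
    ({k : ℤ | k ≠ 0 ∧
        Set.ncard {p : ℤ × ℤ | p.2 ^ 2 = p.1 ^ 3 + k} + 1 = 2 * k.natAbs} =
      ({-1} : Set ℤ)) := by
  constructor
  · rw [Set.eq_empty_iff_forall_notMem]
    rintro k ⟨hk, h⟩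
    by_cases h1 : k = -1
    · subst h1
      have e := mset_m1
      simp only [Mset] at e
      rw [e] at h
      simp at h
    · exact (final k hk h1).1 h
  · ext k
    simp only [Set.mem_singleton_iff]
    constructor
    · rintro ⟨hk, h⟩
      by_contra h1
      exact (final k hk h1).2 h
    · rintro rfl
      refine ⟨by norm_num, ?_⟩
      have e := mset_m1
      simp only [Mset] at e
      rw [e]
      rfl
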